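/- arXiv:1010.1512 — 4 statements merged into one kernel-verified Lean document; each statement's English description precedes it below -/
import Mathlib

section
/- Assume either (i) p = 1 or p = 2 and λ_p > 0, or (ii) γ > 4d(κp + ρ). Then λ_p > 0 and there exists v_p ∈ ℓ²(ℤ^{pd}) with ‖v_p‖_{ℓ²} = 1 such that: v_p(x) > 0 for all x ∈ ℤ^{pd}; v_p is summable, i.e. Σ_{x} v_p(x) < ∞; H^p v_p = λ_p v_p; and for every x ∈ ℤ^{pd}, e^{−λ_p t} · (exp(t H^p_∞) 𝟙)(x) → ( Σ_{y ∈ ℤ^{pd}} v_p(y) ) · v_p(x) as t → ∞, i.e. the p-th mixed moment from the perspective of the catalyst satisfies ⟨∏_{i=1}^p u(t, Y_t + x_i)⟩ ~ e^{λ_p t} v_p(x) ‖v_p‖_{ℓ¹}. -/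
open Filter Topology BoundedContinuousFunction

section Hilbert

open scoped InnerProductSpace

variable {E : Type*} [NormedAddCommGroup E] [InnerProductSpace ℝ E]

theorem norm_sq_le_of_form_nonneg (D : E →L[ℝ] E) (hs : ∀ f g, ⟪D f, g⟫_ℝ = ⟪f, D g⟫_ℝ)
    (h0 : ∀ f, 0 ≤ ⟪D f, f⟫_ℝ) (f : E) : ‖D f‖ ^ 2 ≤ ‖D‖ * ⟪D f, f⟫_ℝ := by
  rcases (norm_nonneg D).eq_or_lt with h | h
  · have : D = 0 := norm_eq_zero.1 h.symm
    simp [this]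
  have h1 := h0 (f - ‖D‖⁻¹ • D f)
  have h2 : ⟪D (D f), D f⟫_ℝ ≤ ‖D‖ * ‖D f‖ ^ 2 := by
    calc ⟪D (D f), D f⟫_ℝ ≤ ‖D (D f)‖ * ‖D f‖ := real_inner_le_norm _ _
      _ ≤ (‖D‖ * ‖D f‖) * ‖D f‖ := by gcongr; exact D.le_opNorm _
      _ = _ := by ring
  have h3 : ⟪D (D f), f⟫_ℝ = ‖D f‖ ^ 2 := by rw [hs, real_inner_self_eq_norm_sq]
  have h4 : ⟪D f, D f⟫_ℝ = ‖D f‖ ^ 2 := real_inner_self_eq_norm_sq _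
  simp only [map_sub, map_smul, inner_sub_left, inner_sub_right, inner_smul_left,
    inner_smul_right, h3, h4, RCLike.conj_to_real] at h1
  have h5 : ‖D‖⁻¹ * (‖D‖⁻¹ * ⟪D (D f), D f⟫_ℝ) ≤ ‖D‖⁻¹ * ‖D f‖ ^ 2 := by
    calc _ ≤ ‖D‖⁻¹ * (‖D‖⁻¹ * (‖D‖ * ‖D f‖ ^ 2)) := by gcongr
      _ = _ := by field_simp
  have h6 : ‖D‖⁻¹ * ‖D f‖ ^ 2 ≤ ⟪D f, f⟫_ℝ := by linarith
  calc ‖D f‖ ^ 2 = ‖D‖ * (‖D‖⁻¹ * ‖D f‖ ^ 2) := by field_simp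
    _ ≤ _ := by gcongr

theorem eq_zero_of_form_eq_zero (D : E →L[ℝ] E) (hs : ∀ f g, ⟪D f, g⟫_ℝ = ⟪f, D g⟫_ℝ)
    (h0 : ∀ f, 0 ≤ ⟪D f, f⟫_ℝ) (f : E) (hf : ⟪D f, f⟫_ℝ ≤ 0) : D f = 0 := by
  have h1 := norm_sq_le_of_form_nonneg D hs h0 f
  have h2 : ‖D‖ * ⟪D f, f⟫_ℝ ≤ 0 := mul_nonpos_of_nonneg_of_nonpos (norm_nonneg _) hf
  have h3 : ‖D f‖ ^ 2 = 0 := le_antisymm (h1.trans h2) (sq_nonneg _)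
  simpa using h3

theorem isUnit_of_form_ge [CompleteSpace E] (D : E →L[ℝ] E) {c : ℝ} (hc : 0 < c)
    (h : ∀ f, c * ‖f‖ ^ 2 ≤ ⟪D f, f⟫_ℝ) : IsUnit D := by
  let B : E →L[ℝ] E →L[ℝ] ℝ := (innerSL ℝ).comp D
  have hB : IsCoercive B := ⟨c, hc, fun u => by
    have := h u
    simp only [B, ContinuousLinearMap.comp_apply, innerSL_apply_apply]
    linarith [sq ‖u‖, mul_assoc c ‖u‖ ‖u‖, congrArg (c * ·) (sq ‖u‖)]⟩
  have he : (hB.continuousLinearEquivOfBilin : E →L[ℝ] E) = D := by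
    ext1 v
    refine ext_inner_right ℝ fun w => ?_
    have := hB.continuousLinearEquivOfBilin_apply v w
    simp [B]
  rw [← he]
  exact ⟨ContinuousLinearEquiv.toUnit hB.continuousLinearEquivOfBilin, rfl⟩

theorem isGreatest_sSup_spectrum [CompleteSpace E] [Nontrivial E] (T : E →L[ℝ] E)
    (hs : ∀ f g, ⟪T f, g⟫_ℝ = ⟪f, T g⟫_ℝ) :
    sSup (spectrum ℝ T) ∈ spectrum ℝ T ∧
      ∀ f, ⟪T f, f⟫_ℝ ≤ sSup (spectrum ℝ T) * ‖f‖ ^ 2 := by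
  set S : Set ℝ := {c | ∀ f, ⟪T f, f⟫_ℝ ≤ c * ‖f‖ ^ 2} with hS
  have hform : ∀ (c : ℝ) f, ⟪(algebraMap ℝ (E →L[ℝ] E) c - T) f, f⟫_ℝ
      = c * ‖f‖ ^ 2 - ⟪T f, f⟫_ℝ := fun c f => by
    simp [Algebra.algebraMap_eq_smul_one, inner_sub_left, inner_smul_left]
  have hsym : ∀ (c : ℝ) f g, ⟪(algebraMap ℝ (E →L[ℝ] E) c - T) f, g⟫_ℝ
      = ⟪f, (algebraMap ℝ (E →L[ℝ] E) c - T) g⟫_ℝ := fun c f g => by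
    simp [Algebra.algebraMap_eq_smul_one, inner_sub_left, inner_sub_right, inner_smul_left,
      inner_smul_right, hs]
  have hne : S.Nonempty := ⟨‖T‖, fun f => by
    calc ⟪T f, f⟫_ℝ ≤ ‖T f‖ * ‖f‖ := real_inner_le_norm _ _
      _ ≤ (‖T‖ * ‖f‖) * ‖f‖ := by gcongr; exact T.le_opNorm _
      _ = _ := by ring⟩
  obtain ⟨g, hg⟩ := exists_ne (0 : E)
  have hgpos : 0 < ‖g‖ ^ 2 := by positivity
  have hbdd : BddBelow S := ⟨⟪T g, g⟫_ℝ / ‖g‖ ^ 2, fun c hc => by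
    rw [div_le_iff₀ hgpos]; exact hc g⟩
  have hclosed : IsClosed S := by
    have : S = ⋂ f, {c : ℝ | ⟪T f, f⟫_ℝ ≤ c * ‖f‖ ^ 2} := by ext; simp [hS]
    rw [this]
    exact isClosed_iInter fun f => isClosed_le continuous_const (by fun_prop)
  have hmem : sInf S ∈ S := hclosed.csInf_mem hne hbdd
  set m := sInf S
  have hspec : m ∈ spectrum ℝ T := by
    rw [spectrum.mem_iff]
    intro hu
    set D := algebraMap ℝ (E →L[ℝ] E) m - T with hD
    obtain ⟨u, hu⟩ := hu
    have hinv : ∀ f, (↑u⁻¹ : E →L[ℝ] E) (D f) = f := fun f => by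
      rw [← hu, ← mul_apply_eq_comp, Units.inv_mul]; rfl
    set K := ‖(↑u⁻¹ : E →L[ℝ] E)‖
    have hK : ∀ f, ‖f‖ ≤ K * ‖D f‖ := fun f => by
      conv_lhs => rw [← hinv f]
      exact ContinuousLinearMap.le_opNorm _ _
    have hKpos : 0 < K := by
      rcases (norm_nonneg (↑u⁻¹ : E →L[ℝ] E)).eq_or_lt with h | h
      · have := hK g
        rw [show K = 0 from h.symm, zero_mul] at this
        exact absurd (norm_pos_iff.2 hg) (not_lt.2 this)
      · exact h
    have hDpos : 0 < ‖D‖ := by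
      rw [norm_pos_iff]
      intro h
      have := hinv g
      rw [h] at this
      simp at this
      exact hg this.symm
    have h0 : ∀ f, 0 ≤ ⟪D f, f⟫_ℝ := fun f => by
      rw [hform]; linarith [hmem f]
    have hlow : ∀ f, (K ^ 2 * ‖D‖)⁻¹ * ‖f‖ ^ 2 ≤ ⟪D f, f⟫_ℝ := fun f => by
      rw [inv_mul_le_iff₀ (by positivity)]
      calc ‖f‖ ^ 2 ≤ (K * ‖D f‖) ^ 2 := by gcongr; exact hK f
        _ = K ^ 2 * ‖D f‖ ^ 2 := by ring
        _ ≤ K ^ 2 * (‖D‖ * ⟪D f, f⟫_ℝ) := by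
          gcongr; exact norm_sq_le_of_form_nonneg D (hsym m) h0 f
        _ = _ := by ring
    have : m - (K ^ 2 * ‖D‖)⁻¹ ∈ S := fun f => by
      have h1 := hlow f
      rw [hform] at h1
      linarith
    have h2 := csInf_le hbdd this
    have h3 : 0 < (K ^ 2 * ‖D‖)⁻¹ := by positivity
    linarith
  have hgr : IsGreatest (spectrum ℝ T) m := by
    refine ⟨hspec, fun μ hμ => ?_⟩
    by_contra! hlt
    rw [spectrum.mem_iff] at hμ
    refine hμ (isUnit_of_form_ge _ (sub_pos.2 hlt) fun f => ?_)
    rw [hform]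
    have := hmem f
    linarith
  rw [hgr.csSup_eq]
  exact ⟨hspec, hmem⟩

theorem exists_eigenvector_of_compact_perturbation [CompleteSpace E] (T Q : E →L[ℝ] E)
    (hQ : IsCompactOperator Q) {l c : ℝ} (hl : l ∈ spectrum ℝ T) (hc : 0 < c)
    (h : ∀ f, c * ‖f‖ ^ 2 ≤ ⟪l • f - T f + Q f, f⟫_ℝ) :
    ∃ v, v ≠ 0 ∧ T v = l • v := by
  set D : E →L[ℝ] E := algebraMap ℝ (E →L[ℝ] E) l - T + Q with hD
  have hDf : ∀ f, D f = l • f - T f + Q f := fun f => by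
    simp [hD, Algebra.algebraMap_eq_smul_one]
  obtain ⟨u, hu⟩ := isUnit_of_form_ge D hc (fun f => by rw [hDf]; exact h f)
  set R : E →L[ℝ] E := ↑u⁻¹ * Q with hR
  have hRc : IsCompactOperator R := hQ.clm_comp (↑u⁻¹ : E →L[ℝ] E)
  have hfac : algebraMap ℝ (E →L[ℝ] E) l - T = ↑u * (algebraMap ℝ (E →L[ℝ] E) 1 - R) := by
    rw [mul_sub, hR, ← mul_assoc, Units.mul_inv, hu, hD]
    simp
  rcases hRc.hasEigenvalue_or_mem_resolventSet (one_ne_zero (α := ℝ)) with h1 | h1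
  · obtain ⟨v, hv⟩ := h1.exists_hasEigenvector
    refine ⟨v, hv.2, ?_⟩
    have h2 : R v = v := by simpa using hv.apply_eq_smul
    have h3 := congrArg (fun S : E →L[ℝ] E => S v) hfac
    simp [Algebra.algebraMap_eq_smul_one, h2] at h3
    exact (sub_eq_zero.1 h3).symm
  · exfalso
    rw [spectrum.mem_iff] at hl
    rw [spectrum.mem_resolventSet_iff] at h1
    apply hl
    rw [hfac]
    exact u.isUnit.mul h1

theorem hasDerivAt_exp_neg_smul_apply [CompleteSpace E] (D : E →L[ℝ] E) (f : E) (t : ℝ) :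
    HasDerivAt (fun t : ℝ => NormedSpace.exp (t • (-D)) f)
      (-(D (NormedSpace.exp (t • (-D)) f))) t := by
  have h := hasDerivAt_exp_smul_const' (𝕂 := ℝ) (-D) t
  have := h.clm_apply (hasDerivAt_const t f)
  simpa using this

theorem norm_exp_neg_smul_apply_le [CompleteSpace E] (D : E →L[ℝ] E)
    (h0 : ∀ f, 0 ≤ ⟪D f, f⟫_ℝ) (f : E) {t : ℝ} (ht : 0 ≤ t) :
    ‖NormedSpace.exp (t • (-D)) f‖ ≤ ‖f‖ := by
  have hd : ∀ t, HasDerivAt (fun t : ℝ => ‖NormedSpace.exp (t • (-D)) f‖ ^ 2) _ t :=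
    fun t => (hasDerivAt_exp_neg_smul_apply D f t).norm_sq
  have := antitone_of_hasDerivAt_nonpos hd (fun t => by
    simp only [inner_neg_right]
    have := h0 (NormedSpace.exp (t • (-D)) f)
    rw [real_inner_comm] at this
    simp only [Pi.zero_apply]
    linarith) ht
  simp only [zero_smul, NormedSpace.exp_zero] at this
  exact (sq_le_sq₀ (norm_nonneg _) (norm_nonneg _)).1 this

theorem tendsto_exp_neg_smul_apply_of_range [CompleteSpace E] (D : E →L[ℝ] E)
    (hs : ∀ f g, ⟪D f, g⟫_ℝ = ⟪f, D g⟫_ℝ) (h0 : ∀ f, 0 ≤ ⟪D f, f⟫_ℝ) (g : E) :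
    Tendsto (fun t : ℝ => NormedSpace.exp (t • (-D)) (D g)) atTop (𝓝 0) := by
  set a : ℝ → E := fun t => NormedSpace.exp (t • (-D)) g with ha
  have hcomm : ∀ t : ℝ, NormedSpace.exp (t • (-D)) (D g) = D (a t) := fun t => by
    have h1 : Commute D (NormedSpace.exp (t • (-D))) :=
      (((Commute.refl D).neg_right).smul_right t).exp_right
    exact (congrArg (fun S : E →L[ℝ] E => S g) h1.eq).symm
  simp only [hcomm]
  have hda : ∀ t, HasDerivAt a (-(D (a t))) t := hasDerivAt_exp_neg_smul_apply D g
  have hdD : ∀ t, HasDerivAt (fun t => D (a t)) (D (-(D (a t)))) t :=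
    fun t => D.hasFDerivAt.comp_hasDerivAt t (hda t)
  have hdm : ∀ t, HasDerivAt (fun t => ⟪D (a t), a t⟫_ℝ + 2 * t * ‖D (a t)‖ ^ 2)
      (-(4 * t * ⟪D (D (a t)), D (a t)⟫_ℝ)) t := fun t => by
    have := ((hdD t).inner ℝ (hda t)).add
      (((hasDerivAt_id t).const_mul 2).mul (hdD t).norm_sq)
    refine this.congr_deriv ?_
    have h1 : ⟪D (D (a t)), a t⟫_ℝ = ‖D (a t)‖ ^ 2 := by rw [hs, real_inner_self_eq_norm_sq]
    have h2 : ⟪D (a t), D (D (a t))⟫_ℝ = ⟪D (D (a t)), D (a t)⟫_ℝ := real_inner_comm _ _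
    simp only [inner_neg_right, inner_neg_left, map_neg, h1, h2, real_inner_self_eq_norm_sq, id]
    ring
  have hanti : AntitoneOn (fun t => ⟪D (a t), a t⟫_ℝ + 2 * t * ‖D (a t)‖ ^ 2) (Set.Ici 0) := by
    refine antitoneOn_of_deriv_nonpos (convex_Ici 0)
      (fun t _ => (hdm t).continuousAt.continuousWithinAt)
      (fun t _ => (hdm t).differentiableAt.differentiableWithinAt) fun t ht => ?_
    rw [(hdm t).deriv]
    rw [interior_Ici] at ht
    have := h0 (D (a t))
    have ht' : (0 : ℝ) < t := ht
    have : 0 ≤ 4 * t * ⟪D (D (a t)), D (a t)⟫_ℝ := by positivity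
    linarith
  set C := ⟪D g, g⟫_ℝ
  have hb : ∀ t : ℝ, 0 < t → ‖D (a t)‖ ^ 2 ≤ C / (2 * t) := fun t ht => by
    have h1 := hanti (Set.mem_Ici.2 le_rfl) (Set.mem_Ici.2 ht.le) ht.le
    have h2 := h0 (a t)
    simp only [ha, zero_smul, NormedSpace.exp_zero, mul_zero, zero_mul, add_zero,
      one_apply_eq_self] at h1
    rw [le_div_iff₀ (by positivity)]
    simp only [ha] at h2 ⊢
    linarith
  have hlim : Tendsto (fun t : ℝ => C / (2 * t)) atTop (𝓝 0) :=
    tendsto_const_nhds.div_atTop (tendsto_id.const_mul_atTop (by norm_num))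
  have hsq : Tendsto (fun t => ‖D (a t)‖ ^ 2) atTop (𝓝 0) :=
    tendsto_of_tendsto_of_tendsto_of_le_of_le' tendsto_const_nhds hlim
      (Eventually.of_forall fun t => sq_nonneg _)
      ((eventually_gt_atTop 0).mono hb)
  rw [tendsto_zero_iff_norm_tendsto_zero]
  have := hsq.sqrt
  simpa [Real.sqrt_sq (norm_nonneg _)] using this

theorem tendsto_exp_neg_smul_apply [CompleteSpace E] (D : E →L[ℝ] E)
    (hs : ∀ f g, ⟪D f, g⟫_ℝ = ⟪f, D g⟫_ℝ) (h0 : ∀ f, 0 ≤ ⟪D f, f⟫_ℝ) (v : E)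
    (hv : ‖v‖ = 1) (hDv : D v = 0) (hker : ∀ g, D g = 0 → ∃ c : ℝ, g = c • v) (f : E) :
    Tendsto (fun t : ℝ => NormedSpace.exp (t • (-D)) f) atTop (𝓝 (⟪v, f⟫_ℝ • v)) := by
  have hfix : ∀ t : ℝ, NormedSpace.exp (t • (-D)) v = v := fun t => by
    have := is_const_of_deriv_eq_zero
      (f := fun t : ℝ => NormedSpace.exp (t • (-D)) v)
      (fun t => (hasDerivAt_exp_neg_smul_apply D v t).differentiableAt) (fun t => by
        rw [(hasDerivAt_exp_neg_smul_apply D v t).deriv]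
        have h1 : Commute D (NormedSpace.exp (t • (-D))) :=
          (((Commute.refl D).neg_right).smul_right t).exp_right
        have h2 := congrArg (fun S : E →L[ℝ] E => S v) h1.eq
        simp only [mul_apply_eq_comp, hDv, map_zero] at h2
        rw [h2, neg_zero]) t 0
    simpa using this
  set f' := f - ⟪v, f⟫_ℝ • v with hf'
  have hperp : f' ∈ D.kerᗮ := by
    rw [Submodule.mem_orthogonal]
    intro w hw
    obtain ⟨c, rfl⟩ := hker w hw
    simp [hf', inner_sub_right, inner_smul_left, inner_smul_right, hv]
    ring
  have hadj : ContinuousLinearMap.adjoint D = D :=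
    ((ContinuousLinearMap.eq_adjoint_iff D D).2 hs).symm
  rw [ContinuousLinearMap.orthogonal_ker, hadj] at hperp
  have hcl : f' ∈ closure (Set.range D) := by
    rw [← SetLike.mem_coe, Submodule.topologicalClosure_coe] at hperp
    exact hperp
  have hlim : Tendsto (fun t : ℝ => NormedSpace.exp (t • (-D)) f') atTop (𝓝 0) := by
    rw [Metric.tendsto_nhds]
    intro ε hε
    obtain ⟨_, ⟨g, rfl⟩, hg⟩ := Metric.mem_closure_iff.1 hcl (ε / 2) (by positivity)
    have h1 := Metric.tendsto_nhds.1 (tendsto_exp_neg_smul_apply_of_range D hs h0 g) (ε / 2)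
      (by positivity)
    filter_upwards [h1, eventually_ge_atTop 0] with t ht ht0
    rw [dist_zero_right] at ht ⊢
    have h2 := norm_exp_neg_smul_apply_le D h0 (f' - D g) ht0
    rw [dist_eq_norm] at hg
    rw [map_sub] at h2
    have h3 := norm_add_le (NormedSpace.exp (t • (-D)) f' - NormedSpace.exp (t • (-D)) (D g))
      (NormedSpace.exp (t • (-D)) (D g))
    rw [sub_add_cancel] at h3
    linarith
  have hsum := hlim.add_const (⟪v, f⟫_ℝ • v)
  rw [zero_add] at hsum
  refine hsum.congr fun t => ?_
  rw [hf', map_sub, map_smul, hfix, sub_add_cancel]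

end Hilbert

section LatticeOperator

variable {X ι : Type*} [AddCommGroup X] [Fintype ι]

/-- The lattice Schrödinger operator with symmetric jump rates `c i` along `± e i` and potential
`W`. -/
noncomputable def latticeOp (e : ι → X) (c : ι → ℝ) (W : X → ℝ) (f : X → ℝ) (x : X) : ℝ :=
  ∑ i, c i * ((f (x + e i) - f x) + (f (x - e i) - f x)) + W x * f x

variable {e : ι → X} {c : ι → ℝ} {W : X → ℝ} {w : ℝ}

theorem summable_mul_shift_of_bounded {φ q : X → ℝ} {C : ℝ} (hφ : ∀ x, |φ x| ≤ C)
    (hq : Summable q) (y : X) : Summable fun x => φ x * q (x + y) := by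
  have h1 : Summable fun x => |q (x + y)| := ((Equiv.addRight y).summable_iff.2 hq).abs
  refine Summable.of_norm_bounded (h1.mul_left C) fun x => ?_
  rw [norm_mul]
  exact mul_le_mul_of_nonneg_right (hφ x) (norm_nonneg _)

theorem summable_mul_shift_of_sq {f g : X → ℝ} (hf : Summable fun x => f x ^ 2)
    (hg : Summable fun x => g x ^ 2) (y : X) : Summable fun x => f x * g (x + y) := by
  have h1 : Summable fun x => g (x + y) ^ 2 :=
    ((Equiv.addRight y).summable_iff (f := fun x => g x ^ 2)).2 hg
  refine Summable.of_norm_bounded (hf.add h1) fun x => ?_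
  rw [norm_mul, Real.norm_eq_abs, Real.norm_eq_abs, ← sq_abs (f x), ← sq_abs (g (x + y))]
  have h := two_mul_le_add_sq |f x| |g (x + y)|
  have h' : 0 ≤ |f x| * |g (x + y)| := by positivity
  linarith

theorem hasSum_mul_latticeOp (hW : ∀ x, |W x| ≤ w) {f g : X → ℝ}
    (hfg : ∀ y, Summable fun x => f x * g (x + y)) :
    HasSum (fun x => f x * latticeOp e c W g x)
      (∑ i, c i * (((∑' x, f x * g (x + e i)) - ∑' x, f x * g x)
        + ((∑' x, f x * g (x - e i)) - ∑' x, f x * g x)) + ∑' x, W x * (f x * g x)) := by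
  have h0 : Summable fun x => f x * g x := by simpa using hfg 0
  have hneg : ∀ y, Summable fun x => f x * g (x - y) := fun y => by
    simpa [sub_eq_add_neg] using hfg (-y)
  have hWs : Summable fun x => W x * (f x * g x) := by
    simpa using summable_mul_shift_of_bounded hW h0 0
  have := (hasSum_sum fun i (_ : i ∈ Finset.univ) =>
    ((((hfg (e i)).hasSum.sub h0.hasSum).add ((hneg (e i)).hasSum.sub h0.hasSum)).mul_left
      (c i))).add hWs.hasSum
  refine this.congr_fun fun x => ?_
  rw [latticeOp, mul_add, Finset.mul_sum]
  congr 1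
  · exact Finset.sum_congr rfl fun i _ => by ring
  · ring

theorem summable_shift_swap {f g : X → ℝ} (hfg : ∀ y, Summable fun x => f x * g (x + y)) (y : X) :
    Summable fun x => g x * f (x + y) := by
  have := (Equiv.addRight y).summable_iff.2 (hfg (-y))
  refine this.congr fun x => ?_
  simp [mul_comm]

theorem tsum_mul_latticeOp_comm (hW : ∀ x, |W x| ≤ w) {f g : X → ℝ}
    (hfg : ∀ y, Summable fun x => f x * g (x + y)) :
    ∑' x, f x * latticeOp e c W g x = ∑' x, g x * latticeOp e c W f x := by
  rw [(hasSum_mul_latticeOp hW hfg).tsum_eq,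
    (hasSum_mul_latticeOp hW (summable_shift_swap hfg)).tsum_eq]
  have h1 : ∀ y, ∑' x, f x * g (x + y) = ∑' x, g x * f (x - y) := fun y => by
    rw [← (Equiv.addRight y).tsum_eq (fun x => g x * f (x - y))]
    simp [mul_comm]
  have h2 : ∀ y, ∑' x, f x * g (x - y) = ∑' x, g x * f (x + y) := fun y => by
    rw [← (Equiv.addRight y).tsum_eq (fun x => f x * g (x - y))]
    simp [mul_comm]
  have h3 : ∑' x, f x * g x = ∑' x, g x * f x := tsum_congr fun x => mul_comm _ _
  congr 1
  · refine Finset.sum_congr rfl fun i _ => ?_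
    rw [h1, h2, h3]
    ring
  · exact tsum_congr fun x => by rw [mul_comm (f x)]

theorem latticeOp_add_mul (f : X → ℝ) (K : ℝ) (x : X) :
    latticeOp e c W f x + K * f x
      = ∑ i, c i * (f (x + e i) + f (x - e i)) + (W x + K - 2 * ∑ i, c i) * f x := by
  have : ∑ i, c i * ((f (x + e i) - f x) + (f (x - e i) - f x))
      = ∑ i, c i * (f (x + e i) + f (x - e i)) - 2 * (∑ i, c i) * f x := by
    rw [Finset.mul_sum, Finset.sum_mul, ← Finset.sum_sub_distrib]
    exact Finset.sum_congr rfl fun i _ => by ring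
  rw [latticeOp, this]
  ring

theorem latticeOp_add_mul_nonneg (hc : ∀ i, 0 ≤ c i) (hW : ∀ x, |W x| ≤ w) {K : ℝ}
    (hK : w + 2 * ∑ i, c i ≤ K) {f : X → ℝ} (hf : ∀ x, 0 ≤ f x) (x : X) :
    0 ≤ latticeOp e c W f x + K * f x := by
  rw [latticeOp_add_mul]
  have h1 := (abs_le.1 (hW x)).1
  refine add_nonneg (Finset.sum_nonneg fun i _ =>
    mul_nonneg (hc i) (add_nonneg (hf _) (hf _))) (mul_nonneg ?_ (hf x))
  linarith

/-- The resolvent equation has a nonnegative summable solution as soon as the operator has a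
supersolution bounded away from zero and infinity. -/
theorem exists_summable_solution (hc : ∀ i, 0 ≤ c i) (hW : ∀ x, |W x| ≤ w) {φ : X → ℝ}
    {η C b l : ℝ} (hη : 0 < η) (hφη : ∀ x, η ≤ φ x) (hφC : ∀ x, φ x ≤ C)
    (hφ : ∀ x, latticeOp e c W φ x ≤ b * φ x) (hbl : b < l) {g : X → ℝ} (hg0 : ∀ x, 0 ≤ g x)
    (hg : Summable g) :
    ∃ h : X → ℝ, (∀ x, 0 ≤ h x) ∧ Summable h ∧ ∀ x, l * h x - latticeOp e c W h x = g x := by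
  have hc0 : 0 ≤ ∑ i, c i := Finset.sum_nonneg fun i _ => hc i
  have hw0 : 0 ≤ w := (abs_nonneg _).trans (hW 0)
  set K := w + 2 * ∑ i, c i + |b| + |l| + 1 with hK
  have hKb : 0 ≤ b + K := by linarith [neg_abs_le b, abs_nonneg l]
  have hKl : 0 < l + K := by linarith
  set θ := (b + K) / (l + K) with hθ
  have hθ0 : 0 ≤ θ := by positivity
  have hθ1 : θ < 1 := by rw [hθ, div_lt_one hKl]; linarith
  have hφabs : ∀ x, |φ x| ≤ C := fun x => by
    rw [abs_of_nonneg (hη.le.trans (hφη x))]; exact hφC x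
  set T : (X → ℝ) → X → ℝ := fun f x => (latticeOp e c W f x + K * f x) / (l + K) with hT
  have hTnn : ∀ f : X → ℝ, (∀ x, 0 ≤ f x) → ∀ x, 0 ≤ T f x := fun f hf x =>
    div_nonneg (latticeOp_add_mul_nonneg hc hW (by linarith [abs_nonneg b, abs_nonneg l]) hf x)
      hKl.le
  have hTφ : ∀ f : X → ℝ, (∀ x, 0 ≤ f x) → Summable f → Summable (T f) ∧
      ∑' x, φ x * T f x ≤ θ * ∑' x, φ x * f x := by
    intro f hf hfs
    have hs := summable_mul_shift_of_bounded hφabs hfs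
    have hs1 := summable_mul_shift_of_bounded (φ := fun _ => (1 : ℝ)) (C := 1) (by simp) hfs
    have hφf : Summable fun x => φ x * f x := by simpa using hs 0
    have h1 : Summable (latticeOp e c W f) := by
      simpa using (hasSum_mul_latticeOp (e := e) (c := c) hW hs1).summable
    refine ⟨(h1.add (hfs.mul_left K)).div_const _, ?_⟩
    have h2 := hasSum_mul_latticeOp (e := e) (c := c) hW hs
    have h3 : ∑' x, φ x * T f x
        = (∑' x, f x * latticeOp e c W φ x + K * ∑' x, φ x * f x) / (l + K) := by
      rw [← tsum_mul_latticeOp_comm hW hs, ← tsum_mul_left,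
        ← h2.summable.tsum_add (hφf.mul_left K), ← tsum_div_const]
      exact tsum_congr fun x => by simp only [hT]; ring
    have h4 : ∑' x, f x * latticeOp e c W φ x ≤ b * ∑' x, φ x * f x := by
      rw [← tsum_mul_left]
      refine Summable.tsum_le_tsum (fun x => ?_)
        (hasSum_mul_latticeOp hW (summable_shift_swap hs)).summable (hφf.mul_left b)
      calc f x * latticeOp e c W φ x ≤ f x * (b * φ x) :=
            mul_le_mul_of_nonneg_left (hφ x) (hf x)
        _ = _ := by ring
    rw [h3, hθ, div_mul_eq_mul_div]
    gcongr
    linarith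
  set F : ℕ → X → ℝ := fun n => T^[n] g with hF
  have hFs : ∀ n x, F (n + 1) x = T (F n) x := fun n x => by
    simp only [hF, Function.iterate_succ_apply']
  have hF0 : ∀ n x, 0 ≤ F n x := fun n => by
    induction n with
    | zero => exact hg0
    | succ n ih => intro x; rw [hFs]; exact hTnn _ ih x
  have hFsum : ∀ n, Summable (F n) := fun n => by
    induction n with
    | zero => exact hg
    | succ n ih => exact (hTφ _ (hF0 n) ih).1.congr fun x => (hFs n x).symm
  set S := ∑' x, φ x * g x with hS
  have hFφ : ∀ n, ∑' x, φ x * F n x ≤ θ ^ n * S := fun n => by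
    induction n with
    | zero => simp [hF, hS]
    | succ n ih =>
      simp only [hFs]
      calc _ ≤ θ * ∑' x, φ x * F n x := (hTφ _ (hF0 n) (hFsum n)).2
        _ ≤ θ * (θ ^ n * S) := by gcongr
        _ = _ := by ring
  have hbound : ∀ n (s : Finset X), ∑ x ∈ s, F n x ≤ θ ^ n * (S / η) := fun n s => by
    have h1 : Summable fun x => φ x * F n x := by
      simpa using summable_mul_shift_of_bounded hφabs (hFsum n) 0
    have h2 : ∑ x ∈ s, φ x * F n x ≤ θ ^ n * S :=
      (h1.sum_le_tsum s fun x _ => mul_nonneg (hη.le.trans (hφη x)) (hF0 n x)).trans (hFφ n)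
    have h3 : η * ∑ x ∈ s, F n x ≤ ∑ x ∈ s, φ x * F n x := by
      rw [Finset.mul_sum]
      exact Finset.sum_le_sum fun x _ => mul_le_mul_of_nonneg_right (hφη x) (hF0 n x)
    rw [mul_div_assoc', le_div_iff₀ hη]
    linarith
  have hgeo : Summable fun n : ℕ => θ ^ n * (S / η) :=
    (summable_geometric_of_lt_one hθ0 hθ1).mul_right _
  have hFn : ∀ x, Summable fun n => F n x := fun x =>
    Summable.of_nonneg_of_le (fun n => hF0 n x) (fun n => by simpa using hbound n {x}) hgeo
  set h0 : X → ℝ := fun x => ∑' n, F n x with hh0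
  have hh0nn : ∀ x, 0 ≤ h0 x := fun x => tsum_nonneg fun n => hF0 n x
  have hh0s : Summable h0 := by
    refine summable_of_sum_le hh0nn (c := ∑' n : ℕ, θ ^ n * (S / η)) fun s => ?_
    rw [← Summable.tsum_finsetSum fun x _ => hFn x]
    exact Summable.tsum_le_tsum (fun n => hbound n s) (summable_sum fun x _ => hFn x) hgeo
  have hTh : ∀ x, T h0 x = h0 x - g x := fun x => by
    have h1 : HasSum (fun n => T (F n) x) (T h0 x) := by
      have hh : ∀ x, HasSum (fun n => F n x) (h0 x) := fun x => (hFn x).hasSum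
      exact ((((hasSum_sum fun i (_ : i ∈ Finset.univ) =>
        ((((hh (x + e i)).sub (hh x)).add ((hh (x - e i)).sub (hh x))).mul_left (c i))).add
          ((hh x).mul_left (W x))).add ((hh x).mul_left K)).div_const (l + K))
    have h2 : h0 x = F 0 x + ∑' n, F (n + 1) x := (hFn x).tsum_eq_zero_add
    simp only [hFs, h1.tsum_eq] at h2
    rw [h2]
    simp [hF]
  refine ⟨fun x => h0 x / (l + K), fun x => div_nonneg (hh0nn x) hKl.le,
    hh0s.div_const _, fun x => ?_⟩
  have h1 : latticeOp e c W (fun x => h0 x / (l + K)) x = latticeOp e c W h0 x / (l + K) := by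
    simp only [latticeOp, add_div, Finset.sum_div]
    congr 1
    · exact Finset.sum_congr rfl fun i _ => by ring
    · ring
  have h2 := hTh x
  simp only [hT] at h2
  rw [div_eq_iff hKl.ne'] at h2
  rw [h1, mul_div_assoc', ← sub_div, div_eq_iff hKl.ne']
  linarith

/-- A bounded positive supersolution controls the quadratic form. -/
theorem form_le_of_supersolution (hc : ∀ i, 0 ≤ c i) (hW : ∀ x, |W x| ≤ w) {φ : X → ℝ}
    {η C b : ℝ} (hη : 0 < η) (hφη : ∀ x, η ≤ φ x) (hφC : ∀ x, φ x ≤ C)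
    (hφ : ∀ x, latticeOp e c W φ x ≤ b * φ x) {f : X → ℝ} (hf : Summable fun x => f x ^ 2) :
    ∑' x, f x * latticeOp e c W f x ≤ b * ∑' x, f x ^ 2 := by
  have hφpos : ∀ x, 0 < φ x := fun x => hη.trans_le (hφη x)
  have hφabs : ∀ x, |φ x| ≤ C := fun x => by rw [abs_of_pos (hφpos x)]; exact hφC x
  set q : X → ℝ := fun x => f x ^ 2 / φ x with hq
  have hq0 : ∀ x, 0 ≤ q x := fun x => div_nonneg (sq_nonneg _) (hφpos x).le
  have hqs : Summable q := Summable.of_nonneg_of_le hq0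
    (fun x => div_le_div_of_nonneg_left (sq_nonneg _) hη (hφη x)) (hf.div_const η)
  have hqφ : ∀ x, q x * φ x = f x ^ 2 := fun x => div_mul_cancel₀ _ (hφpos x).ne'
  have hs := summable_mul_shift_of_bounded hφabs hqs
  have h1 := (hasSum_mul_latticeOp (e := e) (c := c) hW hs).summable
  have h2 := (hasSum_mul_latticeOp (e := e) (c := c) hW (summable_shift_swap hs)).summable
  have h3 := (hasSum_mul_latticeOp (e := e) (c := c) hW
    (fun y => summable_mul_shift_of_sq hf hf y)).summable
  have hpt : ∀ x y, f x * f y ≤ (φ x * q y + q x * φ y) / 2 := fun x y => by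
    have hfx : f x = (f x / φ x) * φ x := (div_mul_cancel₀ _ (hφpos x).ne').symm
    have hfy : f y = (f y / φ y) * φ y := (div_mul_cancel₀ _ (hφpos y).ne').symm
    have hqx : q x = (f x / φ x) ^ 2 * φ x := by
      have := (hφpos x).ne'
      simp only [hq]; field_simp
    have hqy : q y = (f y / φ y) ^ 2 * φ y := by
      have := (hφpos y).ne'
      simp only [hq]; field_simp
    rw [hqx, hqy]
    conv_lhs => rw [hfx, hfy]
    nlinarith [mul_nonneg (mul_nonneg (hφpos x).le (hφpos y).le)
      (sq_nonneg (f x / φ x - f y / φ y))]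
  calc ∑' x, f x * latticeOp e c W f x
      ≤ ∑' x, (φ x * latticeOp e c W q x + q x * latticeOp e c W φ x) / 2 := by
        refine Summable.tsum_le_tsum (fun x => ?_) h3 ((h1.add h2).div_const 2)
        have e1 : (φ x * latticeOp e c W q x + q x * latticeOp e c W φ x) / 2
            = ∑ i, c i * ((φ x * q (x + e i) + q x * φ (x + e i)) / 2
              + (φ x * q (x - e i) + q x * φ (x - e i)) / 2 - 2 * f x ^ 2) + W x * f x ^ 2 := by
          simp only [latticeOp, mul_add, Finset.mul_sum]
          rw [add_add_add_comm, ← Finset.sum_add_distrib, add_div, Finset.sum_div]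
          congr 1
          · refine Finset.sum_congr rfl fun i _ => ?_
            linear_combination (-2 * c i) * hqφ x
          · linear_combination (W x) * hqφ x
        have e2 : f x * latticeOp e c W f x
            = ∑ i, c i * (f x * f (x + e i) + f x * f (x - e i) - 2 * f x ^ 2)
              + W x * f x ^ 2 := by
          simp only [latticeOp, mul_add, Finset.mul_sum]
          congr 1
          · exact Finset.sum_congr rfl fun i _ => by ring
          · ring
        rw [e1, e2]
        gcongr with i _
        · exact hc i
        · exact hpt _ _
        · exact hpt _ _
    _ = ∑' x, q x * latticeOp e c W φ x := by
        rw [tsum_div_const, h1.tsum_add h2, tsum_mul_latticeOp_comm hW hs]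
        ring
    _ ≤ ∑' x, b * f x ^ 2 := by
        refine Summable.tsum_le_tsum (fun x => ?_) h2 (hf.mul_left b)
        rw [← hqφ x]
        calc q x * latticeOp e c W φ x ≤ q x * (b * φ x) :=
              mul_le_mul_of_nonneg_left (hφ x) (hq0 x)
          _ = _ := by ring
    _ = _ := tsum_mul_left

end LatticeOperator


section SquareSummable

open scoped InnerProductSpace

variable {X ι : Type*}

theorem lp_two_summable_sq (f : lp (fun _ : X => ℝ) 2) : Summable fun x => f x ^ 2 := by
  simpa [sq] using lp.summable_inner (𝕜 := ℝ) f f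

theorem lp_two_inner_eq_tsum (f g : lp (fun _ : X => ℝ) 2) : ⟪f, g⟫_ℝ = ∑' x, f x * g x := by
  rw [lp.inner_eq_tsum]
  exact tsum_congr fun x => by simp [mul_comm]

theorem lp_two_norm_sq_eq_tsum (f : lp (fun _ : X => ℝ) 2) : ‖f‖ ^ 2 = ∑' x, f x ^ 2 := by
  rw [← real_inner_self_eq_norm_sq, lp_two_inner_eq_tsum]
  exact tsum_congr fun x => (sq _).symm

/-- The element of `ℓ²` given by a square-summable function. -/
noncomputable def lpTwoOfSq (f : X → ℝ) (hf : Summable fun x => f x ^ 2) :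
    lp (fun _ : X => ℝ) 2 :=
  ⟨f, memℓp_gen (by simpa using hf)⟩

@[simp]
theorem lpTwoOfSq_apply (f : X → ℝ) (hf : Summable fun x => f x ^ 2) (x : X) :
    lpTwoOfSq f hf x = f x := rfl

theorem summable_sq_of_nonneg {f : X → ℝ} (h0 : ∀ x, 0 ≤ f x) (hf : Summable f) :
    Summable fun x => f x ^ 2 :=
  Summable.of_nonneg_of_le (fun x => sq_nonneg _)
    (fun x => by
      rw [sq]
      exact mul_le_mul_of_nonneg_right (hf.le_tsum x fun y _ => h0 y) (h0 x))
    (hf.mul_left (∑' y, f y))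

theorem exists_compact_restriction (F : Finset X) :
    ∃ Q : lp (fun _ : X => ℝ) 2 →L[ℝ] lp (fun _ : X => ℝ) 2, IsCompactOperator Q ∧
      ∀ f x, Q f x = (F : Set X).indicator f x := by
  classical
  induction F using Finset.induction_on with
  | empty => exact ⟨0, isCompactOperator_zero, fun f x => by simp⟩
  | insert a s ha ih =>
    obtain ⟨Q, hQc, hQ⟩ := ih
    set δ : lp (fun _ : X => ℝ) 2 := lp.single 2 a 1
    refine ⟨(ContinuousLinearMap.toSpanSingleton ℝ δ).comp (innerSL ℝ δ) + Q,
      IsCompactOperator.add ?_ hQc, fun f x => ?_⟩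
    · have h : IsCompactOperator (innerSL ℝ δ : lp (fun _ : X => ℝ) 2 →L[ℝ] ℝ) :=
        isCompactOperator_of_locallyCompactSpace_dom _
      exact h.clm_comp (ContinuousLinearMap.toSpanSingleton ℝ δ)
    · have h1 : ⟪δ, f⟫_ℝ = f a := by simp [δ, lp.inner_single_left]
      have h2 : ((ContinuousLinearMap.toSpanSingleton ℝ δ).comp (innerSL ℝ δ) + Q) f x
          = f a * δ x + Q f x := by
        simp only [_root_.add_apply, ContinuousLinearMap.comp_apply, innerSL_apply_apply,
          ContinuousLinearMap.toSpanSingleton_apply, h1]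
        rfl
      rw [h2, hQ]
      by_cases hx : x = a
      · subst hx
        simp [δ, Set.indicator, ha]
      · simp [δ, Set.indicator, hx]

variable [AddCommGroup X] [Fintype ι] {e : ι → X} {c : ι → ℝ} {W : X → ℝ} {w : ℝ}
  {H : lp (fun _ : X => ℝ) 2 →L[ℝ] lp (fun _ : X => ℝ) 2}

theorem latticeOp_symmetric (hW : ∀ x, |W x| ≤ w) (hH : ∀ f x, H f x = latticeOp e c W f x)
    (f g : lp (fun _ : X => ℝ) 2) : ⟪H f, g⟫_ℝ = ⟪f, H g⟫_ℝ := by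
  rw [real_inner_comm, lp_two_inner_eq_tsum, lp_two_inner_eq_tsum]
  simp only [hH]
  exact tsum_mul_latticeOp_comm hW
    (summable_mul_shift_of_sq (lp_two_summable_sq g) (lp_two_summable_sq f))

theorem eigenvector_abs (hc : ∀ i, 0 ≤ c i) (hW : ∀ x, |W x| ≤ w)
    (hH : ∀ f x, H f x = latticeOp e c W f x) {l : ℝ} (hl : ∀ f, ⟪H f, f⟫_ℝ ≤ l * ‖f‖ ^ 2)
    {f g : lp (fun _ : X => ℝ) 2} (hf : H f = l • f) (hg : ∀ x, g x = |f x|) :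
    H g = l • g := by
  set D : lp (fun _ : X => ℝ) 2 →L[ℝ] lp (fun _ : X => ℝ) 2 :=
    l • ContinuousLinearMap.id ℝ _ - H with hD
  have hform : ∀ h, ⟪D h, h⟫_ℝ = l * ‖h‖ ^ 2 - ⟪H h, h⟫_ℝ := fun h => by
    simp [hD, inner_sub_left, inner_smul_left]
  have hs : ∀ f g, ⟪D f, g⟫_ℝ = ⟪f, D g⟫_ℝ := fun f g => by
    simp [hD, inner_sub_left, inner_sub_right, inner_smul_left, inner_smul_right,
      latticeOp_symmetric hW hH]
  have hnorm : ‖g‖ ^ 2 = ‖f‖ ^ 2 := by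
    rw [lp_two_norm_sq_eq_tsum, lp_two_norm_sq_eq_tsum]
    exact tsum_congr fun x => by rw [hg, sq_abs]
  have hle : ⟪H f, f⟫_ℝ ≤ ⟪H g, g⟫_ℝ := by
    rw [real_inner_comm, real_inner_comm g, lp_two_inner_eq_tsum, lp_two_inner_eq_tsum]
    simp only [hH]
    refine Summable.tsum_le_tsum (fun x => ?_)
      (hasSum_mul_latticeOp hW
        (summable_mul_shift_of_sq (lp_two_summable_sq f) (lp_two_summable_sq f))).summable
      (hasSum_mul_latticeOp hW
        (summable_mul_shift_of_sq (lp_two_summable_sq g) (lp_two_summable_sq g))).summable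
    have key : ∀ h : X → ℝ, h x * latticeOp e c W h x
        = ∑ i, c i * (h x * h (x + e i) + h x * h (x - e i) - 2 * (h x * h x))
          + W x * (h x * h x) := fun h => by
      simp only [latticeOp, mul_add, Finset.mul_sum]
      congr 1
      · exact Finset.sum_congr rfl fun i _ => by ring
      · ring
    rw [key, key]
    simp only [hg, abs_mul_abs_self]
    refine add_le_add (Finset.sum_le_sum fun i _ => mul_le_mul_of_nonneg_left ?_ (hc i)) le_rfl
    have h1 := le_abs_self (f x * f (x + e i))
    have h2 := le_abs_self (f x * f (x - e i))
    rw [abs_mul] at h1 h2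
    linarith
  have hHf : ⟪H f, f⟫_ℝ = l * ‖f‖ ^ 2 := by
    rw [hf, inner_smul_left, real_inner_self_eq_norm_sq]; rfl
  have h0 := eq_zero_of_form_eq_zero D hs (fun h => by rw [hform]; linarith [hl h]) g
    (by rw [hform, hnorm]; linarith)
  have h1 : l • g - H g = 0 := h0
  exact (sub_eq_zero.1 h1).symm

theorem eq_zero_of_latticeOp_eq (hc : ∀ i, 0 < c i)
    (he : AddSubgroup.closure (Set.range e) = ⊤) {l : ℝ} {f : X → ℝ} (hf : ∀ x, 0 ≤ f x)
    (hl : ∀ x, latticeOp e c W f x = l * f x) {x₀ : X} (hx₀ : f x₀ = 0) (x : X) : f x = 0 := by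
  have hstep : ∀ x, f x = 0 → ∀ i, f (x + e i) = 0 ∧ f (x - e i) = 0 := fun x hx i => by
    have h1 := hl x
    rw [latticeOp, hx] at h1
    simp only [sub_zero, mul_zero, add_zero] at h1
    have h2 := (Finset.sum_eq_zero_iff_of_nonneg (fun i _ =>
      mul_nonneg (hc i).le (add_nonneg (hf _) (hf _)))).1 h1 i (Finset.mem_univ i)
    have h3 := (mul_eq_zero.1 h2).resolve_left (hc i).ne'
    constructor <;> linarith [hf (x + e i), hf (x - e i)]
  have hall : ∀ y ∈ AddSubgroup.closure (Set.range e), ∀ x, f x = 0 → f (x + y) = 0 := by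
    intro y hy
    induction hy using AddSubgroup.closure_induction'' with
    | mem y hy => obtain ⟨i, rfl⟩ := hy; exact fun x hx => (hstep x hx i).1
    | neg_mem y hy =>
      obtain ⟨i, rfl⟩ := hy
      intro x hx
      rw [← sub_eq_add_neg]
      exact (hstep x hx i).2
    | zero => simp
    | add y z _ _ ihy ihz =>
      intro x hx
      rw [← add_assoc]
      exact ihz _ (ihy x hx)
  have := hall (x - x₀) (by rw [he]; trivial) x₀ hx₀
  simpa using this

end SquareSummable

section PositiveEvolution

theorem mem_cone_of_hasDerivAt {E : Type*} [NormedAddCommGroup E] [NormedSpace ℝ E]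
    [CompleteSpace E] (S : E →L[ℝ] E) {P : Set E} (hP : IsClosed P) (hP0 : 0 ∈ P)
    (hadd : ∀ f ∈ P, ∀ g ∈ P, f + g ∈ P) (hsmul : ∀ a : ℝ, 0 ≤ a → ∀ f ∈ P, a • f ∈ P)
    (hS : ∀ f ∈ P, S f ∈ P) {R : ℝ → E} (hR : ∀ t, HasDerivAt R (S (R t)) t) (h0 : R 0 ∈ P)
    {t : ℝ} (ht : 0 ≤ t) : R t ∈ P := by
  have hexp : R = fun t : ℝ => NormedSpace.exp (t • S) (R 0) := by
    refine ODE_solution_unique_univ (v := fun _ f => S f) (s := fun _ => Set.univ) (t₀ := 0)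
      (fun _ => S.lipschitz.lipschitzOnWith) (fun t => ⟨hR t, trivial⟩) (fun t => ⟨?_, trivial⟩)
      (by simp)
    have := (hasDerivAt_exp_smul_const' (𝕂 := ℝ) S t).clm_apply (hasDerivAt_const t (R 0))
    simpa using this
  rw [hexp]
  have hsum := (ContinuousLinearMap.apply ℝ E (R 0)).hasSum
    (NormedSpace.exp_series_hasSum_exp' (𝕂 := ℝ) (t • S))
  have hpow : ∀ n : ℕ, ((t • S) ^ n) (R 0) ∈ P := fun n => by
    induction n with
    | zero => exact h0
    | succ n ih =>
      rw [pow_succ']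
      exact hsmul t ht _ (hS _ ih)
  refine hP.mem_of_tendsto hsum (Eventually.of_forall fun s => ?_)
  exact Finset.sum_induction _ (· ∈ P) (fun f g hf hg => hadd f hf g hg) hP0
    fun n _ => hsmul _ (by positivity) _ (hpow n)

theorem nonneg_of_hasDerivAt {X : Type*} [TopologicalSpace X] (S : (X →ᵇ ℝ) →L[ℝ] (X →ᵇ ℝ))
    (hS : ∀ f : X →ᵇ ℝ, (∀ x, 0 ≤ f x) → ∀ x, 0 ≤ S f x) {R : ℝ → (X →ᵇ ℝ)}
    (hR : ∀ t, HasDerivAt R (S (R t)) t) (h0 : ∀ x, 0 ≤ R 0 x) {t : ℝ} (ht : 0 ≤ t) (x : X) :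
    0 ≤ R t x := by
  have hclosed : IsClosed {f : X →ᵇ ℝ | ∀ x, 0 ≤ f x} := by
    simp only [Set.ofPred_forall]
    exact isClosed_iInter fun x =>
      isClosed_le continuous_const (lipschitz_eval_const x).continuous
  exact mem_cone_of_hasDerivAt S hclosed (fun x => le_rfl)
    (fun f hf g hg x => add_nonneg (hf x) (hg x)) (fun a ha f hf x => mul_nonneg ha (hf x))
    hS hR h0 ht x

end PositiveEvolution

section GroundState

open scoped InnerProductSpace

variable {X ι : Type*} [AddCommGroup X] [Fintype ι] {e : ι → X} {c : ι → ℝ} {W : X → ℝ} {w : ℝ}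
  {H : lp (fun _ : X => ℝ) 2 →L[ℝ] lp (fun _ : X => ℝ) 2}

instance nontrivial_lp_two : Nontrivial (lp (fun _ : X => ℝ) 2) := by
  classical
  refine ⟨lp.single 2 (0 : X) (1 : ℝ), 0, fun h => ?_⟩
  have := congrArg (fun f : lp (fun _ : X => ℝ) 2 => f 0) h
  simp at this

theorem form_le_sSup_spectrum (hW : ∀ x, |W x| ≤ w) (hH : ∀ f x, H f x = latticeOp e c W f x)
    (f : lp (fun _ : X => ℝ) 2) : ⟪H f, f⟫_ℝ ≤ sSup (spectrum ℝ H) * ‖f‖ ^ 2 :=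
  (isGreatest_sSup_spectrum H (latticeOp_symmetric hW hH)).2 f

theorem latticeOp_sub_indicator (F : Set X) (M : ℝ) (f : X → ℝ) (x : X) :
    latticeOp e c (fun x => W x - F.indicator (fun _ => M) x) f x
      = latticeOp e c W f x - M * F.indicator f x := by
  by_cases hx : x ∈ F
  · simp only [latticeOp, Set.indicator_of_mem hx]
    ring
  · simp only [latticeOp, Set.indicator_of_notMem hx]
    ring

theorem exists_smul_eq_of_eigenvector (hc : ∀ i, 0 < c i)
    (he : AddSubgroup.closure (Set.range e) = ⊤) (hW : ∀ x, |W x| ≤ w)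
    (hH : ∀ f x, H f x = latticeOp e c W f x) {l : ℝ} (hl : ∀ f, ⟪H f, f⟫_ℝ ≤ l * ‖f‖ ^ 2)
    {v : lp (fun _ : X => ℝ) 2} (hv : v 0 ≠ 0) (hHv : H v = l • v) {g : lp (fun _ : X => ℝ) 2}
    (hg : H g = l • g) : ∃ a : ℝ, g = a • v := by
  refine ⟨g 0 / v 0, ?_⟩
  set f := g - (g 0 / v 0) • v with hf
  have hHf : H f = l • f := by
    rw [hf, map_sub, map_smul, hg, hHv, smul_sub, smul_comm]
  have hf0 : f 0 = 0 := by
    have : f 0 = g 0 - g 0 / v 0 * v 0 := rfl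
    rw [this, div_mul_cancel₀ _ hv, sub_self]
  set k := lpTwoOfSq (fun x => |f x|) (by simpa using lp_two_summable_sq f) with hk
  have hkH := eigenvector_abs (fun i => (hc i).le) hW hH hl hHf (g := k) fun x => rfl
  have hz := eq_zero_of_latticeOp_eq (W := W) hc he (f := k) (l := l) (fun x => abs_nonneg _)
    (fun x => by rw [← hH, hkH]; rfl) (x₀ := 0) (by simp [hk, hf0])
  have : f = 0 := lp.ext (funext fun x => abs_eq_zero.1 (hz x))
  exact sub_eq_zero.1 this

/-- If `W` admits, outside a finite set, a supersolution below the top of the spectrum, then the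
top of the spectrum is attained by a positive summable ground state. -/
theorem exists_ground_state (hc : ∀ i, 0 < c i) (he : AddSubgroup.closure (Set.range e) = ⊤)
    (hW : ∀ x, |W x| ≤ w) (hH : ∀ f x, H f x = latticeOp e c W f x) {F : Finset X} {φ : X → ℝ}
    {η C b : ℝ} (hη : 0 < η) (hφη : ∀ x, η ≤ φ x) (hφC : ∀ x, φ x ≤ C)
    (hφ : ∀ x, x ∉ F → latticeOp e c W φ x ≤ b * φ x) (hb : b < sSup (spectrum ℝ H)) :
    ∃ v : lp (fun _ : X => ℝ) 2, ‖v‖ = 1 ∧ (∀ x, 0 < v x) ∧ Summable v ∧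
      H v = sSup (spectrum ℝ H) • v := by
  have hl := form_le_sSup_spectrum hW hH
  have hls := (isGreatest_sSup_spectrum H (latticeOp_symmetric hW hH)).1
  set l := sSup (spectrum ℝ H) with hldef
  have hc0 : ∀ i, 0 ≤ c i := fun i => (hc i).le
  set M := ∑ x ∈ F, |latticeOp e c W φ x - b * φ x| / η with hM
  have hM0 : 0 ≤ M := Finset.sum_nonneg fun x _ => by positivity
  have hMφ : ∀ x ∈ F, latticeOp e c W φ x - M * φ x ≤ b * φ x := fun x hx => by
    have h1 : |latticeOp e c W φ x - b * φ x| / η ≤ M :=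
      Finset.single_le_sum (f := fun x => |latticeOp e c W φ x - b * φ x| / η)
        (fun y _ => by positivity) hx
    rw [div_le_iff₀ hη] at h1
    linarith [le_abs_self (latticeOp e c W φ x - b * φ x),
      mul_le_mul_of_nonneg_left (hφη x) hM0]
  set W' : X → ℝ := fun x => W x - (F : Set X).indicator (fun _ => M) x with hW'
  have hWb : ∀ x, |W' x| ≤ w + M := fun x => by
    refine (abs_sub _ _).trans (add_le_add (hW x) ?_)
    by_cases hx : x ∈ (F : Set X)
    · rw [Set.indicator_of_mem hx, abs_of_nonneg hM0]
    · rw [Set.indicator_of_notMem hx, abs_zero]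
      exact hM0
  have hφ' : ∀ x, latticeOp e c W' φ x ≤ b * φ x := fun x => by
    rw [hW', latticeOp_sub_indicator]
    by_cases hx : x ∈ F
    · rw [Set.indicator_of_mem (by exact hx)]
      exact hMφ x hx
    · rw [Set.indicator_of_notMem (by exact hx)]
      simpa using hφ x hx
  obtain ⟨Q₀, hQc, hQ₀⟩ := exists_compact_restriction F
  set Q := M • Q₀ with hQ
  have hHQ : ∀ f x, (l • f - H f + Q f) x = l * f x - latticeOp e c W' f x := fun f x => by
    have h1 : (l • f - H f + Q f) x = l * f x - H f x + M * Q₀ f x := rfl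
    rw [h1, hH, hQ₀, hW', latticeOp_sub_indicator]
    ring
  have hcoer : ∀ f, (l - b) * ‖f‖ ^ 2 ≤ ⟪l • f - H f + Q f, f⟫_ℝ := fun f => by
    have hsq := lp_two_summable_sq f
    have h1 := form_le_of_supersolution hc0 hWb hη hφη hφC hφ' hsq
    have h2 := (hasSum_mul_latticeOp (e := e) (c := c) hWb
      (summable_mul_shift_of_sq hsq hsq)).summable
    have h3 : ⟪l • f - H f + Q f, f⟫_ℝ
        = l * ∑' x, f x ^ 2 - ∑' x, f x * latticeOp e c W' f x := by
      rw [real_inner_comm, lp_two_inner_eq_tsum, ← tsum_mul_left,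
        ← (hsq.mul_left l).tsum_sub h2]
      exact tsum_congr fun x => by rw [hHQ]; ring
    rw [h3, lp_two_norm_sq_eq_tsum]
    linarith
  obtain ⟨v₀, hv₀, hHv₀⟩ := exists_eigenvector_of_compact_perturbation H Q (hQc.smul M) hls
    (sub_pos.2 hb) hcoer
  set k := lpTwoOfSq (fun x => |v₀ x|) (by simpa using lp_two_summable_sq v₀) with hk
  have hkH : H k = l • k := eigenvector_abs hc0 hW hH hl hHv₀ fun x => rfl
  have hk0 : ∀ x, 0 ≤ k x := fun x => abs_nonneg _
  have hkpos : ∀ x, 0 < k x := fun x => by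
    refine (hk0 x).lt_of_ne fun h => hv₀ ?_
    have hz := eq_zero_of_latticeOp_eq (W := W) hc he (f := k) (l := l) hk0
      (fun x => by rw [← hH, hkH]; rfl) (x₀ := x) h.symm
    exact lp.ext (funext fun x => abs_eq_zero.1 (hz x))
  have hkne : k ≠ 0 := fun h => (hkpos 0).ne' (by rw [h]; rfl)
  have hksum : Summable k := by
    obtain ⟨h, hh0, hhs, hh⟩ := exists_summable_solution hc0 hWb hη hφη hφC hφ' hb
      (g := fun x => M * (F : Set X).indicator k x)
      (fun x => mul_nonneg hM0 (Set.indicator_nonneg (fun x _ => hk0 x) x))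
      ((summable_of_ne_finset_zero (s := F) fun x hx => by
        rw [Set.indicator_of_notMem (by exact hx)]).mul_left M)
    set h' := lpTwoOfSq h (summable_sq_of_nonneg hh0 hhs) with hh'
    have heq : h' - k = 0 := by
      have h1 : l • (h' - k) - H (h' - k) + Q (h' - k) = 0 := by
        have h2 : l • h' - H h' + Q h' = l • k - H k + Q k := lp.ext <| funext fun x => by
          rw [hHQ, hkH, sub_self, zero_add, show (Q k) x = M * Q₀ k x from rfl, hQ₀]
          exact hh x
        rw [← sub_eq_zero.2 h2, map_sub, map_sub, smul_sub]
        abel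
      have h3 := hcoer (h' - k)
      rw [h1, inner_zero_left] at h3
      have h4 : ‖h' - k‖ ^ 2 ≤ 0 := nonpos_of_mul_nonpos_right h3 (sub_pos.2 hb)
      simpa using le_antisymm h4 (sq_nonneg _)
    rw [← sub_eq_zero.1 heq]
    exact hhs
  refine ⟨‖k‖⁻¹ • k, ?_, fun x => ?_, ?_, ?_⟩
  · rw [norm_smul, norm_inv, norm_norm, inv_mul_cancel₀ (norm_ne_zero_iff.2 hkne)]
  · exact mul_pos (inv_pos.2 (norm_pos_iff.2 hkne)) (hkpos x)
  · exact hksum.mul_left ‖k‖⁻¹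
  · rw [map_smul, hkH, smul_comm]

end GroundState

section MomentAsymptotics

open scoped InnerProductSpace

/-- The inclusion of `ℓ²` into the bounded functions. -/
noncomputable def lpTwoToBounded (X : Type*) [TopologicalSpace X] [DiscreteTopology X] :
    lp (fun _ : X => ℝ) 2 →L[ℝ] (X →ᵇ ℝ) :=
  LinearMap.mkContinuous
    { toFun f := ofNormedAddCommGroupDiscrete f ‖f‖ fun x =>
        lp.norm_apply_le_norm (by norm_num) f x
      map_add' _ _ := rfl
      map_smul' _ _ := rfl } 1
    fun f => by
      rw [one_mul]
      exact (norm_le (norm_nonneg _)).2 fun x => lp.norm_apply_le_norm (by norm_num) f x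

@[simp]
theorem lpTwoToBounded_apply {X : Type*} [TopologicalSpace X] [DiscreteTopology X]
    (f : lp (fun _ : X => ℝ) 2) (x : X) :
    lpTwoToBounded X f x = f x := rfl

theorem exists_tsum_functional {X : Type*} [TopologicalSpace X] {q : X → ℝ}
    (hq : ∀ x, 0 ≤ q x) (hqs : Summable q) :
    ∃ L : (X →ᵇ ℝ) →L[ℝ] ℝ, ∀ f, HasSum (fun x => q x * f x) (L f) := by
  have hs : ∀ f : X →ᵇ ℝ, Summable fun x => q x * f x := fun f =>
    Summable.of_norm_bounded (hqs.mul_right ‖f‖) fun x => by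
      rw [norm_mul, Real.norm_of_nonneg (hq x)]
      exact mul_le_mul_of_nonneg_left (f.norm_coe_le_norm x) (hq x)
  refine ⟨LinearMap.mkContinuous
    { toFun f := ∑' x, q x * f x
      map_add' f g := by
        simp only [BoundedContinuousFunction.add_apply, mul_add]
        exact (hs f).tsum_add (hs g)
      map_smul' a f := by
        simp only [BoundedContinuousFunction.smul_apply, smul_eq_mul, mul_left_comm _ a]
        exact tsum_mul_left } (∑' x, q x) fun f => ?_, fun f => (hs f).hasSum⟩
  refine tsum_of_norm_bounded (hqs.hasSum.mul_right ‖f‖) fun x => ?_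
  rw [norm_mul, Real.norm_of_nonneg (hq x)]
  exact mul_le_mul_of_nonneg_left (f.norm_coe_le_norm x) (hq x)

variable {X ι : Type*} [TopologicalSpace X] [AddCommGroup X] [Fintype ι] {e : ι → X}
  {c : ι → ℝ} {W : X → ℝ} {w : ℝ} {H : lp (fun _ : X => ℝ) 2 →L[ℝ] lp (fun _ : X => ℝ) 2}
  {Hinf : (X →ᵇ ℝ) →L[ℝ] (X →ᵇ ℝ)}

theorem nonneg_of_hasDerivAt_sub_smul (hc : ∀ i, 0 ≤ c i) (hW : ∀ x, |W x| ≤ w)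
    (hHinf : ∀ f x, Hinf f x = latticeOp e c W f x) {l : ℝ} {r : ℝ → (X →ᵇ ℝ)}
    (hr : ∀ t, HasDerivAt r (Hinf (r t) - l • r t) t) (h0 : ∀ x, 0 ≤ r 0 x) {t : ℝ} (ht : 0 ≤ t)
    (x : X) : 0 ≤ r t x := by
  set K := w + 2 * ∑ i, c i with hK
  have hR : ∀ t, HasDerivAt (fun t => Real.exp ((K + l) * t) • r t)
      ((Hinf + K • ContinuousLinearMap.id ℝ (X →ᵇ ℝ)) (Real.exp ((K + l) * t) • r t)) t :=
    fun t => by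
    have h1 : HasDerivAt (fun t => Real.exp ((K + l) * t))
        (Real.exp ((K + l) * t) * (K + l)) t := by
      simpa using ((hasDerivAt_id t).const_mul (K + l)).exp
    refine (h1.smul (hr t)).congr_deriv ?_
    change _ = Hinf (Real.exp ((K + l) * t) • r t) + K • (Real.exp ((K + l) * t) • r t)
    rw [map_smul]
    module
  have := nonneg_of_hasDerivAt (Hinf + K • ContinuousLinearMap.id ℝ (X →ᵇ ℝ))
    (fun f hf x => by
      change 0 ≤ Hinf f x + K * f x
      rw [hHinf]
      exact latticeOp_add_mul_nonneg hc hW le_rfl hf x) hR (fun x => by simpa using h0 x) ht x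
  exact nonneg_of_mul_nonneg_right this (Real.exp_pos _)

theorem tendsto_exp_mul_of_ground_state [DiscreteTopology X] (hc : ∀ i, 0 ≤ c i)
    (hW : ∀ x, |W x| ≤ w)
    (hH : ∀ f x, H f x = latticeOp e c W f x) (hHinf : ∀ f x, Hinf f x = latticeOp e c W f x)
    {u : ℝ → (X →ᵇ ℝ)} (hu0 : u 0 = 1) (hu : ∀ t, HasDerivAt u (Hinf (u t)) t) {l : ℝ}
    (hl : ∀ f, ⟪H f, f⟫_ℝ ≤ l * ‖f‖ ^ 2) {v : lp (fun _ : X => ℝ) 2} (hv1 : ‖v‖ = 1)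
    (hv : ∀ x, 0 < v x) (hvs : Summable v) (hHv : H v = l • v)
    (hsimple : ∀ g, H g = l • g → ∃ a : ℝ, g = a • v) (x : X) :
    Tendsto (fun t : ℝ => Real.exp (-l * t) * u t x) atTop (𝓝 ((∑' y, v y) * v x)) := by
  set D : lp (fun _ : X => ℝ) 2 →L[ℝ] lp (fun _ : X => ℝ) 2 :=
    l • ContinuousLinearMap.id ℝ _ - H with hD
  have hDf : ∀ f, D f = l • f - H f := fun f => rfl
  have hsymm := latticeOp_symmetric hW hH
  have hDs : ∀ f g, ⟪D f, g⟫_ℝ = ⟪f, D g⟫_ℝ := fun f g => by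
    rw [hDf, hDf, inner_sub_left, inner_sub_right, hsymm, real_inner_smul_left,
      real_inner_smul_right]
  have hD0 : ∀ f, 0 ≤ ⟪D f, f⟫_ℝ := fun f => by
    rw [hDf, inner_sub_left, real_inner_smul_left, real_inner_self_eq_norm_sq]
    linarith [hl f]
  obtain ⟨L, hL⟩ := exists_tsum_functional (fun x => (hv x).le) hvs
  have hLH : ∀ f, L (Hinf f) = l * L f := fun f => by
    have hfv := summable_mul_shift_of_bounded (fun x => f.norm_coe_le_norm x) hvs
    rw [← (hL f).tsum_eq, ← (hL (Hinf f)).tsum_eq, ← tsum_mul_left]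
    simp only [hHinf]
    rw [← tsum_mul_latticeOp_comm (e := e) (c := c) hW hfv]
    refine tsum_congr fun x => ?_
    rw [← hH, hHv]
    change f x * (l * v x) = _
    ring
  have hvx : v x ≤ 1 := by
    have := lp.norm_apply_le_norm (by norm_num) v x
    rw [hv1] at this
    exact (le_abs_self _).trans this
  rw [Metric.tendsto_atTop]
  intro ε hε
  set δ := ε / 3 * v x with hδ
  have hδ0 : 0 < δ := by have := hv x; positivity
  obtain ⟨Λ, hΛ⟩ := (Tendsto.eventually_const_lt (sub_lt_self _ hδ0) hvs.hasSum).exists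
  have hΛle : ∑ y ∈ Λ, v y ≤ ∑' y, v y := hvs.sum_le_tsum Λ fun y _ => (hv y).le
  have hsupp : ∀ y ∉ Λ, (Λ : Set X).indicator (fun _ => (1 : ℝ)) y = 0 := fun y hy =>
    Set.indicator_of_notMem (by exact hy) _
  set g := lpTwoOfSq ((Λ : Set X).indicator fun _ => (1 : ℝ))
    (summable_of_ne_finset_zero (s := Λ) fun y hy => by rw [hsupp y hy, sq, zero_mul]) with hg
  have hvg : HasSum (fun y => v y * g y) (∑ y ∈ Λ, v y) := by
    have : HasSum (fun y => v y * g y) (∑ y ∈ Λ, v y * g y) :=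
        hasSum_sum_of_ne_finset_zero fun y hy => by
      change v y * (Λ : Set X).indicator (fun _ => (1 : ℝ)) y = 0
      rw [hsupp y hy, mul_zero]
    convert this using 1
    refine Finset.sum_congr rfl fun y hy => ?_
    change _ = v y * (Λ : Set X).indicator (fun _ => (1 : ℝ)) y
    rw [Set.indicator_of_mem (by exact hy), mul_one]
  set a : ℝ → lp (fun _ : X => ℝ) 2 := fun t => NormedSpace.exp (t • (-D)) g with ha
  have ha0 : a 0 = g := by simp [ha]
  have halim : Tendsto a atTop (𝓝 ((∑ y ∈ Λ, v y) • v)) := by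
    have := tendsto_exp_neg_smul_apply D hDs hD0 v hv1 (by rw [hDf, hHv, sub_self])
      (fun f hf => hsimple f (sub_eq_zero.1 hf).symm) g
    rwa [lp_two_inner_eq_tsum, hvg.tsum_eq] at this
  set r : ℝ → (X →ᵇ ℝ) := fun t => Real.exp (-l * t) • u t - lpTwoToBounded X (a t) with hr
  have hrd : ∀ t, HasDerivAt r (Hinf (r t) - l • r t) t := fun t => by
    have h1 : HasDerivAt (fun t => Real.exp (-l * t)) (Real.exp (-l * t) * -l) t := by
      simpa using ((hasDerivAt_id t).const_mul (-l)).exp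
    have h2 := (h1.smul (hu t)).sub
      ((lpTwoToBounded X).hasFDerivAt.comp_hasDerivAt t (hasDerivAt_exp_neg_smul_apply D g t))
    refine h2.congr_deriv ?_
    have h3 : ∀ f, lpTwoToBounded X (H f) = Hinf (lpTwoToBounded X f) := fun f => by
      ext y
      rw [lpTwoToBounded_apply, hH, hHinf]
      rfl
    change _ - lpTwoToBounded X (-(D (a t))) = _
    simp only [hr, hDf, map_sub, map_neg, map_smul, h3]
    module
  have hr0 : r 0 = 1 - lpTwoToBounded X g := by simp [hr, hu0, ha0]
  have hrnn : ∀ t, 0 ≤ t → ∀ y, 0 ≤ r t y := fun t ht =>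
    nonneg_of_hasDerivAt_sub_smul hc hW hHinf hrd (fun y => by
      rw [hr0]
      change 0 ≤ 1 - (Λ : Set X).indicator (fun _ => (1 : ℝ)) y
      exact sub_nonneg.2 (Set.indicator_le_self' (fun _ _ => zero_le_one) y)) ht
  have hLr : ∀ t, L (r t) = ∑' y, v y - ∑ y ∈ Λ, v y := fun t => by
    have hd : ∀ t, HasDerivAt (fun t => L (r t)) 0 t := fun t => by
      refine (L.hasFDerivAt.comp_hasDerivAt t (hrd t)).congr_deriv ?_
      rw [map_sub, hLH, map_smul, smul_eq_mul, sub_self]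
    rw [is_const_of_deriv_eq_zero (fun t => (hd t).differentiableAt) (fun t => (hd t).deriv) t 0,
      hr0, map_sub]
    congr 1
    · exact (hL 1).unique (by simpa using hvs.hasSum)
    · exact (hL _).unique hvg
  have hrle : ∀ t, 0 ≤ t → r t x ≤ ε / 3 := fun t ht => by
    have h1 := le_hasSum (hL (r t)) x fun y _ => mul_nonneg (hv y).le (hrnn t ht y)
    rw [hLr] at h1
    refine le_of_mul_le_mul_left ?_ (hv x)
    linarith
  obtain ⟨T, hT⟩ := Metric.tendsto_atTop.1 halim (ε / 3) (by positivity)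
  refine ⟨max T 0, fun t ht => ?_⟩
  have h1 : |a t x - (∑ y ∈ Λ, v y) * v x| < ε / 3 := by
    have := hT t ((le_max_left _ _).trans ht)
    rw [dist_eq_norm] at this
    exact (lp.norm_apply_le_norm (by norm_num) (a t - (∑ y ∈ Λ, v y) • v) x).trans_lt this
  have h2 := hrle t ((le_max_right _ _).trans ht)
  have h3 := hrnn t ((le_max_right _ _).trans ht) x
  have h4 : r t x = Real.exp (-l * t) * u t x - a t x := rfl
  have h5 : (∑' y, v y - ∑ y ∈ Λ, v y) * v x ≤ ε / 3 := by
    have : ∑' y, v y - ∑ y ∈ Λ, v y ≤ ε / 3 * v x := by linarith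
    nlinarith [hv x, mul_le_mul_of_nonneg_left hvx (hv x).le]
  have h6 : 0 ≤ (∑' y, v y - ∑ y ∈ Λ, v y) * v x :=
    mul_nonneg (sub_nonneg.2 hΛle) (hv x).le
  rw [Real.dist_eq, abs_lt]
  rw [abs_lt] at h1
  constructor <;> linarith [h1.1, h1.2]

/-- The ground state and moment asymptotics of a lattice Schrödinger operator with a supersolution
outside a finite set that lies below the top of the spectrum. -/
theorem exists_ground_state_and_tendsto [DiscreteTopology X] (hc : ∀ i, 0 < c i)
    (he : AddSubgroup.closure (Set.range e) = ⊤) (hW : ∀ x, |W x| ≤ w)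
    (hH : ∀ f x, H f x = latticeOp e c W f x) (hHinf : ∀ f x, Hinf f x = latticeOp e c W f x)
    {u : ℝ → (X →ᵇ ℝ)} (hu0 : u 0 = 1) (hu : ∀ t, HasDerivAt u (Hinf (u t)) t)
    {F : Finset X} {φ : X → ℝ} {η C b : ℝ} (hη : 0 < η) (hφη : ∀ x, η ≤ φ x)
    (hφC : ∀ x, φ x ≤ C) (hφ : ∀ x, x ∉ F → latticeOp e c W φ x ≤ b * φ x)
    (hb : b < sSup (spectrum ℝ H)) :
    ∃ v : lp (fun _ : X => ℝ) 2, ‖v‖ = 1 ∧ (∀ x, 0 < v x) ∧ Summable (fun x => v x) ∧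
      H v = sSup (spectrum ℝ H) • v ∧
      ∀ x, Tendsto (fun t : ℝ => Real.exp (-(sSup (spectrum ℝ H)) * t) * u t x) atTop
        (𝓝 ((∑' y, v y) * v x)) := by
  obtain ⟨v, hv1, hv, hvs, hHv⟩ := exists_ground_state hc he hW hH hη hφη hφC hφ hb
  have hl := form_le_sSup_spectrum hW hH
  exact ⟨v, hv1, hv, hvs, hHv, tendsto_exp_mul_of_ground_state (fun i => (hc i).le) hW hH hHinf hu0
    hu hl hv1 hv hvs hHv fun g hg => exists_smul_eq_of_eigenvector hc he hW hH hl (hv 0).ne' hHv hg⟩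

end MomentAsymptotics

section Catalyst

open scoped InnerProductSpace

/-- The jumps of the catalyst problem: a single particle jumps, or all particles jump at once. -/
def catalystStep (d p : ℕ) : (Fin p × Fin d) ⊕ Fin d → Fin p → Fin d → ℤ :=
  Sum.elim (fun ij => Pi.single ij.1 (Pi.single ij.2 1)) fun j _ => Pi.single j 1

/-- The jump rates of the catalyst problem. -/
def catalystRate (d p : ℕ) (κ ρ : ℝ) : (Fin p × Fin d) ⊕ Fin d → ℝ :=
  Sum.elim (fun _ => κ) fun _ => ρ

/-- The potential of the catalyst problem. -/
noncomputable def catalystPotential (d p : ℕ) (γ : ℝ) (x : Fin p → Fin d → ℤ) : ℝ :=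
  γ * ∑ i : Fin p, if x i = 0 then (1 : ℝ) else 0

variable {d p : ℕ} {κ ρ γ : ℝ}

theorem latticeOp_catalyst (f : (Fin p → Fin d → ℤ) → ℝ) (x : Fin p → Fin d → ℤ) :
    latticeOp (catalystStep d p) (catalystRate d p κ ρ) (catalystPotential d p γ) f x
      = κ * (∑ i : Fin p, ∑ j : Fin d,
          ((f (Function.update x i (x i + Pi.single j 1)) - f x)
            + (f (Function.update x i (x i - Pi.single j 1)) - f x)))
        + ρ * (∑ j : Fin d,
          ((f (fun i => x i + Pi.single j 1) - f x)
            + (f (fun i => x i - Pi.single j 1) - f x)))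
        + γ * ((∑ i : Fin p, if x i = 0 then (1:ℝ) else 0) * f x) := by
  have h1 : ∀ i (z : Fin d → ℤ), Function.update x i (x i + z) = x + Pi.single i z := fun i z => by
    ext k
    by_cases hk : k = i
    · subst hk; simp
    · simp [hk]
  have h2 : ∀ i (z : Fin d → ℤ), Function.update x i (x i - z) = x - Pi.single i z := fun i z => by
    ext k
    by_cases hk : k = i
    · subst hk; simp
    · simp [hk]
  simp only [latticeOp, Fintype.sum_sum_type, Fintype.sum_prod_type, catalystStep, catalystRate,
    Sum.elim_inl, Sum.elim_inr, h1, h2, ← Finset.mul_sum, catalystPotential, mul_assoc]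
  rfl

theorem catalystRate_pos (hκ : 0 < κ) (hρ : 0 < ρ) (i) : 0 < catalystRate d p κ ρ i := by
  cases i <;> assumption

theorem abs_catalystPotential_le (hγ : 0 < γ) (x : Fin p → Fin d → ℤ) :
    |catalystPotential d p γ x| ≤ γ * p := by
  rw [catalystPotential, abs_mul, abs_of_pos hγ]
  refine mul_le_mul_of_nonneg_left ?_ hγ.le
  rw [abs_of_nonneg (Finset.sum_nonneg fun i _ => by split_ifs <;> norm_num)]
  calc (∑ i : Fin p, if x i = 0 then (1 : ℝ) else 0) ≤ ∑ _i : Fin p, (1 : ℝ) :=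
        Finset.sum_le_sum fun i _ => by split_ifs <;> norm_num
    _ = p := by simp

theorem catalystPotential_le_of_ne_zero (hγ : 0 < γ) {x : Fin p → Fin d → ℤ} (hx : x ≠ 0) :
    catalystPotential d p γ x ≤ γ * (p - 1) := by
  obtain ⟨k, hk⟩ := Function.ne_iff.1 hx
  refine mul_le_mul_of_nonneg_left ?_ hγ.le
  have h1 : (∑ i : Fin p, if x i = 0 then (1 : ℝ) else 0) ≤ ∑ i : Fin p, if i = k then 0 else 1 :=
    Finset.sum_le_sum fun i _ => by
      by_cases hi : i = k
      · subst hi; rw [if_neg (by exact hk), if_pos rfl]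
      · rw [if_neg hi]; split_ifs <;> norm_num
  have h2 : (∑ i : Fin p, if i = k then (0 : ℝ) else 1) = p - 1 := by
    have : ∀ i : Fin p, (if i = k then (0 : ℝ) else 1) = 1 - if i = k then 1 else 0 := fun i => by
      split_ifs <;> norm_num
    simp [this]
  linarith

theorem closure_range_catalystStep :
    AddSubgroup.closure (Set.range (catalystStep d p)) = ⊤ := by
  refine (AddSubgroup.eq_top_iff' _).2 fun x => ?_
  have hx : x = ∑ i, ∑ j, x i j • (Pi.single i (Pi.single j 1) : Fin p → Fin d → ℤ) := by
    ext i j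
    simp only [Finset.sum_apply, Pi.smul_apply]
    rw [Finset.sum_eq_single i, Finset.sum_eq_single j]
    · simp
    · intro b _ hb; simp [Pi.single_eq_of_ne hb.symm]
    · simp
    · intro b _ hb; simp [Pi.single_eq_of_ne hb.symm]
    · simp
  rw [hx]
  refine AddSubgroup.sum_mem _ fun i _ => AddSubgroup.sum_mem _ fun j _ =>
    AddSubgroup.zsmul_mem _ (AddSubgroup.subset_closure ?_) _
  exact ⟨Sum.inl (i, j), rfl⟩

theorem catalystStep_ne_zero (hp : 1 ≤ p) (i) : catalystStep d p i ≠ 0 := by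
  rcases i with ⟨i, j⟩ | j
  · intro h
    have := congrFun (congrFun h i) j
    simp [catalystStep] at this
  · intro h
    have := congrFun (congrFun h ⟨0, hp⟩) j
    simp [catalystStep] at this

theorem catalyst_le_sSup_spectrum (hp : 1 ≤ p) (hγ : 0 < γ)
    {H : lp (fun _ : Fin p → Fin d → ℤ => ℝ) 2 →L[ℝ] lp (fun _ : Fin p → Fin d → ℤ => ℝ) 2}
    (hH : ∀ f x, H f x
      = latticeOp (catalystStep d p) (catalystRate d p κ ρ) (catalystPotential d p γ) f x) :
    γ * p - 2 * d * (κ * p + ρ) ≤ sSup (spectrum ℝ H) := by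
  have h1 := form_le_sSup_spectrum (abs_catalystPotential_le hγ) hH (lp.single 2 0 1)
  rw [lp.inner_single_right, hH, lp.norm_single (by norm_num)] at h1
  have hne := catalystStep_ne_zero (d := d) hp
  have h2 : latticeOp (catalystStep d p) (catalystRate d p κ ρ) (catalystPotential d p γ)
      (lp.single 2 (0 : Fin p → Fin d → ℤ) (1 : ℝ)) 0 = γ * p - 2 * d * (κ * p + ρ) := by
    have hW : catalystPotential d p γ 0 = γ * p := by simp [catalystPotential]
    simp only [latticeOp, zero_add, zero_sub, hW, lp.single_apply_self]
    have h3 : ∀ i, (lp.single 2 (0 : Fin p → Fin d → ℤ) (1 : ℝ) :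
        lp (fun _ : Fin p → Fin d → ℤ => ℝ) 2) (catalystStep d p i) = 0 := fun i =>
      lp.single_apply_ne 2 0 1 (hne i)
    have h4 : ∀ i, (lp.single 2 (0 : Fin p → Fin d → ℤ) (1 : ℝ) :
        lp (fun _ : Fin p → Fin d → ℤ => ℝ) 2) (-catalystStep d p i) = 0 := fun i =>
      lp.single_apply_ne 2 0 1 (neg_ne_zero.2 (hne i))
    simp only [h3, h4]
    simp [catalystRate]
    ring
  rw [h2] at h1
  simpa using h1

end Catalyst

section TwoParticles

open scoped InnerProductSpace

theorem hasSum_mul_fin_two {Y : Type*} {A B : Y → ℝ} (hA : Summable A) (hB : Summable B) :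
    HasSum (fun x : Fin 2 → Y => A (x 0) * B (x 1)) ((∑' y, A y) * ∑' y, B y) := by
  have h := hA.hasSum.mul hB.hasSum (summable_mul_of_summable_norm hA.norm hB.norm)
  exact ((finTwoArrowEquiv Y).hasSum_iff (f := fun z : Y × Y => A z.1 * B z.2)).2 h

variable {d : ℕ} {κ ρ γ : ℝ}

/-- The unit jumps of the `d`-dimensional lattice. -/
def unitStep (d : ℕ) (j : Fin d) : Fin d → ℤ := Pi.single j 1

/-- The lattice resolvent equation with a point source has a nonnegative summable solution that is
positive at the origin. -/
theorem exists_green_function (hκρ : 0 < κ + ρ) {μ : ℝ} (hμ : 0 < μ) :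
    ∃ G : (Fin d → ℤ) → ℝ, (∀ y, 0 ≤ G y) ∧ Summable G ∧ 0 < G 0 ∧
      ∀ y, latticeOp (unitStep d) (fun _ => κ + ρ) 0 G y = μ * G y - if y = 0 then 1 else 0 := by
  obtain ⟨G, hG0, hGs, hG⟩ := exists_summable_solution (e := unitStep d) (c := fun _ => κ + ρ)
    (W := 0) (w := 0) (φ := fun _ => 1) (η := 1) (C := 1) (b := 0) (l := μ)
    (g := fun y => if y = 0 then 1 else 0) (fun _ => hκρ.le) (by simp) one_pos (by simp) (by simp)
    (by simp [latticeOp]) hμ (fun y => by split_ifs <;> norm_num)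
    (summable_of_ne_finset_zero (s := {0}) fun y hy => by
      rw [if_neg (by simpa using hy)])
  refine ⟨G, hG0, hGs, (hG0 0).lt_of_ne fun h => ?_, fun y => by linarith [hG y]⟩
  have h1 := hG 0
  simp only [latticeOp, ← h, Pi.zero_apply, sub_zero, mul_zero, add_zero, zero_add, zero_sub,
    if_true] at h1
  have h2 : 0 ≤ ∑ i : Fin d, (κ + ρ) * (G (unitStep d i) + G (-unitStep d i)) :=
    Finset.sum_nonneg fun i _ => mul_nonneg hκρ.le (add_nonneg (hG0 _) (hG0 _))
  linarith

theorem mul_green_function_le_one (hρ : 0 < ρ) (hγ : 0 < γ) {μ : ℝ}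
    {H : lp (fun _ : Fin 2 → Fin d → ℤ => ℝ) 2 →L[ℝ] lp (fun _ : Fin 2 → Fin d → ℤ => ℝ) 2}
    (hH : ∀ f x, H f x
      = latticeOp (catalystStep d 2) (catalystRate d 2 κ ρ) (catalystPotential d 2 γ) f x)
    (hμ : sSup (spectrum ℝ H) = 2 * μ) {G : (Fin d → ℤ) → ℝ} (hG0 : ∀ y, 0 ≤ G y)
    (hGs : Summable G) (hGpos : 0 < G 0)
    (hG : ∀ y, latticeOp (unitStep d) (fun _ => κ + ρ) 0 G y = μ * G y - if y = 0 then 1 else 0) :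
    γ * G 0 ≤ 1 := by
  have hsq := summable_sq_of_nonneg hG0 hGs
  have hsh := summable_mul_shift_of_sq hsq hsq
  have hsh' : ∀ y, Summable fun x => G x * G (x - y) := fun y => by
    simpa [sub_eq_add_neg] using hsh (-y)
  have hs0 : Summable fun x => G x * G x := by simpa using hsh 0
  set n := ∑' x, G x * G x with hn
  set a : Fin d → ℝ := fun j => ∑' x, G x * G (x + unitStep d j) with ha
  set b : Fin d → ℝ := fun j => ∑' x, G x * G (x - unitStep d j) with hb
  have hnpos : 0 < n :=
    hs0.tsum_pos (fun x => mul_nonneg (hG0 x) (hG0 x)) 0 (mul_pos hGpos hGpos)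
  have hδ : HasSum (fun x : Fin d → ℤ => (G x * G x) * if x = 0 then 1 else 0) (G 0 * G 0) := by
    have := hasSum_single (f := fun x : Fin d → ℤ => (G x * G x) * if x = 0 then 1 else 0) 0
      fun y hy => by rw [if_neg hy, mul_zero]
    simpa using this
  have hδ' : HasSum (fun x : Fin d → ℤ => G x * if x = 0 then 1 else 0) (G 0) := by
    have := hasSum_single (f := fun x : Fin d → ℤ => G x * if x = 0 then 1 else 0) 0
      fun y hy => by rw [if_neg hy, mul_zero]
    simpa using this
  have hgreen : (κ + ρ) * ∑ j, ((a j - n) + (b j - n)) = μ * n - G 0 := by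
    have h1 := hasSum_mul_latticeOp (e := unitStep d) (c := fun _ => κ + ρ) (W := 0) (w := 0)
      (by simp) hsh
    have h2 := (hs0.hasSum.mul_left μ).sub hδ'
    have h3 := h1.unique (h2.congr_fun fun x => by rw [hG]; ring)
    simpa [← Finset.mul_sum] using h3
  set f : (Fin 2 → Fin d → ℤ) → ℝ := fun x => G (x 0) * G (x 1) with hf
  have hf0 : ∀ x, 0 ≤ f x := fun x => mul_nonneg (hG0 _) (hG0 _)
  have hfsq := summable_sq_of_nonneg hf0 (hasSum_mul_fin_two hGs hGs).summable
  set F := lpTwoOfSq f hfsq with hF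
  have hprod : ∀ {A B : (Fin d → ℤ) → ℝ}, Summable A → Summable B → ∀ g : (Fin 2 → Fin d → ℤ) → ℝ,
      (∀ x, g x = A (x 0) * B (x 1)) → ∑' x, g x = (∑' y, A y) * ∑' y, B y :=
    fun hA hB g hg => by rw [tsum_congr hg, (hasSum_mul_fin_two hA hB).tsum_eq]
  have hnn : ∑' x, f x * f x = n * n :=
    hprod hs0 hs0 _ fun x => by simp only [hf]; ring
  have hform := form_le_sSup_spectrum (abs_catalystPotential_le hγ) hH F
  rw [hμ, lp_two_norm_sq_eq_tsum, real_inner_comm, lp_two_inner_eq_tsum] at hform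
  simp only [hH, hF, lpTwoOfSq_apply, sq] at hform
  change ∑' x, f x * latticeOp _ _ _ f x ≤ _ at hform
  rw [hnn, (hasSum_mul_latticeOp (abs_catalystPotential_le hγ)
    (summable_mul_shift_of_sq hfsq hfsq)).tsum_eq, hnn] at hform
  have hWf : ∑' x, catalystPotential d 2 γ x * (f x * f x) = 2 * γ * (G 0 * G 0) * n := by
    have h1 := (hasSum_mul_fin_two hδ.summable hs0).add (hasSum_mul_fin_two hs0 hδ.summable)
    have h2 := (h1.mul_left γ).tsum_eq
    rw [hδ.tsum_eq] at h2
    rw [show 2 * γ * (G 0 * G 0) * n = γ * (G 0 * G 0 * n + n * (G 0 * G 0)) by ring, hn, ← h2]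
    refine tsum_congr fun x => ?_
    simp only [catalystPotential, Fin.sum_univ_two, hf]
    ring
  have e1 : ∀ j, ∑' x, f x * f (x + catalystStep d 2 (Sum.inl (0, j))) = a j * n := fun j =>
    hprod (hsh _) hs0 _ fun x => by simp [hf, catalystStep, unitStep]; ring
  have e2 : ∀ j, ∑' x, f x * f (x + catalystStep d 2 (Sum.inl (1, j))) = n * a j := fun j =>
    hprod hs0 (hsh _) _ fun x => by simp [hf, catalystStep, unitStep]; ring
  have e3 : ∀ j, ∑' x, f x * f (x - catalystStep d 2 (Sum.inl (0, j))) = b j * n := fun j =>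
    hprod (hsh' _) hs0 _ fun x => by simp [hf, catalystStep, unitStep]; ring
  have e4 : ∀ j, ∑' x, f x * f (x - catalystStep d 2 (Sum.inl (1, j))) = n * b j := fun j =>
    hprod hs0 (hsh' _) _ fun x => by simp [hf, catalystStep, unitStep]; ring
  have e5 : ∀ j, ∑' x, f x * f (x + catalystStep d 2 (Sum.inr j)) = a j * a j := fun j =>
    hprod (hsh _) (hsh _) _ fun x => by simp [hf, catalystStep, unitStep]; ring
  have e6 : ∀ j, ∑' x, f x * f (x - catalystStep d 2 (Sum.inr j)) = b j * b j := fun j =>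
    hprod (hsh' _) (hsh' _) _ fun x => by simp [hf, catalystStep, unitStep]; ring
  simp only [Fintype.sum_sum_type, Fintype.sum_prod_type, Fin.sum_univ_two, e1, e2, e3, e4, e5, e6,
    hWf, catalystRate, Sum.elim_inl, Sum.elim_inr, ← Finset.mul_sum] at hform
  have s1 : ∑ j, (a j * n - n * n + (b j * n - n * n)) = n * ∑ j, ((a j - n) + (b j - n)) := by
    rw [Finset.mul_sum]; exact Finset.sum_congr rfl fun j _ => by ring
  have s2 : ∑ j, (n * a j - n * n + (n * b j - n * n)) = n * ∑ j, ((a j - n) + (b j - n)) := by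
    rw [Finset.mul_sum]; exact Finset.sum_congr rfl fun j _ => by ring
  have s3 : 2 * n * ∑ j, ((a j - n) + (b j - n))
      ≤ ∑ j, (a j * a j - n * n + (b j * b j - n * n)) := by
    rw [Finset.mul_sum]
    exact Finset.sum_le_sum fun j _ => by nlinarith [sq_nonneg (a j - n), sq_nonneg (b j - n)]
  rw [s1, s2] at hform
  have s4 := mul_le_mul_of_nonneg_left s3 hρ.le
  have s5 : 2 * n * (G 0 * (γ * G 0 - 1)) ≤ 0 := by
    have : 2 * n * ((κ + ρ) * ∑ j, ((a j - n) + (b j - n))) = 2 * n * (μ * n - G 0) := by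
      rw [hgreen]
    linarith
  have s6 : G 0 * (γ * G 0 - 1) ≤ 0 := nonpos_of_mul_nonpos_right s5 (by positivity)
  linarith [nonpos_of_mul_nonpos_right s6 hGpos]

theorem latticeOp_catalyst_two_add (G : (Fin d → ℤ) → ℝ) (η : ℝ) (x : Fin 2 → Fin d → ℤ) :
    latticeOp (catalystStep d 2) (catalystRate d 2 κ ρ) (catalystPotential d 2 γ)
        (fun x => η + G (x 0) + G (x 1)) x
      = latticeOp (unitStep d) (fun _ => κ + ρ) 0 G (x 0)
        + latticeOp (unitStep d) (fun _ => κ + ρ) 0 G (x 1)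
        + γ * ((if x 0 = 0 then 1 else 0) + if x 1 = 0 then 1 else 0)
          * (η + G (x 0) + G (x 1)) := by
  simp only [latticeOp, Fintype.sum_sum_type, Fintype.sum_prod_type, Fin.sum_univ_two, catalystRate,
    catalystPotential, catalystStep, Sum.elim_inl, Sum.elim_inr, Pi.add_apply, Pi.sub_apply,
    Pi.single_eq_same, unitStep, Pi.zero_apply, zero_mul, add_zero]
  rw [← Finset.sum_add_distrib, ← Finset.sum_add_distrib, ← Finset.sum_add_distrib]
  congr 1
  refine Finset.sum_congr rfl fun j _ => ?_
  simp
  ring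

theorem exists_supersolution_two (hκ : 0 < κ) (hρ : 0 < ρ) (hγ : 0 < γ)
    {H : lp (fun _ : Fin 2 → Fin d → ℤ => ℝ) 2 →L[ℝ] lp (fun _ : Fin 2 → Fin d → ℤ => ℝ) 2}
    (hH : ∀ f x, H f x
      = latticeOp (catalystStep d 2) (catalystRate d 2 κ ρ) (catalystPotential d 2 γ) f x)
    (hl : 0 < sSup (spectrum ℝ H)) :
    ∃ (F : Finset (Fin 2 → Fin d → ℤ)) (φ : (Fin 2 → Fin d → ℤ) → ℝ) (η C b : ℝ), 0 < η ∧
      (∀ x, η ≤ φ x) ∧ (∀ x, φ x ≤ C) ∧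
      (∀ x, x ∉ F → latticeOp (catalystStep d 2) (catalystRate d 2 κ ρ)
        (catalystPotential d 2 γ) φ x ≤ b * φ x) ∧ b < sSup (spectrum ℝ H) := by
  classical
  obtain ⟨μ, hμ⟩ : ∃ μ, sSup (spectrum ℝ H) = 2 * μ := ⟨_, (mul_div_cancel₀ _ two_ne_zero).symm⟩
  rw [hμ] at hl ⊢
  have hμ0 : 0 < μ := by linarith
  obtain ⟨G, hG0, hGs, hGpos, hG⟩ := exists_green_function (d := d) (add_pos hκ hρ) hμ0
  have hγG := mul_green_function_le_one hρ hγ hH hμ hG0 hGs hGpos hG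
  set η := μ * G 0 / (4 * γ) with hη
  have hη0 : 0 < η := by positivity
  have hηγ : γ * η = μ * G 0 / 4 := by rw [hη]; field_simp
  have hfin : {y | ¬ G y < η}.Finite :=
    eventually_cofinite.1 (hGs.tendsto_cofinite_zero.eventually_lt_const hη0)
  refine ⟨Fintype.piFinset fun _ => insert 0 hfin.toFinset, fun x => η + G (x 0) + G (x 1), η,
    η + (∑' y, G y) + ∑' y, G y, 3 * μ / 2, hη0, fun x => ?_, fun x => ?_, fun x hx => ?_, ?_⟩
  · linarith [hG0 (x 0), hG0 (x 1)]
  · linarith [hGs.le_tsum (x 0) fun y _ => hG0 y, hGs.le_tsum (x 1) fun y _ => hG0 y]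
  · have key : ∀ y z, (y = 0 → ¬ (z = 0 ∨ η ≤ G z)) → (z = 0 → ¬ (y = 0 ∨ η ≤ G y)) →
        (μ * G y - if y = 0 then 1 else 0) + (μ * G z - if z = 0 then 1 else 0)
          + γ * ((if y = 0 then 1 else 0) + if z = 0 then 1 else 0) * (η + G y + G z)
          ≤ 3 * μ / 2 * (η + G y + G z) := by
      have haux : ∀ z, G z < η →
          μ * G 0 - 1 + μ * G z + γ * (η + G 0 + G z) ≤ 3 * μ / 2 * (η + G 0 + G z) :=
          fun z hz => by
        have h1 := mul_lt_mul_of_pos_left hz hγ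
        have h2 : 0 ≤ μ * G z := mul_nonneg hμ0.le (hG0 z)
        have h3 : 0 ≤ μ * η := by positivity
        linarith
      intro y z h1 h2
      by_cases hy : y = 0
      · obtain ⟨hz, hzη⟩ := not_or.1 (h1 hy)
        subst hy
        rw [if_pos rfl, if_neg hz]
        linarith [haux z (not_le.1 hzη)]
      · by_cases hz : z = 0
        · obtain ⟨-, hyη⟩ := not_or.1 (h2 hz)
          subst hz
          rw [if_pos rfl, if_neg hy]
          linarith [haux y (not_le.1 hyη)]
        · rw [if_neg hy, if_neg hz]
          have h3 : 0 ≤ μ * G y := mul_nonneg hμ0.le (hG0 y)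
          have h4 : 0 ≤ μ * G z := mul_nonneg hμ0.le (hG0 z)
          have h5 : 0 ≤ μ * η := by positivity
          linarith
    rw [latticeOp_catalyst_two_add, hG, hG]
    have hx' : ¬ ((x 0 = 0 ∨ η ≤ G (x 0)) ∧ (x 1 = 0 ∨ η ≤ G (x 1))) := by
      simpa [Fintype.mem_piFinset, Fin.forall_fin_two] using hx
    exact key _ _ (fun h h' => hx' ⟨Or.inl h, h'⟩) fun h h' => hx' ⟨h', Or.inl h⟩
  · linarith

end TwoParticles

/-- Moment asymptotics for the parabolic Anderson model from the
perspective of a moving catalyst. Let `H^p = A^p + γV^p` be the `p`-th Anderson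
Hamiltonian, realized both on `ℓ²(ℤ^{pd})` (as `Hp`) and on `ℓ^∞(ℤ^{pd})` (as the
generator of the moment semigroup, encoded by the ODE `u' = H^p_∞ u`, `u 0 = 𝟙`,
whose unique solution is `t ↦ exp(t H^p_∞)𝟙`, the `p`-th mixed moment).
Assume either (i) `p = 1` or `p = 2` and `λ_p := sup σ(H^p) > 0`, or
(ii) `γ > 4d(κp + ρ)`. Then `λ_p > 0` and there is an `ℓ²`-normalized, strictly
positive, summable eigenfunction `v_p` of `H^p` for `λ_p` with
`e^{−λ_p t}·(exp(t H^p_∞)𝟙)(x) → (Σ_y v_p(y))·v_p(x)` for every `x`, i.e.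
`⟨∏_i u(t, Y_t + x_i)⟩ ~ e^{λ_p t} v_p(x) ‖v_p‖_{ℓ¹}`. -/
theorem moving_catalyst_moment_asymptotics
    (d p : ℕ) (hd : 1 ≤ d) (hp : 1 ≤ p)
    (κ ρ γ : ℝ) (hκ : 0 < κ) (hρ : 0 < ρ) (hγ : 0 < γ)
    (Hp : lp (fun _ : Fin p → Fin d → ℤ => ℝ) 2 →L[ℝ] lp (fun _ : Fin p → Fin d → ℤ => ℝ) 2)
    (hHp : ∀ (f : lp (fun _ : Fin p → Fin d → ℤ => ℝ) 2) (x : Fin p → Fin d → ℤ),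
      Hp f x = κ * (∑ i : Fin p, ∑ j : Fin d,
          ((f (Function.update x i (x i + Pi.single j 1)) - f x)
            + (f (Function.update x i (x i - Pi.single j 1)) - f x)))
        + ρ * (∑ j : Fin d,
          ((f (fun i => x i + Pi.single j 1) - f x)
            + (f (fun i => x i - Pi.single j 1) - f x)))
        + γ * ((∑ i : Fin p, if x i = 0 then (1:ℝ) else 0) * f x))
    (Hinf : ((Fin p → Fin d → ℤ) →ᵇ ℝ) →L[ℝ] ((Fin p → Fin d → ℤ) →ᵇ ℝ))
    (hHinf : ∀ (f : (Fin p → Fin d → ℤ) →ᵇ ℝ) (x : Fin p → Fin d → ℤ),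
      Hinf f x = κ * (∑ i : Fin p, ∑ j : Fin d,
          ((f (Function.update x i (x i + Pi.single j 1)) - f x)
            + (f (Function.update x i (x i - Pi.single j 1)) - f x)))
        + ρ * (∑ j : Fin d,
          ((f (fun i => x i + Pi.single j 1) - f x)
            + (f (fun i => x i - Pi.single j 1) - f x)))
        + γ * ((∑ i : Fin p, if x i = 0 then (1:ℝ) else 0) * f x))
    (u : ℝ → ((Fin p → Fin d → ℤ) →ᵇ ℝ)) (hu0 : u 0 = 1)
    (hu : ∀ t : ℝ, HasDerivAt u (Hinf (u t)) t)
    (hcase : ((p = 1 ∨ p = 2) ∧ 0 < sSup (spectrum ℝ Hp))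
      ∨ 4 * d * (κ * p + ρ) < γ) :
    0 < sSup (spectrum ℝ Hp) ∧
    ∃ v : lp (fun _ : Fin p → Fin d → ℤ => ℝ) 2, ‖v‖ = 1 ∧
      (∀ x : Fin p → Fin d → ℤ, 0 < v x) ∧
      Summable (fun x : Fin p → Fin d → ℤ => v x) ∧
      Hp v = sSup (spectrum ℝ Hp) • v ∧
      ∀ x : Fin p → Fin d → ℤ,
        Tendsto (fun t : ℝ => Real.exp (-(sSup (spectrum ℝ Hp)) * t) * u t x) atTop
          (𝓝 ((∑' y : Fin p → Fin d → ℤ, v y) * v x)) := by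
  have hH' : ∀ f x, Hp f x
      = latticeOp (catalystStep d p) (catalystRate d p κ ρ) (catalystPotential d p γ) f x :=
    fun f x => by rw [hHp, latticeOp_catalyst]
  have hHinf' : ∀ f x, Hinf f x
      = latticeOp (catalystStep d p) (catalystRate d p κ ρ) (catalystPotential d p γ) f x :=
    fun f x => by rw [hHinf, latticeOp_catalyst]
  have hp1 : (1 : ℝ) ≤ p := by exact_mod_cast hp
  have hrate := catalystRate_pos (d := d) (p := p) hκ hρ
  have honepoint : γ * (p - 1) < sSup (spectrum ℝ Hp) →
      0 < sSup (spectrum ℝ Hp) ∧ ∃ v : lp (fun _ : Fin p → Fin d → ℤ => ℝ) 2, ‖v‖ = 1 ∧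
        (∀ x, 0 < v x) ∧ Summable (fun x => v x) ∧ Hp v = sSup (spectrum ℝ Hp) • v ∧
        ∀ x, Tendsto (fun t : ℝ => Real.exp (-(sSup (spectrum ℝ Hp)) * t) * u t x) atTop
          (𝓝 ((∑' y, v y) * v x)) := fun h =>
    ⟨(mul_nonneg hγ.le (sub_nonneg.2 hp1)).trans_lt h,
      exists_ground_state_and_tendsto hrate closure_range_catalystStep
        (abs_catalystPotential_le hγ) hH' hHinf' hu0 hu (F := {0}) (φ := fun _ => 1) one_pos
        (fun _ => le_rfl) (fun _ => le_rfl) (fun x hx => by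
          simpa [latticeOp] using catalystPotential_le_of_ne_zero hγ (by simpa using hx)) h⟩
  rcases hcase with ⟨rfl | rfl, hl⟩ | hlarge
  · exact honepoint (by simpa using hl)
  · obtain ⟨F, φ, η, C, b, hη, hφη, hφC, hφ, hb⟩ := exists_supersolution_two hκ hρ hγ hH' hl
    exact ⟨hl, exists_ground_state_and_tendsto hrate closure_range_catalystStep
      (abs_catalystPotential_le hγ) hH' hHinf' hu0 hu hη hφη hφC hφ hb⟩
  · refine honepoint (lt_of_lt_of_le ?_ (catalyst_le_sSup_spectrum hp hγ hH'))
    have : 0 ≤ d * (κ * p + ρ) := by positivity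
    linarith
end

section
/- Let p = 2 and assume λ_2 := sup σ(H²) > 0. Then λ_2 is an eigenvalue of H², its eigenspace {v ∈ ℓ²(ℤ^{2d}) : H² v = λ_2 v} is one-dimensional and is spanned by a strictly positive function, and λ_2 is isolated in the point spectrum of H² (there is ε > 0 such that no eigenvalue of H² other than λ_2 lies in (λ_2 − ε, λ_2 + ε)). -/
open Filter Topology

section Hilbert

variable {E : Type*} [NormedAddCommGroup E] [InnerProductSpace ℝ E]

theorem norm_sq_le_mul_inner_of_nonneg {Q : E →L[ℝ] E}
    (hsymm : ∀ x y, inner ℝ (Q x) y = inner ℝ x (Q y)) (hnonneg : ∀ x, 0 ≤ inner ℝ (Q x) x)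
    (x : E) : ‖Q x‖ ^ 2 ≤ (‖Q‖ + 1) * inner ℝ (Q x) x := by
  have hM : 0 < ‖Q‖ + 1 := by positivity
  set t : ℝ := -(‖Q‖ + 1)⁻¹ with ht
  have h := hnonneg (x + t • Q x)
  have h1 : inner ℝ (Q (Q x)) x = ‖Q x‖ ^ 2 := by
    rw [hsymm, real_inner_self_eq_norm_sq]
  have h2 : inner ℝ (Q (Q x)) (Q x) ≤ (‖Q‖ + 1) * ‖Q x‖ ^ 2 := by
    calc inner ℝ (Q (Q x)) (Q x) ≤ ‖Q (Q x)‖ * ‖Q x‖ := real_inner_le_norm _ _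
      _ ≤ (‖Q‖ * ‖Q x‖) * ‖Q x‖ := by gcongr; exact Q.le_opNorm _
      _ ≤ (‖Q‖ + 1) * ‖Q x‖ ^ 2 := by nlinarith [sq_nonneg ‖Q x‖]
  simp only [map_add, map_smul, inner_add_left, inner_add_right, real_inner_smul_left,
    real_inner_smul_right, h1, real_inner_self_eq_norm_sq] at h
  have h3 : t * (‖Q‖ + 1) = -1 := by rw [ht]; field_simp
  have h4 : t * (t * inner ℝ (Q (Q x)) (Q x)) ≤ -t * ‖Q x‖ ^ 2 := by
    have := mul_le_mul_of_nonneg_left h2 (mul_self_nonneg t)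
    calc t * (t * inner ℝ (Q (Q x)) (Q x)) ≤ t * t * ((‖Q‖ + 1) * ‖Q x‖ ^ 2) := by linarith
      _ = t * (t * (‖Q‖ + 1)) * ‖Q x‖ ^ 2 := by ring
      _ = -t * ‖Q x‖ ^ 2 := by rw [h3]; ring
  have h5 : 0 ≤ inner ℝ (Q x) x + t * ‖Q x‖ ^ 2 := by linarith
  have h6 := mul_le_mul_of_nonneg_left h5 hM.le
  have h7 : (‖Q‖ + 1) * (t * ‖Q x‖ ^ 2) = -‖Q x‖ ^ 2 := by
    rw [← mul_assoc, mul_comm (‖Q‖ + 1) t, h3]; ring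
  linarith

/-- The top of the spectrum of a symmetric operator is the supremum of its quadratic form, and
it is an approximate eigenvalue. -/
theorem symmetric_sSup_spectrum [CompleteSpace E] [Nontrivial E] {H : E →L[ℝ] E}
    (hsymm : ∀ x y, inner ℝ (H x) y = inner ℝ x (H y)) :
    (∀ x, inner ℝ (H x) x ≤ sSup (spectrum ℝ H) * ‖x‖ ^ 2) ∧
    ∀ ε > 0, ∃ x, ‖x‖ = 1 ∧ ‖sSup (spectrum ℝ H) • x - H x‖ < ε := by
  set R : Set ℝ := {r | ∃ x : E, ‖x‖ = 1 ∧ inner ℝ (H x) x = r} with hR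
  have hne : R.Nonempty := by
    obtain ⟨x, hx⟩ := exists_norm_eq E (zero_le_one (α := ℝ))
    exact ⟨_, x, hx, rfl⟩
  have hbdd : BddAbove R := by
    refine ⟨‖H‖, ?_⟩
    rintro _ ⟨x, hx, rfl⟩
    calc inner ℝ (H x) x ≤ ‖H x‖ * ‖x‖ := real_inner_le_norm _ _
      _ ≤ (‖H‖ * ‖x‖) * ‖x‖ := by gcongr; exact H.le_opNorm _
      _ = ‖H‖ := by rw [hx]; ring
  set s := sSup R with hs
  have hle : ∀ x, inner ℝ (H x) x ≤ s * ‖x‖ ^ 2 := by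
    intro x
    rcases eq_or_ne x 0 with rfl | hx
    · simp
    have hn : 0 < ‖x‖ := norm_pos_iff.mpr hx
    have h := le_csSup hbdd (show inner ℝ (H (‖x‖⁻¹ • x)) (‖x‖⁻¹ • x) ∈ R from
      ⟨_, by rw [norm_smul, norm_inv, norm_norm, inv_mul_cancel₀ hn.ne'], rfl⟩)
    rw [map_smul, real_inner_smul_left, real_inner_smul_right, ← hs, ← mul_assoc, ← mul_inv,
      inv_mul_le_iff₀ (by positivity)] at h
    linarith
  set Q : E →L[ℝ] E := algebraMap ℝ (E →L[ℝ] E) s - H with hQ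
  have hQa : ∀ x, Q x = s • x - H x := fun x => by
    simp [hQ, Algebra.algebraMap_eq_smul_one]
  have hQsymm : ∀ x y, inner ℝ (Q x) y = inner ℝ x (Q y) := by
    intro x y
    simp only [hQa, inner_sub_left, inner_sub_right, real_inner_smul_left, real_inner_smul_right,
      hsymm]
  have hQnn : ∀ x, 0 ≤ inner ℝ (Q x) x := by
    intro x
    rw [hQa, inner_sub_left, real_inner_smul_left, real_inner_self_eq_norm_sq]
    linarith [hle x]
  have happ : ∀ ε > 0, ∃ x, ‖x‖ = 1 ∧ ‖Q x‖ < ε := by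
    intro ε hε
    have hM : 0 < ‖Q‖ + 1 := by positivity
    obtain ⟨_, ⟨x, hx, rfl⟩, hlt⟩ := exists_lt_of_lt_csSup hne
      (show s - ε ^ 2 / (‖Q‖ + 1) < s by linarith [show 0 < ε ^ 2 / (‖Q‖ + 1) by positivity])
    refine ⟨x, hx, lt_of_pow_lt_pow_left₀ 2 hε.le ?_⟩
    refine (norm_sq_le_mul_inner_of_nonneg hQsymm hQnn x).trans_lt ?_
    rw [← lt_div_iff₀' hM, hQa, inner_sub_left, real_inner_smul_left, real_inner_self_eq_norm_sq,
      hx]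
    linarith
  have hmem : s ∈ spectrum ℝ H := by
    rw [spectrum.mem_iff]
    rintro ⟨u, hu⟩
    have hinv : ∀ x, (↑u⁻¹ : E →L[ℝ] E) (Q x) = x := fun x => by
      have := congrArg (fun T : E →L[ℝ] E => T x) u.inv_mul
      rw [hu] at this
      simpa [hQa] using this
    obtain ⟨x, hx, hlt⟩ := happ (‖(↑u⁻¹ : E →L[ℝ] E)‖ + 1)⁻¹ (by positivity)
    have h := (↑u⁻¹ : E →L[ℝ] E).le_opNorm (Q x)
    rw [hinv, hx] at h
    have h0 : 0 < ‖(↑u⁻¹ : E →L[ℝ] E)‖ + 1 := by positivity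
    have h1 := mul_lt_mul_of_pos_left hlt h0
    rw [mul_inv_cancel₀ h0.ne'] at h1
    nlinarith [norm_nonneg (Q x)]
  have hub : ∀ t ∈ spectrum ℝ H, t ≤ s := by
    intro t ht
    by_contra! hlt
    rw [spectrum.mem_iff] at ht
    refine ht (ContinuousLinearMap.isUnit_of_forall_le_norm_inner_map _
      (c := ⟨t - s, by linarith⟩) (NNReal.coe_pos.mp (sub_pos.mpr hlt)) fun x => ?_)
    refine le_trans ?_ (le_abs_self _)
    have : (algebraMap ℝ (E →L[ℝ] E) t - H) x = t • x - H x := by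
      simp [Algebra.algebraMap_eq_smul_one]
    rw [this, inner_sub_left, real_inner_smul_left, real_inner_self_eq_norm_sq]
    change ‖x‖ ^ 2 * (t - s) ≤ _
    linarith [hle x]
  have hsup : sSup (spectrum ℝ H) = s := IsGreatest.csSup_eq ⟨hmem, hub⟩
  rw [hsup]
  exact ⟨hle, fun ε hε => by simpa only [hQa] using happ ε hε⟩

/-- If the quadratic form of `H` lies below `θ < l` up to a finite-rank correction, then bounded
approximate eigenvectors for `l` have convergent subsequences. -/
theorem exists_tendsto_subseq_of_approx_eigenvector [CompleteSpace E]
    {V : Type*} [NormedAddCommGroup V] [NormedSpace ℝ V] [FiniteDimensional ℝ V]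
    {H : E →L[ℝ] E} {P : E →L[ℝ] V} {θ C l : ℝ} (hθ : θ < l)
    (hform : ∀ x, inner ℝ (H x) x ≤ θ * ‖x‖ ^ 2 + C * ‖P x‖ ^ 2)
    {u : ℕ → E} (hu : ∀ n, ‖u n‖ = 1)
    (hlim : Tendsto (fun n => l • u n - H (u n)) atTop (𝓝 0)) :
    ∃ v : E, ‖v‖ = 1 ∧ H v = l • v ∧ ∃ k : ℕ → ℕ, StrictMono k ∧
      Tendsto (u ∘ k) atTop (𝓝 v) := by
  have : ProperSpace V := FiniteDimensional.proper ℝ V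
  obtain ⟨y, -, k, hk, hy⟩ := tendsto_subseq_of_bounded (Metric.isBounded_closedBall (x := (0 : V))
    (r := ‖P‖)) (x := fun n => P (u n)) fun n => by
      simpa [hu n] using P.le_opNorm (u n)
  have hlimk : Tendsto (fun n => l • u (k n) - H (u (k n))) atTop (𝓝 0) :=
    hlim.comp hk.tendsto_atTop
  have hcau : CauchySeq (u ∘ k) := by
    rw [cauchySeq_iff_tendsto_dist_atTop_0]
    have h1 := hlimk.comp (tendsto_fst (f := atTop) (g := (atTop : Filter ℕ)))
    have h2 := hlimk.comp (tendsto_snd (f := (atTop : Filter ℕ)) (g := atTop))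
    have h3 := hy.comp (tendsto_fst (f := atTop) (g := (atTop : Filter ℕ)))
    have h4 := hy.comp (tendsto_snd (f := (atTop : Filter ℕ)) (g := atTop))
    have h5 := ((((h1.sub h2).norm.mul_const 2).add
      (((h3.sub h4).norm.pow 2).const_mul C)).div_const (l - θ)).sqrt
    rw [prod_atTop_atTop_eq] at h5
    simp only [sub_self, norm_zero, zero_mul, ne_eq, OfNat.ofNat_ne_zero, not_false_eq_true,
      zero_pow, mul_zero, add_zero, zero_div, Real.sqrt_zero] at h5
    refine squeeze_zero (fun _ => dist_nonneg) (fun n => ?_) h5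
    rw [dist_eq_norm]
    refine Real.le_sqrt_of_sq_le ?_
    rw [le_div_iff₀ (by linarith)]
    simp only [Function.comp]
    set x := u (k n.1) - u (k n.2) with hx
    have hx2 : ‖x‖ ≤ 2 := by
      calc ‖x‖ ≤ ‖u (k n.1)‖ + ‖u (k n.2)‖ := norm_sub_le _ _
        _ = 2 := by rw [hu, hu]; norm_num
    have hPx : P (u (k n.1)) - P (u (k n.2)) = P x := by rw [hx, map_sub]
    have hQx : l • u (k n.1) - H (u (k n.1)) - (l • u (k n.2) - H (u (k n.2)))
        = l • x - H x := by
      rw [hx, map_sub, smul_sub]; abel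
    rw [hPx, hQx]
    have h6 : l * ‖x‖ ^ 2 - inner ℝ (H x) x ≤ ‖l • x - H x‖ * 2 := by
      calc l * ‖x‖ ^ 2 - inner ℝ (H x) x = inner ℝ (l • x - H x) x := by
            rw [inner_sub_left, real_inner_smul_left, real_inner_self_eq_norm_sq]
        _ ≤ ‖l • x - H x‖ * ‖x‖ := real_inner_le_norm _ _
        _ ≤ _ := by gcongr
    linarith [hform x]
  obtain ⟨v, hv⟩ := cauchySeq_tendsto_of_complete hcau
  refine ⟨v, ?_, ?_, k, hk, hv⟩
  · refine tendsto_nhds_unique hv.norm ?_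
    simp [hu]
  · have h1 : Tendsto (fun n => l • u (k n) - H (u (k n))) atTop (𝓝 (l • v - H v)) :=
      (hv.const_smul l).sub ((H.continuous.tendsto v).comp hv)
    exact (sub_eq_zero.mp (tendsto_nhds_unique h1 hlimk)).symm

/-- Under the same hypothesis, an eigenvalue `l` of a symmetric operator is isolated among the
eigenvalues. -/
theorem exists_isolating_radius [CompleteSpace E]
    {V : Type*} [NormedAddCommGroup V] [NormedSpace ℝ V] [FiniteDimensional ℝ V]
    {H : E →L[ℝ] E} {P : E →L[ℝ] V} {θ C l : ℝ} (hθ : θ < l)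
    (hsymm : ∀ x y, inner ℝ (H x) y = inner ℝ x (H y))
    (hform : ∀ x, inner ℝ (H x) x ≤ θ * ‖x‖ ^ 2 + C * ‖P x‖ ^ 2) :
    ∃ ε : ℝ, 0 < ε ∧ ∀ μ ∈ Set.Ioo (l - ε) (l + ε),
      (∃ w : E, w ≠ 0 ∧ H w = μ • w) → μ = l := by
  by_contra! hcon
  choose μ hμ hw hne using fun n : ℕ => hcon (1 / ((n : ℝ) + 1)) Nat.one_div_pos_of_nat
  choose w hw0 hw using hw
  set u : ℕ → E := fun n => ‖w n‖⁻¹ • w n with hu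
  have hu1 : ∀ n, ‖u n‖ = 1 := fun n => by
    rw [hu, norm_smul, norm_inv, norm_norm, inv_mul_cancel₀ (norm_ne_zero_iff.mpr (hw0 n))]
  have huH : ∀ n, H (u n) = μ n • u n := fun n => by
    simp only [hu, map_smul, hw n, smul_comm (μ n)]
  have hlim : Tendsto (fun n => l • u n - H (u n)) atTop (𝓝 0) := by
    refine squeeze_zero_norm (fun n => ?_) tendsto_one_div_add_atTop_nhds_zero_nat
    rw [huH, ← sub_smul, norm_smul, hu1, mul_one, Real.norm_eq_abs, abs_le]
    have := hμ n
    constructor <;> linarith [this.1, this.2]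
  obtain ⟨v, hv, hHv, k, -, hk⟩ := exists_tendsto_subseq_of_approx_eigenvector hθ hform hu1 hlim
  have horth : ∀ n, inner ℝ (u n) v = 0 := by
    intro n
    have h := hsymm (u n) v
    rw [huH, hHv, real_inner_smul_left, real_inner_smul_right] at h
    exact (mul_eq_zero.mp (show (μ n - l) * inner ℝ (u n) v = 0 by linarith)).resolve_left
      (sub_ne_zero.mpr (hne n))
  have h1 : Tendsto (fun n => inner ℝ (u (k n)) v) atTop (𝓝 (inner ℝ v v)) :=
    hk.inner tendsto_const_nhds
  simp only [horth, real_inner_self_eq_norm_sq, hv] at h1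
  exact absurd (tendsto_nhds_unique h1 tendsto_const_nhds) (by norm_num)

end Hilbert

section Correlation

theorem summable_mul_of_summable_sq {α : Type*} {f g : α → ℝ} (hf : Summable fun q => f q ^ 2)
    (hg : Summable fun q => g q ^ 2) : Summable fun q => f q * g q := by
  refine Summable.of_norm_bounded (hf.add hg) fun q => ?_
  rw [Real.norm_eq_abs, abs_le]
  constructor <;> nlinarith [sq_nonneg (f q + g q), sq_nonneg (f q - g q), sq_nonneg (f q),
    sq_nonneg (g q)]

theorem tsum_mul_le_sqrt_mul_sqrt {α : Type*} {f g : α → ℝ} (hf : Summable fun q => f q ^ 2)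
    (hg : Summable fun q => g q ^ 2) :
    ∑' q, f q * g q ≤ √(∑' q, f q ^ 2) * √(∑' q, g q ^ 2) := by
  have hfg := summable_mul_of_summable_sq hf hg
  refine hfg.tsum_le_of_sum_le fun s => (Real.sum_mul_le_sqrt_mul_sqrt s f g).trans ?_
  gcongr
  · exact hf.sum_le_tsum s fun _ _ => sq_nonneg _
  · exact hg.sum_le_tsum s fun _ _ => sq_nonneg _

/-- The correlation of `f`, shifted by `a`, with `g`. -/
noncomputable def corr {G : Type*} [AddCommGroup G] (a : G) (f g : G → ℝ) : ℝ := ∑' q, f (q + a) * g q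

variable {G : Type*} [AddCommGroup G] {f g : G → ℝ}

theorem summable_sq_add_right (hf : Summable fun q => f q ^ 2) (a : G) :
    Summable fun q => f (q + a) ^ 2 :=
  (Equiv.addRight a).summable_iff (f := fun q => f q ^ 2) |>.mpr hf

theorem hasSum_corr (hf : Summable fun q => f q ^ 2) (hg : Summable fun q => g q ^ 2) (a : G) :
    HasSum (fun q => f (q + a) * g q) (corr a f g) :=
  (summable_mul_of_summable_sq (summable_sq_add_right hf a) hg).hasSum

theorem corr_neg (a : G) (f g : G → ℝ) : corr (-a) f g = corr a g f := by
  rw [corr, ← (Equiv.addRight a).tsum_eq, corr]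
  exact tsum_congr fun q => by simp [mul_comm]

theorem corr_zero_self (f : G → ℝ) : corr 0 f f = ∑' q, f q ^ 2 := by
  simp [corr, sq]

theorem corr_self_le (hf : Summable fun q => f q ^ 2) (a : G) : corr a f f ≤ corr 0 f f := by
  have h := ((hasSum_corr hf hf 0).add
    ((Equiv.addRight a).hasSum_iff (f := fun q => f (q + 0) * f q) |>.mpr
      (hasSum_corr hf hf 0)))
  have h2 := hasSum_le (fun q => ?_) ((hasSum_corr hf hf a).mul_left 2) h
  · linarith
  · simp only [Function.comp, Equiv.coe_addRight, add_zero]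
    nlinarith [sq_nonneg (f (q + a) - f q)]

theorem corr_le_corr_abs (hf : Summable fun q => f q ^ 2) (a : G) :
    corr a f f ≤ corr a (fun q => |f q|) fun q => |f q| := by
  have hf' : Summable fun q => |f q| ^ 2 := by simpa using hf
  refine hasSum_le (fun q => ?_) (hasSum_corr hf hf a) (hasSum_corr hf' hf' a)
  rw [← abs_mul]
  exact le_abs_self _

end Correlation

section Product

theorem summable_sq_prod {G : Type*} {φ ψ : G → ℝ} (hφ : Summable fun x => φ x ^ 2)
    (hψ : Summable fun x => ψ x ^ 2) : Summable fun q : G × G => (φ q.1 * ψ q.2) ^ 2 := by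
  simpa only [mul_pow] using hφ.mul_of_nonneg hψ (fun _ => sq_nonneg _) (fun _ => sq_nonneg _)

/-- The norms of the sections of a function on a product over the first variable. -/
noncomputable def sectionNorm {G : Type*} (f : G × G → ℝ) (x : G) : ℝ := √(∑' y, f (x, y) ^ 2)

theorem sectionNorm_sq {G : Type*} (f : G × G → ℝ) (x : G) : sectionNorm f x ^ 2 = ∑' y, f (x, y) ^ 2 :=
  Real.sq_sqrt (tsum_nonneg fun _ => sq_nonneg _)

theorem summable_sectionNorm_sq {G : Type*} {f : G × G → ℝ} (hf : Summable fun q => f q ^ 2) :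
    Summable fun x => sectionNorm f x ^ 2 := by
  simp only [sectionNorm_sq]
  exact hf.prod

variable {G : Type*} [AddCommGroup G]

theorem corr_prod {φ : G → ℝ} (hφ : Summable fun x => φ x ^ 2) (a b : G) :
    corr (a, b) (fun q : G × G => φ q.1 * φ q.2) (fun q => φ q.1 * φ q.2) =
      corr a φ φ * corr b φ φ := by
  simp only [corr]
  rw [tsum_mul_tsum_of_summable_norm (hasSum_corr hφ hφ a).summable.norm
    (hasSum_corr hφ hφ b).summable.norm]
  exact tsum_congr fun q => by simp only [Prod.fst_add, Prod.snd_add]; ring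

theorem tsum_strip_prod [DecidableEq G] {φ : G → ℝ} (hφ : Summable fun x => φ x ^ 2) :
    ∑' q : G × G, (if q.1 = 0 then (1 : ℝ) else 0) * (φ q.1 * φ q.2) ^ 2 =
      φ 0 ^ 2 * corr 0 φ φ := by
  have h1 : HasSum (fun x : G => if x = 0 then φ 0 ^ 2 else 0) (φ 0 ^ 2) := hasSum_ite_eq 0 _
  rw [corr_zero_self, ← h1.tsum_eq, tsum_mul_tsum_of_summable_norm h1.summable.norm hφ.norm]
  refine tsum_congr fun q => ?_
  split_ifs with h
  · rw [h]; ring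
  · ring

variable {f : G × G → ℝ}

theorem corr_zero_sectionNorm (hf : Summable fun q => f q ^ 2) :
    corr 0 (sectionNorm f) (sectionNorm f) = corr 0 f f := by
  simp only [corr_zero_self, sectionNorm_sq]
  exact hf.tsum_prod.symm

theorem corr_le_corr_sectionNorm (hf : Summable fun q => f q ^ 2) (a b : G) :
    corr (a, b) f f ≤ corr a (sectionNorm f) (sectionNorm f) := by
  have hs := (hasSum_corr hf hf (a, b)).summable
  have hφ := summable_sectionNorm_sq hf
  rw [corr, hs.tsum_prod]
  refine hs.prod.tsum_le_tsum (fun x => ?_) (hasSum_corr hφ hφ a).summable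
  have h1 : Summable fun y => f (x + a, y) ^ 2 := hf.prod_factor (x + a)
  refine (tsum_mul_le_sqrt_mul_sqrt (summable_sq_add_right h1 b) (hf.prod_factor x)).trans_eq ?_
  have h2 : ∑' y, f (x + a, y + b) ^ 2 = ∑' y, f (x + a, y) ^ 2 :=
    (Equiv.addRight b).tsum_eq (fun y => f (x + a, y) ^ 2)
  rw [h2]
  rfl

theorem summable_strip [DecidableEq G] (hf : Summable fun q => f q ^ 2) :
    Summable fun q : G × G => (if q.1 = 0 then (1 : ℝ) else 0) * f q ^ 2 :=
  Summable.of_nonneg_of_le (fun q => by positivity)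
    (fun q => by split_ifs <;> nlinarith [sq_nonneg (f q)]) hf

theorem tsum_strip_eq [DecidableEq G] (hf : Summable fun q => f q ^ 2) :
    ∑' q : G × G, (if q.1 = 0 then (1 : ℝ) else 0) * f q ^ 2 = sectionNorm f 0 ^ 2 := by
  rw [(summable_strip hf).tsum_prod, tsum_eq_single 0]
  · simp [sectionNorm_sq]
  · intro x hx
    simp [hx]

theorem corr_comp_swap (a b : G) (f : G × G → ℝ) :
    corr (a, b) (f ∘ Prod.swap) (f ∘ Prod.swap) = corr (b, a) f f := by
  rw [corr, corr, ← (Equiv.prodComm G G).tsum_eq]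
  rfl

end Product

section Form

variable {G ι : Type*} [AddCommGroup G] [Fintype ι] {e : ι → G}

/-- The bilinear form of the correlated two-particle Laplacian. -/
noncomputable def kineticForm (κ ρ : ℝ) (e : ι → G) (f g : G × G → ℝ) : ℝ :=
  κ * ∑ j, ((corr (e j, 0) f g - corr 0 f g) + (corr (-e j, 0) f g - corr 0 f g)
      + (corr (0, e j) f g - corr 0 f g) + (corr (0, -e j) f g - corr 0 f g))
    + ρ * ∑ j, ((corr (e j, e j) f g - corr 0 f g) + (corr (-e j, -e j) f g - corr 0 f g))

/-- The quadratic form of the one-particle operator with jump rate `c` and a well at `0`. -/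
noncomputable def oneParticleForm (c γ : ℝ) (e : ι → G) (φ : G → ℝ) : ℝ :=
  c * ∑ j, ((corr (e j) φ φ - corr 0 φ φ) + (corr (-e j) φ φ - corr 0 φ φ)) + γ * φ 0 ^ 2

theorem kineticForm_comm (κ ρ : ℝ) (e : ι → G) (f g : G × G → ℝ) :
    kineticForm κ ρ e f g = kineticForm κ ρ e g f := by
  have h0 : corr 0 f g = corr 0 g f := by simpa using corr_neg 0 f g
  have h1 : ∀ a b : G, corr (-a, -b) f g = corr (a, b) g f := fun a b => corr_neg (a, b) f g
  have h2 : ∀ a b : G, corr (a, b) f g = corr (-a, -b) g f := fun a b =>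
    (corr_neg (a, b) g f).symm
  have h3 : ∀ a : G, corr (-a, 0) f g = corr (a, 0) g f := fun a => by simpa using h1 a 0
  have h4 : ∀ a : G, corr (0, -a) f g = corr (0, a) g f := fun a => by simpa using h1 0 a
  unfold kineticForm
  congr 2
  · refine Finset.sum_congr rfl fun j _ => ?_
    rw [h3, h4, h2 (e j) 0, h2 0 (e j), h0, neg_zero]
    ring
  · refine Finset.sum_congr rfl fun j _ => ?_
    rw [h1, h2 (e j) (e j), h0]
    ring

theorem kineticForm_comp_swap (κ ρ : ℝ) (e : ι → G) (f : G × G → ℝ) :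
    kineticForm κ ρ e (f ∘ Prod.swap) (f ∘ Prod.swap) = kineticForm κ ρ e f f := by
  have h0 : corr 0 (f ∘ Prod.swap) (f ∘ Prod.swap) = corr 0 f f := corr_comp_swap 0 0 f
  simp only [kineticForm, corr_comp_swap, h0]
  congr 2
  exact Finset.sum_congr rfl fun j _ => by ring

variable {κ ρ γ l : ℝ} {f : G × G → ℝ}

theorem kineticForm_le_abs (hκ : 0 ≤ κ) (hρ : 0 ≤ ρ) (hf : Summable fun q => f q ^ 2) :
    kineticForm κ ρ e f f ≤ kineticForm κ ρ e (fun q => |f q|) (fun q => |f q|) := by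
  have h0 : corr 0 (fun q => |f q|) (fun q => |f q|) = corr 0 f f := by simp [corr_zero_self]
  have h := corr_le_corr_abs hf
  unfold kineticForm
  rw [h0]
  gcongr <;> exact h _

/-- A product trial function makes the top of the two-particle form at least twice the top of
the one-particle form. -/
theorem oneParticleForm_le_half [DecidableEq G] (hρ : 0 ≤ ρ)
    (hl : ∀ f : G × G → ℝ, (Summable fun q => f q ^ 2) → kineticForm κ ρ e f f
      + γ * (∑' q : G × G, (if q.1 = 0 then (1 : ℝ) else 0) * f q ^ 2
        + ∑' q : G × G, (if q.2 = 0 then (1 : ℝ) else 0) * f q ^ 2) ≤ l * corr 0 f f)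
    {φ : G → ℝ} (hφ : Summable fun x => φ x ^ 2) :
    oneParticleForm (κ + ρ) γ e φ ≤ l / 2 * corr 0 φ φ := by
  set N := corr 0 φ φ with hN
  have hN0 : 0 ≤ N := by
    rw [hN, corr_zero_self]
    exact tsum_nonneg fun _ => sq_nonneg _
  rcases hN0.eq_or_lt with h0 | hpos
  · have hφ0 : ∀ x, φ x = 0 := by
      rw [hN, corr_zero_self] at h0
      have h := (hasSum_zero_iff_of_nonneg fun _ => sq_nonneg _).mp (h0 ▸ hφ.hasSum)
      exact fun x => by simpa using congrFun h x
    simp [oneParticleForm, corr, hφ0, ← h0]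
  have h := hl _ (summable_sq_prod hφ hφ)
  have hz : corr 0 (fun q : G × G => φ q.1 * φ q.2) (fun q => φ q.1 * φ q.2) = N * N :=
    corr_prod hφ 0 0
  have hs : ∑' q : G × G, (if q.2 = 0 then (1 : ℝ) else 0) * (φ q.1 * φ q.2) ^ 2 =
      φ 0 ^ 2 * N := by
    rw [← tsum_strip_prod hφ, ← (Equiv.prodComm G G).tsum_eq]
    exact tsum_congr fun q => by
      rw [mul_comm (φ q.1) (φ q.2)]
      rfl
  rw [tsum_strip_prod hφ, hs, hz] at h
  simp only [kineticForm, hz] at h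
  simp only [corr_prod hφ, ← hN] at h
  have hsq : ∀ s : ℝ, 2 * N * (s - N) ≤ s * s - N * N := fun s => by
    nlinarith [sq_nonneg (s - N)]
  have hρsum : 2 * N * ∑ j, ((corr (e j) φ φ - N) + (corr (-e j) φ φ - N)) ≤
      ∑ j, ((corr (e j) φ φ * corr (e j) φ φ - N * N)
        + (corr (-e j) φ φ * corr (-e j) φ φ - N * N)) := by
    rw [Finset.mul_sum]
    gcongr with j
    linarith [hsq (corr (e j) φ φ), hsq (corr (-e j) φ φ)]
  have hκsum : ∑ j, ((corr (e j) φ φ * N - N * N) + (corr (-e j) φ φ * N - N * N)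
        + (N * corr (e j) φ φ - N * N) + (N * corr (-e j) φ φ - N * N)) =
      2 * N * ∑ j, ((corr (e j) φ φ - N) + (corr (-e j) φ φ - N)) := by
    rw [Finset.mul_sum]
    exact Finset.sum_congr rfl fun j _ => by ring
  rw [hκsum] at h
  have hρmul := mul_le_mul_of_nonneg_left hρsum hρ
  refine le_of_mul_le_mul_left (a := 2 * N) ?_ (by positivity)
  rw [oneParticleForm, ← hN]
  linarith

/-- The form with a single strip potential is controlled by the one-particle form. -/
theorem kineticForm_add_fst_strip_le [DecidableEq G] (hκ : 0 ≤ κ) (hρ : 0 ≤ ρ)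
    (hl : ∀ φ : G → ℝ, (Summable fun x => φ x ^ 2) →
      oneParticleForm (κ + ρ) γ e φ ≤ l * corr 0 φ φ)
    (hf : Summable fun q => f q ^ 2) :
    kineticForm κ ρ e f f + γ * ∑' q : G × G, (if q.1 = 0 then (1 : ℝ) else 0) * f q ^ 2 ≤
      l * corr 0 f f := by
  have h := hl _ (summable_sectionNorm_sq hf)
  rw [corr_zero_sectionNorm hf] at h
  refine le_trans ?_ h
  rw [tsum_strip_eq hf, oneParticleForm, corr_zero_sectionNorm hf, kineticForm]
  gcongr
  rw [add_mul]
  have hc := corr_le_corr_sectionNorm hf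
  have h0 := corr_self_le hf
  refine add_le_add (mul_le_mul_of_nonneg_left (Finset.sum_le_sum fun j _ => ?_) hκ)
    (mul_le_mul_of_nonneg_left (Finset.sum_le_sum fun j _ => ?_) hρ)
  · linarith [hc (e j) 0, hc (-e j) 0, h0 (0, e j), h0 (0, -e j)]
  · linarith [hc (e j) (e j), hc (-e j) (-e j)]

theorem kineticForm_add_snd_strip_le [DecidableEq G] (hκ : 0 ≤ κ) (hρ : 0 ≤ ρ)
    (hl : ∀ φ : G → ℝ, (Summable fun x => φ x ^ 2) →
      oneParticleForm (κ + ρ) γ e φ ≤ l * corr 0 φ φ)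
    (hf : Summable fun q => f q ^ 2) :
    kineticForm κ ρ e f f + γ * ∑' q : G × G, (if q.2 = 0 then (1 : ℝ) else 0) * f q ^ 2 ≤
      l * corr 0 f f := by
  have h := kineticForm_add_fst_strip_le hκ hρ hl (f := f ∘ Prod.swap)
    ((Equiv.prodComm G G).summable_iff (f := fun q => f q ^ 2) |>.mpr hf)
  have h0 : corr 0 (f ∘ Prod.swap) (f ∘ Prod.swap) = corr 0 f f := corr_comp_swap 0 0 f
  rw [kineticForm_comp_swap, h0] at h
  rwa [← (Equiv.prodComm G G).tsum_eq]

/-- Localization of a correlation by `cos ∘ χ` and `sin ∘ χ`. -/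
theorem corr_le_localized {χ : G → ℝ} {δ : ℝ} {a : G} {f : G → ℝ}
    (hχ : ∀ q, |χ (q + a) - χ q| ≤ δ) (hf : Summable fun q => f q ^ 2)
    (hc : Summable fun q => (Real.cos (χ q) * f q) ^ 2)
    (hs : Summable fun q => (Real.sin (χ q) * f q) ^ 2) :
    corr a f f ≤ corr a (fun q => Real.cos (χ q) * f q) (fun q => Real.cos (χ q) * f q)
      + corr a (fun q => Real.sin (χ q) * f q) (fun q => Real.sin (χ q) * f q)
      + δ ^ 2 / 2 * corr 0 f f := by
  have hz := hasSum_corr hf hf 0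
  have h := ((hasSum_corr hc hc a).add (hasSum_corr hs hs a)).add
    ((hz.add ((Equiv.addRight a).hasSum_iff (f := fun q => f (q + 0) * f q) |>.mpr hz)).mul_left
      (δ ^ 2 / 4))
  have h2 := hasSum_le (fun q => ?_) (hasSum_corr hf hf a) h
  · linarith
  · simp only [Function.comp, Equiv.coe_addRight, add_zero]
    have hcos : Real.cos (χ (q + a)) * Real.cos (χ q) + Real.sin (χ (q + a)) * Real.sin (χ q) =
        Real.cos (χ (q + a) - χ q) := (Real.cos_sub _ _).symm
    set t := χ (q + a) - χ q
    have h1 : 1 - t ^ 2 / 2 ≤ Real.cos t := Real.one_sub_sq_div_two_le_cos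
    have h3 : t ^ 2 ≤ δ ^ 2 := sq_le_sq' (neg_le_of_abs_le (hχ q)) (le_of_abs_le (hχ q))
    have h4 : (1 - Real.cos t) * (f (q + a) * f q) ≤
        δ ^ 2 / 2 * ((f (q + a) ^ 2 + f q ^ 2) / 2) := by
      have h5 : 0 ≤ 1 - Real.cos t := by linarith [Real.cos_le_one t]
      calc (1 - Real.cos t) * (f (q + a) * f q) ≤
          (1 - Real.cos t) * ((f (q + a) ^ 2 + f q ^ 2) / 2) := by
            gcongr
            nlinarith [sq_nonneg (f (q + a) - f q)]
        _ ≤ _ := by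
            gcongr
            linarith
    rw [← hcos] at h4
    linarith

theorem corr_zero_localized {χ : G → ℝ} {f : G → ℝ}
    (hc : Summable fun q => (Real.cos (χ q) * f q) ^ 2)
    (hs : Summable fun q => (Real.sin (χ q) * f q) ^ 2) :
    corr 0 (fun q => Real.cos (χ q) * f q) (fun q => Real.cos (χ q) * f q)
      + corr 0 (fun q => Real.sin (χ q) * f q) (fun q => Real.sin (χ q) * f q) =
      corr 0 f f := by
  simp only [corr_zero_self]
  rw [← hc.tsum_add hs]
  refine tsum_congr fun q => ?_
  rw [mul_pow, mul_pow, ← add_mul, Real.cos_sq_add_sin_sq, one_mul]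

theorem summable_sq_mul_of_abs_le_one {α : Type*} {f w : α → ℝ} (hw : ∀ q, |w q| ≤ 1)
    (hf : Summable fun q => f q ^ 2) : Summable fun q => (w q * f q) ^ 2 := by
  refine Summable.of_nonneg_of_le (fun _ => sq_nonneg _) (fun q => ?_) hf
  rw [mul_pow]
  exact mul_le_of_le_one_left (sq_nonneg _) ((sq_le_one_iff_abs_le_one _).mpr (hw q))

/-- Below the threshold `2 l`, the two-particle form is bounded by `l` up to a localization error
and finitely many coordinates. -/
theorem form_le_of_localization [DecidableEq G] (hκ : 0 ≤ κ) (hρ : 0 ≤ ρ) (hγ : 0 ≤ γ)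
    (hl : ∀ φ : G → ℝ, (Summable fun x => φ x ^ 2) →
      oneParticleForm (κ + ρ) γ e φ ≤ l * corr 0 φ φ)
    {χ : G × G → ℝ} {δ : ℝ} {F : Finset (G × G)}
    (hχ : ∀ a b j, (a = 0 ∨ a = e j ∨ a = -e j) → (b = 0 ∨ b = e j ∨ b = -e j) →
      ∀ q, |χ (q + (a, b)) - χ q| ≤ δ)
    (hχ1 : ∀ q ∉ F, q.1 = 0 → χ q = 0) (hχ2 : ∀ q ∉ F, q.2 = 0 → χ q = Real.pi / 2)
    (hf : Summable fun q => f q ^ 2) :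
    kineticForm κ ρ e f f
      + γ * (∑' q : G × G, (if q.1 = 0 then (1 : ℝ) else 0) * f q ^ 2
        + ∑' q : G × G, (if q.2 = 0 then (1 : ℝ) else 0) * f q ^ 2) ≤
      (l + (2 * κ + ρ) * Fintype.card ι * δ ^ 2) * corr 0 f f + 2 * γ * ∑ q ∈ F, f q ^ 2 := by
  have hc := summable_sq_mul_of_abs_le_one (w := fun q => Real.cos (χ q))
    (fun _ => Real.abs_cos_le_one _) hf
  have hs := summable_sq_mul_of_abs_le_one (w := fun q => Real.sin (χ q))
    (fun _ => Real.abs_sin_le_one _) hf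
  have h1 := kineticForm_add_fst_strip_le hκ hρ hl hc
  have h2 := kineticForm_add_snd_strip_le hκ hρ hl hs
  have hz := corr_zero_localized hc hs
  have hF : HasSum (fun q => if q ∈ F then f q ^ 2 else 0) (∑ q ∈ F, f q ^ 2) := by
    rw [← Finset.sum_congr rfl fun q hq => if_pos (c := q ∈ F) hq]
    exact hasSum_sum_of_ne_finset_zero fun q hq => if_neg hq
  have hsnd : ∀ {f : G × G → ℝ}, (Summable fun q => f q ^ 2) →
      Summable fun q : G × G => (if q.2 = 0 then (1 : ℝ) else 0) * f q ^ 2 := fun hf =>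
    Summable.of_nonneg_of_le (fun q => by positivity)
      (fun q => mul_le_of_le_one_left (sq_nonneg _) (by split_ifs <;> norm_num)) hf
  have hs1 := hasSum_le (fun q => ?_) (summable_strip hf).hasSum
    ((summable_strip hc).hasSum.add hF)
  have hs2 := hasSum_le (fun q => ?_) (hsnd hf).hasSum ((hsnd hs).hasSum.add hF)
  · have hkin : kineticForm κ ρ e f f ≤
        kineticForm κ ρ e (fun q => Real.cos (χ q) * f q) (fun q => Real.cos (χ q) * f q)
        + kineticForm κ ρ e (fun q => Real.sin (χ q) * f q) (fun q => Real.sin (χ q) * f q)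
        + (2 * κ + ρ) * Fintype.card ι * δ ^ 2 * corr 0 f f := by
      have hloc := fun a b j ha hb => corr_le_localized (hχ a b j ha hb) hf hc hs
      have e1 := fun j => hloc (e j) 0 j (by simp) (by simp)
      have e2 := fun j => hloc (-e j) 0 j (by simp) (by simp)
      have e3 := fun j => hloc 0 (e j) j (by simp) (by simp)
      have e4 := fun j => hloc 0 (-e j) j (by simp) (by simp)
      have e5 := fun j => hloc (e j) (e j) j (by simp) (by simp)
      have e6 := fun j => hloc (-e j) (-e j) j (by simp) (by simp)
      have hconst : ∀ c : ℝ, (Fintype.card ι : ℝ) * c = ∑ _j : ι, c := fun c => by simp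
      have hre : (2 * κ + ρ) * Fintype.card ι * δ ^ 2 * corr 0 f f =
          κ * ∑ _j : ι, 2 * (δ ^ 2 * corr 0 f f) + ρ * ∑ _j : ι, δ ^ 2 * corr 0 f f := by
        rw [← hconst, ← hconst]; ring
      rw [hre]
      have hκs := mul_le_mul_of_nonneg_left (Finset.sum_le_sum fun j (_ : j ∈ Finset.univ) =>
        add_le_add (add_le_add (e1 j) (e2 j)) (add_le_add (e3 j) (e4 j))) hκ
      have hρs := mul_le_mul_of_nonneg_left (Finset.sum_le_sum fun j (_ : j ∈ Finset.univ) =>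
        add_le_add (e5 j) (e6 j)) hρ
      simp only [kineticForm, Finset.sum_add_distrib, Finset.sum_sub_distrib, mul_add, mul_sub,
        ← Finset.mul_sum, Finset.sum_const, nsmul_eq_mul] at hκs hρs ⊢
      rw [← hz] at hκs hρs ⊢
      linarith
    have hγs := mul_le_mul_of_nonneg_left (add_le_add hs1 hs2) hγ
    rw [← hz] at hkin ⊢
    linarith
  · by_cases hq : q ∈ F
    · simp only [hq, if_true]
      split_ifs <;> nlinarith [sq_nonneg (f q), sq_nonneg (Real.sin (χ q) * f q)]
    · by_cases h0 : q.2 = 0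
      · simp [hq, h0, hχ2 q hq h0]
      · simp [hq, h0]
  · by_cases hq : q ∈ F
    · simp only [hq, if_true]
      split_ifs <;> nlinarith [sq_nonneg (f q), sq_nonneg (Real.cos (χ q) * f q)]
    · by_cases h0 : q.1 = 0
      · simp [hq, h0, hχ1 q hq h0]
      · simp [hq, h0]

end Form

section SquareSummable

variable {α : Type*}

theorem lp.summable_sq (f : lp (fun _ : α => ℝ) 2) : Summable fun q => f q ^ 2 := by
  have h := (lp.memℓp f).summable (by norm_num)
  simpa using h

theorem memℓp_two_of_summable_sq {f : α → ℝ} (hf : Summable fun q => f q ^ 2) :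
    Memℓp f 2 :=
  memℓp_gen (by simpa using hf)

theorem lp.hasSum_mul (f g : lp (fun _ : α => ℝ) 2) :
    HasSum (fun q => f q * g q) (inner ℝ f g) := by
  simpa [mul_comm] using lp.hasSum_inner (𝕜 := ℝ) f g

theorem lp.norm_sq_eq_corr [AddCommGroup α] (f : lp (fun _ : α => ℝ) 2) :
    ‖f‖ ^ 2 = corr 0 f f := by
  rw [← real_inner_self_eq_norm_sq, ← (lp.hasSum_mul f f).tsum_eq]
  simp [corr]

/-- Restriction of a square-summable function to finitely many points. -/
theorem lp.exists_restrict (F : Finset α) : ∃ P : lp (fun _ : α => ℝ) 2 →L[ℝ] (F → ℝ),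
    ∀ f, ∑ q ∈ F, f q ^ 2 ≤ F.card * ‖P f‖ ^ 2 := by
  refine ⟨ContinuousLinearMap.pi fun q => lp.evalCLM ℝ (fun _ : α => ℝ) 2 q, fun f => ?_⟩
  rw [← nsmul_eq_mul]
  refine Finset.sum_le_card_nsmul _ _ _ fun q hq => ?_
  rw [← sq_abs]
  gcongr
  exact norm_le_pi_norm (ContinuousLinearMap.pi (fun q : F =>
    lp.evalCLM ℝ (fun _ : α => ℝ) 2 (q : α)) f) ⟨q, hq⟩

end SquareSummable

section Lattice

variable {d : ℕ}

/-- A slowly varying angle which, away from finitely many points, vanishes on the first strip and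
equals `π / 2` on the second one. -/
theorem exists_localization_angle (d : ℕ) {δ : ℝ} (hδ : 0 < δ) :
    ∃ (χ : (Fin d → ℤ) × (Fin d → ℤ) → ℝ) (F : Finset ((Fin d → ℤ) × (Fin d → ℤ))),
      (∀ a b j, (a = 0 ∨ a = Pi.single j 1 ∨ a = -Pi.single j 1) →
        (b = 0 ∨ b = Pi.single j 1 ∨ b = -Pi.single j 1) →
        ∀ q, |χ (q + (a, b)) - χ q| ≤ δ) ∧
      (∀ q ∉ F, q.1 = 0 → χ q = 0) ∧ (∀ q ∉ F, q.2 = 0 → χ q = Real.pi / 2) := by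
  set R : ℝ := 2 / δ with hR
  have hR0 : 0 < R := by positivity
  have hfin : (Metric.closedBall (0 : Fin d → ℤ) R ×ˢ
      Metric.closedBall (0 : Fin d → ℤ) R).Finite :=
    ((isCompact_closedBall _ _).finite_of_discrete).prod
      ((isCompact_closedBall _ _).finite_of_discrete)
  have hunit : ∀ (a : Fin d → ℤ) j, (a = 0 ∨ a = Pi.single j 1 ∨ a = -Pi.single j 1) →
      ‖a‖ ≤ 1 := by
    have h1 : ∀ j, ‖(Pi.single j 1 : Fin d → ℤ)‖ ≤ 1 := fun j => by
      rw [pi_norm_le_iff_of_nonneg zero_le_one]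
      intro i
      rcases eq_or_ne i j with rfl | h
      · simp
      · simp [h]
    rintro a j (rfl | rfl | rfl)
    · simp
    · exact h1 j
    · rw [norm_neg]
      exact h1 j
  refine ⟨fun q => Real.pi / 4 * (1 + max (-1) (min 1 ((‖q.1‖ - ‖q.2‖) / R))), hfin.toFinset,
    ?_, ?_, ?_⟩
  · intro a b j ha hb q
    have hclamp : ∀ s t : ℝ, |max (-1) (min 1 s) - max (-1) (min 1 t)| ≤ |s - t| := fun s t => by
      rw [max_comm (-1), max_comm (-1)]
      exact (abs_max_sub_max_le_abs _ _ _).trans (by simpa using abs_min_sub_min_le_max 1 s 1 t)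
    have h1 : |‖q.1 + a‖ - ‖q.1‖| ≤ 1 :=
      (abs_norm_sub_norm_le _ _).trans (by simpa using hunit a j ha)
    have h2 : |‖q.2 + b‖ - ‖q.2‖| ≤ 1 :=
      (abs_norm_sub_norm_le _ _).trans (by simpa using hunit b j hb)
    have h3 : |(‖q.1 + a‖ - ‖q.2 + b‖) / R - (‖q.1‖ - ‖q.2‖) / R| ≤ δ := by
      rw [← sub_div, abs_div, abs_of_pos hR0, div_le_iff₀ hR0, hR, mul_div_cancel₀ _ hδ.ne']
      rw [abs_le] at h1 h2 ⊢
      constructor <;> linarith [h1.1, h1.2, h2.1, h2.2]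
    have h4 := (hclamp _ _).trans h3
    rw [← mul_sub, add_sub_add_left_eq_sub, abs_mul, abs_of_pos (by positivity)]
    have h5 : Real.pi / 4 ≤ 1 := by linarith [Real.pi_le_four]
    calc _ ≤ 1 * δ := by gcongr; exact h4
      _ = δ := one_mul δ
  · intro q hq h0
    have hlt : R < ‖q.2‖ := by
      by_contra! hle
      exact hq (by simp [h0, hR0.le, hle])
    have : (‖q.1‖ - ‖q.2‖) / R ≤ -1 := by
      rw [div_le_iff₀ hR0, h0, norm_zero]
      linarith
    simp only
    rw [max_eq_left ((min_le_right _ _).trans this)]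
    ring
  · intro q hq h0
    have hlt : R < ‖q.1‖ := by
      by_contra! hle
      exact hq (by simp [h0, hR0.le, hle])
    have : 1 ≤ (‖q.1‖ - ‖q.2‖) / R := by
      rw [le_div_iff₀ hR0, h0, norm_zero]
      linarith
    simp only
    rw [min_eq_left this, max_eq_right (by norm_num)]
    ring

/-- A nonnegative solution of the eigenvalue equation with a zero vanishes identically. -/
theorem eq_zero_of_nonneg_of_apply_eq_zero {κ ρ γ l : ℝ} (hκ : 0 < κ) (hρ : 0 ≤ ρ)
    {f : (Fin d → ℤ) × (Fin d → ℤ) → ℝ} (hf : ∀ q, 0 ≤ f q)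
    (heq : ∀ q, κ * (∑ j : Fin d,
          ((f (q.1 + Pi.single j 1, q.2) - f q) + (f (q.1 - Pi.single j 1, q.2) - f q)
            + (f (q.1, q.2 + Pi.single j 1) - f q) + (f (q.1, q.2 - Pi.single j 1) - f q)))
        + ρ * (∑ j : Fin d,
          ((f (q.1 + Pi.single j 1, q.2 + Pi.single j 1) - f q)
            + (f (q.1 - Pi.single j 1, q.2 - Pi.single j 1) - f q)))
        + γ * (((if q.1 = 0 then (1:ℝ) else 0) + (if q.2 = 0 then (1:ℝ) else 0)) * f q) =
        l * f q)
    {q₀ : (Fin d → ℤ) × (Fin d → ℤ)} (h0 : f q₀ = 0) (q : (Fin d → ℤ) × (Fin d → ℤ)) :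
    f q = 0 := by
  have hstep : ∀ q, f q = 0 → ∀ j,
      f (q.1 + Pi.single j 1, q.2) = 0 ∧ f (q.1 - Pi.single j 1, q.2) = 0 ∧
      f (q.1, q.2 + Pi.single j 1) = 0 ∧ f (q.1, q.2 - Pi.single j 1) = 0 := by
    intro q hq j
    have h := heq q
    simp only [hq, sub_zero, mul_zero, add_zero] at h
    have hnn : ∀ j : Fin d, 0 ≤ f (q.1 + Pi.single j 1, q.2) + f (q.1 - Pi.single j 1, q.2)
        + f (q.1, q.2 + Pi.single j 1) + f (q.1, q.2 - Pi.single j 1) := fun j => by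
      linarith [hf (q.1 + Pi.single j 1, q.2), hf (q.1 - Pi.single j 1, q.2),
        hf (q.1, q.2 + Pi.single j 1), hf (q.1, q.2 - Pi.single j 1)]
    have hρs := mul_nonneg hρ (Finset.sum_nonneg fun j (_ : j ∈ Finset.univ) =>
      add_nonneg (hf (q.1 + Pi.single j 1, q.2 + Pi.single j 1))
        (hf (q.1 - Pi.single j 1, q.2 - Pi.single j 1)))
    have hκs := Finset.sum_nonneg fun j (_ : j ∈ Finset.univ) => hnn j
    have hz := (Finset.sum_eq_zero_iff_of_nonneg fun j _ => hnn j).mp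
      (le_antisymm (nonpos_of_mul_nonpos_right (by linarith) hκ) hκs) j (Finset.mem_univ j)
    have h1 := hf (q.1 + Pi.single j 1, q.2)
    have h2 := hf (q.1 - Pi.single j 1, q.2)
    have h3 := hf (q.1, q.2 + Pi.single j 1)
    have h4 := hf (q.1, q.2 - Pi.single j 1)
    refine ⟨?_, ?_, ?_, ?_⟩ <;> linarith
  let D : AddSubgroup ((Fin d → ℤ) × (Fin d → ℤ)) :=
    { carrier := {a | ∀ q, f q = 0 ↔ f (q + a) = 0}
      zero_mem' := fun q => by simp
      add_mem' := fun {a b} ha hb q => by rw [← add_assoc, ha q, hb (q + a)]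
      neg_mem' := fun {a} ha q => by rw [ha (q + -a), neg_add_cancel_right] }
  have hD1 : ∀ j, AddMonoidHom.inl (Fin d → ℤ) (Fin d → ℤ) (Pi.single j 1) ∈ D := fun j q => by
    have hadd : q + AddMonoidHom.inl _ _ (Pi.single j 1) = (q.1 + Pi.single j 1, q.2) :=
      Prod.ext rfl (add_zero _)
    refine ⟨fun h => hadd ▸ (hstep q h j).1, fun h => ?_⟩
    simpa using (hstep _ h j).2.1
  have hD2 : ∀ j, AddMonoidHom.inr (Fin d → ℤ) (Fin d → ℤ) (Pi.single j 1) ∈ D := fun j q => by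
    have hadd : q + AddMonoidHom.inr _ _ (Pi.single j 1) = (q.1, q.2 + Pi.single j 1) :=
      Prod.ext (add_zero _) rfl
    refine ⟨fun h => hadd ▸ (hstep q h j).2.2.1, fun h => ?_⟩
    simpa using (hstep _ h j).2.2.2
  have hgen : ∀ (φ : (Fin d → ℤ) →+ (Fin d → ℤ) × (Fin d → ℤ)),
      (∀ j, φ (Pi.single j 1) ∈ D) → ∀ x, φ x ∈ D := by
    intro φ hφ x
    rw [← Finset.univ_sum_single x, map_sum]
    refine D.sum_mem fun j _ => ?_
    have : (Pi.single j (x j) : Fin d → ℤ) = x j • Pi.single j 1 := by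
      rw [← Pi.single_smul, smul_eq_mul, mul_one]
    rw [this, map_zsmul]
    exact D.zsmul_mem (hφ j) _
  have hmem : q - q₀ ∈ D := by
    have h := D.add_mem (hgen _ hD1 (q - q₀).1) (hgen _ hD2 (q - q₀).2)
    rwa [AddMonoidHom.inl_apply, AddMonoidHom.inr_apply, Prod.fst_add_snd] at h
  simpa using (hmem q₀).mp h0

end Lattice

/-- The quadratic form of the two-particle Anderson operator. -/
theorem inner_eq_kineticForm_add
    {d : ℕ} {κ ρ γ : ℝ}
    {H2 : lp (fun _ : (Fin d → ℤ) × (Fin d → ℤ) => ℝ) 2 →L[ℝ]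
      lp (fun _ : (Fin d → ℤ) × (Fin d → ℤ) => ℝ) 2}
    (hH2 : ∀ (f : lp (fun _ : (Fin d → ℤ) × (Fin d → ℤ) => ℝ) 2)
        (q : (Fin d → ℤ) × (Fin d → ℤ)),
      H2 f q = κ * (∑ j : Fin d,
          ((f (q.1 + Pi.single j 1, q.2) - f q) + (f (q.1 - Pi.single j 1, q.2) - f q)
            + (f (q.1, q.2 + Pi.single j 1) - f q) + (f (q.1, q.2 - Pi.single j 1) - f q)))
        + ρ * (∑ j : Fin d,
          ((f (q.1 + Pi.single j 1, q.2 + Pi.single j 1) - f q)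
            + (f (q.1 - Pi.single j 1, q.2 - Pi.single j 1) - f q)))
        + γ * (((if q.1 = 0 then (1:ℝ) else 0) + (if q.2 = 0 then (1:ℝ) else 0)) * f q))
    (f g : lp (fun _ : (Fin d → ℤ) × (Fin d → ℤ) => ℝ) 2) :
    inner ℝ (H2 f) g = kineticForm κ ρ (fun j : Fin d => Pi.single j 1) f g
      + γ * (∑' q : (Fin d → ℤ) × (Fin d → ℤ), (if q.1 = 0 then (1 : ℝ) else 0) * (f q * g q)
        + ∑' q : (Fin d → ℤ) × (Fin d → ℤ), (if q.2 = 0 then (1 : ℝ) else 0) * (f q * g q)) := by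
  have hc := hasSum_corr (lp.summable_sq f) (lp.summable_sq g)
  have hw : ∀ w : (Fin d → ℤ) × (Fin d → ℤ) → ℝ, (∀ q, |w q| ≤ 1) →
      HasSum (fun q => w q * (f q * g q)) (∑' q, w q * (f q * g q)) := fun w hw => by
    refine (Summable.of_norm_bounded (lp.hasSum_mul f g).summable.norm fun q => ?_).hasSum
    rw [norm_mul]
    exact mul_le_of_le_one_left (norm_nonneg _) (hw q)
  have h1 := hw (fun q => if q.1 = 0 then (1 : ℝ) else 0) fun q => by split_ifs <;> simp
  have h2 := hw (fun q => if q.2 = 0 then (1 : ℝ) else 0) fun q => by split_ifs <;> simp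
  have hκs := (hasSum_sum (s := Finset.univ) fun (j : Fin d) _ =>
    ((((hc (Pi.single j 1, 0)).sub (hc 0)).add ((hc (-Pi.single j 1, 0)).sub (hc 0))).add
      ((hc (0, Pi.single j 1)).sub (hc 0))).add ((hc (0, -Pi.single j 1)).sub (hc 0))).mul_left κ
  have hρs := (hasSum_sum (s := Finset.univ) fun (j : Fin d) _ =>
    ((hc (Pi.single j 1, Pi.single j 1)).sub (hc 0)).add
      ((hc (-Pi.single j 1, -Pi.single j 1)).sub (hc 0))).mul_left ρ
  refine (lp.hasSum_mul (H2 f) g).unique ?_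
  refine ((hκs.add hρs).add ((h1.add h2).mul_left γ)).congr_fun fun q => ?_
  have hadd : ∀ a b : Fin d → ℤ, q + (a, b) = (q.1 + a, q.2 + b) := fun _ _ => rfl
  simp only [add_zero]
  simp only [hH2, hadd, add_zero, ← sub_eq_add_neg, ← sub_mul, ← add_mul, ← Finset.sum_mul]
  ring

/-- Let `H² = A² + γV²` be the second Anderson Hamiltonian on
`ℓ²(ℤ^d × ℤ^d)` and assume `λ₂ := sup σ(H²) > 0`. Then `λ₂` is an eigenvalue of
`H²`, its eigenspace is one-dimensional and spanned by a strictly positive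
function, and `λ₂` is isolated in the point spectrum of `H²`. -/
theorem principal_eigenfunction_H2
    (d : ℕ) (hd : 1 ≤ d)
    (κ ρ γ : ℝ) (hκ : 0 < κ) (hρ : 0 < ρ) (hγ : 0 < γ)
    (H2 : lp (fun _ : (Fin d → ℤ) × (Fin d → ℤ) => ℝ) 2 →L[ℝ]
      lp (fun _ : (Fin d → ℤ) × (Fin d → ℤ) => ℝ) 2)
    (hH2 : ∀ (f : lp (fun _ : (Fin d → ℤ) × (Fin d → ℤ) => ℝ) 2)
        (q : (Fin d → ℤ) × (Fin d → ℤ)),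
      H2 f q = κ * (∑ j : Fin d,
          ((f (q.1 + Pi.single j 1, q.2) - f q) + (f (q.1 - Pi.single j 1, q.2) - f q)
            + (f (q.1, q.2 + Pi.single j 1) - f q) + (f (q.1, q.2 - Pi.single j 1) - f q)))
        + ρ * (∑ j : Fin d,
          ((f (q.1 + Pi.single j 1, q.2 + Pi.single j 1) - f q)
            + (f (q.1 - Pi.single j 1, q.2 - Pi.single j 1) - f q)))
        + γ * (((if q.1 = 0 then (1:ℝ) else 0) + (if q.2 = 0 then (1:ℝ) else 0)) * f q))
    (hlam : 0 < sSup (spectrum ℝ H2)) :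
    ∃ v : lp (fun _ : (Fin d → ℤ) × (Fin d → ℤ) => ℝ) 2,
      (∀ q : (Fin d → ℤ) × (Fin d → ℤ), 0 < v q) ∧
      H2 v = sSup (spectrum ℝ H2) • v ∧
      (∀ w : lp (fun _ : (Fin d → ℤ) × (Fin d → ℤ) => ℝ) 2,
        H2 w = sSup (spectrum ℝ H2) • w → ∃ c : ℝ, w = c • v) ∧
      ∃ ε : ℝ, 0 < ε ∧ ∀ μ : ℝ,
        μ ∈ Set.Ioo (sSup (spectrum ℝ H2) - ε) (sSup (spectrum ℝ H2) + ε) →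
        (∃ w : lp (fun _ : (Fin d → ℤ) × (Fin d → ℤ) => ℝ) 2, w ≠ 0 ∧ H2 w = μ • w) →
        μ = sSup (spectrum ℝ H2) := by
  set l := sSup (spectrum ℝ H2)
  set e : Fin d → Fin d → ℤ := fun j => Pi.single j 1
  have hinner := inner_eq_kineticForm_add hH2
  have hsymm : ∀ f g, inner ℝ (H2 f) g = inner ℝ f (H2 g) := fun f g => by
    rw [← real_inner_comm f, hinner, hinner, kineticForm_comm]
    simp only [mul_comm (f _)]
  have hquad : ∀ f, inner ℝ (H2 f) f = kineticForm κ ρ e f f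
      + γ * (∑' q : (Fin d → ℤ) × (Fin d → ℤ), (if q.1 = 0 then (1 : ℝ) else 0) * f q ^ 2
        + ∑' q : (Fin d → ℤ) × (Fin d → ℤ), (if q.2 = 0 then (1 : ℝ) else 0) * f q ^ 2) :=
    fun f => by simpa only [sq] using hinner f f
  have : Nontrivial (lp (fun _ : (Fin d → ℤ) × (Fin d → ℤ) => ℝ) 2) := by
    refine ⟨lp.single 2 0 1, 0, fun h => ?_⟩
    have := congrArg (fun f : lp (fun _ : (Fin d → ℤ) × (Fin d → ℤ) => ℝ) 2 => f 0) h
    simp at this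
  obtain ⟨hle, happ⟩ := symmetric_sSup_spectrum hsymm
  have hhalf : ∀ φ : (Fin d → ℤ) → ℝ, (Summable fun x => φ x ^ 2) →
      oneParticleForm (κ + ρ) γ e φ ≤ l / 2 * corr 0 φ φ := fun φ =>
    oneParticleForm_le_half hρ.le fun f hf => by
      have h := hle ⟨f, memℓp_two_of_summable_sq hf⟩
      rwa [hquad, lp.norm_sq_eq_corr] at h
  set M : ℝ := (2 * κ + ρ) * Fintype.card (Fin d) with hM
  have hM0 : 0 ≤ M := by positivity
  have hδ : 0 < √(l / (4 * (M + 1))) := by positivity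
  obtain ⟨χ, F, hχ, hχ1, hχ2⟩ := exists_localization_angle d hδ
  obtain ⟨P, hP⟩ := lp.exists_restrict F
  have hform : ∀ f, inner ℝ (H2 f) f ≤ 3 * l / 4 * ‖f‖ ^ 2 + 2 * γ * F.card * ‖P f‖ ^ 2 := by
    intro f
    have h := form_le_of_localization hκ.le hρ.le hγ.le hhalf hχ hχ1 hχ2 (lp.summable_sq f)
    rw [← hquad, ← lp.norm_sq_eq_corr, Real.sq_sqrt (by positivity), ← hM] at h
    have hMl : M * (l / (4 * (M + 1))) ≤ l / 4 := by
      rw [mul_div_assoc', div_le_div_iff₀ (by positivity) (by norm_num)]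
      nlinarith
    have h1 := mul_le_mul_of_nonneg_right hMl (sq_nonneg ‖f‖)
    have h2 := mul_le_mul_of_nonneg_left (hP f) (by positivity : 0 ≤ 2 * γ)
    linarith
  have hgap : 3 * l / 4 < l := by linarith
  choose u hu1 hu using fun n : ℕ => happ (1 / ((n : ℝ) + 1)) Nat.one_div_pos_of_nat
  obtain ⟨v₀, hv₀, hHv₀, -⟩ := exists_tendsto_subseq_of_approx_eigenvector hgap hform hu1
    (squeeze_zero_norm (fun n => (hu n).le) tendsto_one_div_add_atTop_nhds_zero_nat)
  have hzero : ∀ w : lp (fun _ : (Fin d → ℤ) × (Fin d → ℤ) => ℝ) 2, H2 w = l • w →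
      (∀ q, 0 ≤ w q) → ∀ q₀, w q₀ = 0 → w = 0 := by
    intro w hw hnn q₀ h0
    refine lp.ext (funext fun q => ?_)
    refine eq_zero_of_nonneg_of_apply_eq_zero hκ hρ.le (γ := γ) (l := l) hnn (fun q => ?_) h0 q
    rw [← hH2, hw]
    rfl
  have habs : ∀ w : lp (fun _ : (Fin d → ℤ) × (Fin d → ℤ) => ℝ) 2, H2 w = l • w →
      ∃ w' : lp (fun _ : (Fin d → ℤ) × (Fin d → ℤ) => ℝ) 2,
        (∀ q, w' q = |w q|) ∧ H2 w' = l • w' := by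
    intro w hw
    have hs := lp.summable_sq w
    set w' : lp (fun _ : (Fin d → ℤ) × (Fin d → ℤ) => ℝ) 2 :=
      ⟨fun q => |w q|, memℓp_two_of_summable_sq (by simpa only [sq_abs] using hs)⟩
    have hw' : ∀ q, w' q = |w q| := fun _ => rfl
    refine ⟨w', hw', ?_⟩
    set Q := l • ContinuousLinearMap.id ℝ (lp (fun _ : (Fin d → ℤ) × (Fin d → ℤ) => ℝ) 2) - H2
    have hQ : ∀ x, Q x = l • x - H2 x := fun _ => rfl
    have hQsymm : ∀ x y, inner ℝ (Q x) y = inner ℝ x (Q y) := fun x y => by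
      simp only [hQ, inner_sub_left, inner_sub_right, real_inner_smul_left,
        real_inner_smul_right, hsymm]
    have hQi : ∀ x, inner ℝ (Q x) x = l * ‖x‖ ^ 2 - inner ℝ (H2 x) x := fun x => by
      rw [hQ, inner_sub_left, real_inner_smul_left, real_inner_self_eq_norm_sq]
    have hnorm : ‖w'‖ ^ 2 = ‖w‖ ^ 2 := by
      simp only [lp.norm_sq_eq_corr, corr_zero_self, hw', sq_abs]
    have hge : inner ℝ (H2 w) w ≤ inner ℝ (H2 w') w' := by
      rw [hquad, hquad]
      simp only [hw', sq_abs]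
      gcongr
      exact kineticForm_le_abs hκ.le hρ.le hs
    rw [hw, real_inner_smul_left, real_inner_self_eq_norm_sq] at hge
    have hn := norm_sq_le_mul_inner_of_nonneg hQsymm
      (fun x => by rw [hQi]; linarith [hle x]) w'
    have h0 : inner ℝ (Q w') w' ≤ 0 := by
      rw [hQi, hnorm]
      linarith
    have h1 : ‖Q w'‖ ^ 2 ≤ 0 :=
      hn.trans (mul_nonpos_of_nonneg_of_nonpos (by positivity) h0)
    have h2 : Q w' = 0 := by
      rw [← norm_eq_zero]
      exact pow_eq_zero_iff (two_ne_zero) |>.mp (le_antisymm h1 (sq_nonneg _))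
    exact (sub_eq_zero.mp h2).symm
  have hvanish : ∀ w : lp (fun _ : (Fin d → ℤ) × (Fin d → ℤ) => ℝ) 2, H2 w = l • w →
      ∀ q₀, w q₀ = 0 → w = 0 := by
    intro w hw q₀ h0
    obtain ⟨w', hw', hHw'⟩ := habs w hw
    have h := hzero w' hHw' (fun q => by rw [hw']; exact abs_nonneg _) q₀ (by rw [hw', h0, abs_zero])
    refine lp.ext (funext fun q => ?_)
    have hq := hw' q
    rw [h] at hq
    exact abs_eq_zero.mp hq.symm
  obtain ⟨v, hv, hHv⟩ := habs v₀ hHv₀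
  have hv₀0 : v₀ ≠ 0 := fun h => by simp [h] at hv₀
  refine ⟨v, fun q => ?_, hHv, fun w hw => ⟨w 0 / v 0, ?_⟩,
    exists_isolating_radius hgap hsymm hform⟩
  · rw [hv]
    exact abs_pos.mpr fun h => hv₀0 (hvanish v₀ hHv₀ q h)
  · have hv0 : v 0 ≠ 0 := by
      rw [hv]
      exact abs_ne_zero.mpr fun h => hv₀0 (hvanish v₀ hHv₀ 0 h)
    refine sub_eq_zero.mp (hvanish (w - (w 0 / v 0) • v) ?_ 0 ?_)
    · rw [map_sub, map_smul, hw, hHv, smul_sub, smul_comm]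
    · change w 0 - w 0 / v 0 * v 0 = 0
      rw [div_mul_cancel₀ _ hv0, sub_self]
end

section
/- The supremum of the spectrum of the restriction H²_S of H² to the closed subspace S of component-wise symmetric functions coincides with λ_2 = sup σ(H²). -/
open Filter Topology

/-- A real number bounds the spectrum of a self-adjoint operator on a real Hilbert space from above
if and only if it bounds the quadratic form of the operator. -/
theorem IsSelfAdjoint.mem_upperBounds_spectrum_iff {E : Type*} [NormedAddCommGroup E]
    [InnerProductSpace ℝ E] [CompleteSpace E] {T : E →L[ℝ] E} (hT : IsSelfAdjoint T) (μ : ℝ) :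
    μ ∈ upperBounds (spectrum ℝ T) ↔ ∀ x, inner ℝ (T x) x ≤ μ * ‖x‖ ^ 2 := by
  constructor
  · intro hμ x
    set c : ℝ := ‖T‖ + |μ| with hc
    set A : E →L[ℝ] E := algebraMap ℝ (E →L[ℝ] E) c + T with hA
    have hAx : ∀ x, inner ℝ (A x) x = c * ‖x‖ ^ 2 + inner ℝ (T x) x := fun x ↦ by
      simp [hA, Algebra.algebraMap_eq_smul_one, inner_add_left, inner_smul_left]
    have hAsa : IsSelfAdjoint A := by
      rw [hA, Algebra.algebraMap_eq_smul_one]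
      exact ((IsSelfAdjoint.all c).smul (IsSelfAdjoint.one _)).add hT
    have hA0 : 0 ≤ A := by
      rw [ContinuousLinearMap.nonneg_iff_isPositive, ContinuousLinearMap.isPositive_def']
      refine ⟨hAsa, fun x ↦ ?_⟩
      have h₁ : |inner ℝ (T x) x| ≤ ‖T‖ * ‖x‖ * ‖x‖ :=
        (abs_real_inner_le_norm _ _).trans (by gcongr; exact T.le_opNorm x)
      have h₂ := neg_abs_le (inner ℝ (T x) x)
      have h₃ : 0 ≤ |μ| * ‖x‖ ^ 2 := by positivity
      rw [ContinuousLinearMap.reApplyInnerSelf_apply, hAx, RCLike.re_to_real, hc]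
      nlinarith
    have hcμ : 0 ≤ c + μ := by
      have := neg_abs_le μ
      have := norm_nonneg T
      linarith
    have hnorm : ‖A‖ ≤ c + μ := by
      have hr : spectralRadius ℝ A ≤ ((c + μ).toNNReal : ENNReal) := by
        refine iSup₂_le fun k hk ↦ ?_
        have hk0 : 0 ≤ k := spectrum_nonneg_of_nonneg hA0 hk
        have hkT : k - c ∈ spectrum ℝ T := by
          rwa [hA, ← sub_add_cancel k c, spectrum.add_mem_add_iff] at hk
        have := hμ hkT
        rw [ENNReal.coe_le_coe, ← NNReal.coe_le_coe, coe_nnnorm, Real.norm_of_nonneg hk0,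
          Real.coe_toNNReal _ hcμ]
        linarith
      rw [A.spectralRadius_eq_nnnorm hAsa, ENNReal.coe_le_coe, ← NNReal.coe_le_coe,
        Real.coe_toNNReal _ hcμ] at hr
      exact hr
    have h₁ : inner ℝ (A x) x ≤ (c + μ) * ‖x‖ * ‖x‖ :=
      (real_inner_le_norm _ _).trans
        (by gcongr; exact (A.le_opNorm x).trans (by gcongr))
    rw [hAx] at h₁
    nlinarith
  · intro h k hk
    by_contra! hlt
    refine hk (ContinuousLinearMap.isUnit_of_forall_le_norm_inner_map _
      (c := ⟨k - μ, (sub_pos.2 hlt).le⟩) (sub_pos.2 hlt) fun x ↦ ?_)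
    refine le_trans ?_ (le_abs_self _)
    have := h x
    simp [Algebra.algebraMap_eq_smul_one, inner_sub_left, inner_smul_left]
    change ‖x‖ ^ 2 * (k - μ) ≤ _
    linarith

theorem Real.sSup_eq_of_upperBounds_eq {s t : Set ℝ} (h : upperBounds s = upperBounds t) :
    sSup s = sSup t := by
  have hempty : ∀ s : Set ℝ, ¬ s.Nonempty ↔ upperBounds s = Set.univ := fun s ↦ by
    refine ⟨fun hs ↦ by rw [Set.not_nonempty_iff_eq_empty.1 hs, upperBounds_empty], ?_⟩
    rintro hs ⟨x, hx⟩
    have hmem : x - 1 ∈ upperBounds s := hs ▸ Set.mem_univ _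
    linarith [hmem hx]
  have hne : s.Nonempty ↔ t.Nonempty := by
    rw [← not_iff_not, hempty, hempty, h]
  have hb : BddAbove s ↔ BddAbove t := by simp only [BddAbove, h]
  by_cases hs : s.Nonempty ∧ BddAbove s
  · have h₁ := isLUB_csSup hs.1 hs.2
    have h₂ := isLUB_csSup (hne.1 hs.1) (hb.1 hs.2)
    rw [IsLUB, h] at h₁
    exact h₁.unique h₂
  · rcases not_and_or.1 hs with hs | hs
    · rw [Set.not_nonempty_iff_eq_empty.1 hs,
        Set.not_nonempty_iff_eq_empty.1 (fun ht ↦ hs (hne.2 ht))]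
    · rw [Real.sSup_of_not_bddAbove hs, Real.sSup_of_not_bddAbove (fun ht ↦ hs (hb.2 ht))]

theorem memℓp_two_iff_summable_sq {α : Type*} {f : α → ℝ} :
    Memℓp f 2 ↔ Summable fun q => f q ^ 2 := by
  rw [memℓp_gen_iff (by norm_num)]
  simp

section FiniteRange

variable {G ι : Type*} [AddCommGroup G] [Fintype ι]
  {T : lp (fun _ : G => ℝ) 2 →L[ℝ] lp (fun _ : G => ℝ) 2} {w : ι → ℝ} {v : ι → G} {c : G → ℝ}

theorem lp.summable_translate_mul (f g : lp (fun _ : G => ℝ) 2) (a : G) :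
    Summable fun q => f (q + a) * g q := by
  have hsq (f : lp (fun _ : G => ℝ) 2) := memℓp_two_iff_summable_sq.1 (lp.memℓp f)
  have hf : Summable fun q => f (q + a) ^ 2 := (hsq f).comp_injective (add_left_injective a)
  refine Summable.of_norm_bounded ((hf.add (hsq g))) fun q ↦ ?_
  rw [Real.norm_eq_abs, abs_le]
  constructor <;> nlinarith [sq_nonneg (f (q + a) + g q), sq_nonneg (f (q + a) - g q)]

theorem lp.tsum_translate_mul (f g : lp (fun _ : G => ℝ) 2) (a : G) :
    ∑' q, f (q + a) * g q = ∑' q, g (q - a) * f q := by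
  rw [← (Equiv.addRight a).tsum_eq fun q => g (q - a) * f q]
  simp [mul_comm]

/-- A real Schrödinger operator with symmetric, translation invariant hopping of finite range on
`ℓ²` of an abelian group is self-adjoint. -/
theorem isSelfAdjoint_of_symmetric_hopping
    (hT : ∀ f q, T f q = ∑ i, w i * (f (q + v i) + f (q - v i)) + c q * f q) :
    IsSelfAdjoint T := by
  rw [ContinuousLinearMap.isSelfAdjoint_iff_isSymmetric]
  intro f g
  have hshift : ∀ (f g : lp (fun _ : G => ℝ) 2) i, Summable fun q =>
      w i * (f (q + v i) + f (q - v i)) * g q := fun f g i ↦ by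
    have := ((lp.summable_translate_mul f g (v i)).add
      (lp.summable_translate_mul f g (-v i))).mul_left (w i)
    refine this.congr fun q ↦ ?_
    rw [← sub_eq_add_neg]
    ring
  have hinner : ∀ f g : lp (fun _ : G => ℝ) 2, inner ℝ (T f) g = ∑' q, T f q * g q :=
    fun f g ↦ by simp [lp.inner_eq_tsum, mul_comm]
  have hdiag : ∀ f g : lp (fun _ : G => ℝ) 2, Summable fun q => c q * f q * g q := fun f g ↦ by
    have h₁ : Summable fun q => T f q * g q := by
      simpa [mul_comm] using lp.summable_inner (𝕜 := ℝ) (T f) g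
    refine (h₁.sub (summable_sum fun i (_ : i ∈ Finset.univ) ↦ hshift f g i)).congr fun q ↦ ?_
    rw [hT, add_mul, Finset.sum_mul]
    ring
  have hexp : ∀ f g : lp (fun _ : G => ℝ) 2, inner ℝ (T f) g =
      ∑ i, w i * (∑' q, f (q + v i) * g q + ∑' q, f (q - v i) * g q) + ∑' q, c q * f q * g q :=
    fun f g ↦ by
    rw [hinner]
    simp only [hT, add_mul, Finset.sum_mul]
    rw [(summable_sum fun i _ ↦ hshift f g i).tsum_add (hdiag f g),
      Summable.tsum_finsetSum fun i _ ↦ hshift f g i]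
    congr 1
    refine Finset.sum_congr rfl fun i _ ↦ ?_
    have h₂ := lp.summable_translate_mul f g (-v i)
    simp only [← sub_eq_add_neg] at h₂
    rw [← (lp.summable_translate_mul f g (v i)).tsum_add h₂, ← tsum_mul_left]
    congr 1 with q
    ring
  change inner ℝ (T f) g = inner ℝ f (T g)
  rw [real_inner_comm (T g), hexp, hexp]
  congr 1
  · refine Finset.sum_congr rfl fun i _ ↦ ?_
    rw [lp.tsum_translate_mul f g, ← lp.tsum_translate_mul g f, add_comm]
  · congr 1 with q
    ring

/-- The quadratic form of a Schrödinger operator with nonnegative hopping rates does not decrease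
when two functions are replaced by their pointwise quadratic mean. -/
theorem inner_add_inner_le_of_sq_add_sq_eq (hw : ∀ i, 0 ≤ w i)
    (hT : ∀ f q, T f q = ∑ i, w i * (f (q + v i) + f (q - v i)) + c q * f q)
    {f g h : lp (fun _ : G => ℝ) 2} (hh : ∀ q, 0 ≤ h q)
    (hfg : ∀ q, f q ^ 2 + g q ^ 2 = 2 * h q ^ 2) :
    inner ℝ (T f) f + inner ℝ (T g) g ≤ 2 * inner ℝ (T h) h := by
  have hs : ∀ f : lp (fun _ : G => ℝ) 2,
      HasSum (fun q => T f q * f q) (inner ℝ (T f) f) := fun f ↦ by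
    simpa [mul_comm] using lp.hasSum_inner (𝕜 := ℝ) (T f) f
  refine hasSum_le (fun q ↦ ?_) ((hs f).add (hs g)) ((hs h).mul_left 2)
  have hpair : ∀ p, f p * f q + g p * g q ≤ 2 * (h p * h q) := fun p ↦ by
    refine abs_le_of_sq_le_sq' ?_ (by have := hh p; have := hh q; positivity) |>.2
    have e : (2 * (h p * h q)) ^ 2 = (f p ^ 2 + g p ^ 2) * (f q ^ 2 + g q ^ 2) := by
      rw [hfg, hfg]
      ring
    rw [e]
    nlinarith [sq_nonneg (f p * g q - g p * f q)]
  have e₁ : ∀ k : lp (fun _ : G => ℝ) 2, T k q * k q =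
      ∑ i, w i * (k (q + v i) * k q + k (q - v i) * k q) + c q * k q ^ 2 := fun k ↦ by
    rw [hT, add_mul, Finset.sum_mul]
    congr 1
    · exact Finset.sum_congr rfl fun i _ ↦ by ring
    · ring
  have e₂ : c q * f q ^ 2 + c q * g q ^ 2 = 2 * (c q * h q ^ 2) := by
    rw [← mul_add, hfg]
    ring
  have e₃ : ∑ i, w i * (f (q + v i) * f q + f (q - v i) * f q) +
      ∑ i, w i * (g (q + v i) * g q + g (q - v i) * g q) ≤
      2 * ∑ i, w i * (h (q + v i) * h q + h (q - v i) * h q) := by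
    rw [← Finset.sum_add_distrib, Finset.mul_sum]
    refine Finset.sum_le_sum fun i _ ↦ ?_
    have := mul_le_mul_of_nonneg_left
      (add_le_add (hpair (q + v i)) (hpair (q - v i))) (hw i)
    linarith
  simp only [e₁]
  linarith

end FiniteRange

theorem lp.norm_sq_eq_tsum_sq {α : Type*} (f : lp (fun _ : α => ℝ) 2) :
    ‖f‖ ^ 2 = ∑' q, f q ^ 2 := by
  rw [← real_inner_self_eq_norm_sq, lp.inner_eq_tsum]
  simp [pow_two]

/-- Composition with the swap of the two components. -/
theorem lp.exists_swap {α : Type*} (f : lp (fun _ : α × α => ℝ) 2) :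
    ∃ g : lp (fun _ : α × α => ℝ) 2, ∀ q, g q = f q.swap :=
  ⟨⟨fun q => f q.swap, memℓp_two_iff_summable_sq.2
    ((Equiv.prodComm α α).summable_iff.2 (memℓp_two_iff_summable_sq.1 (lp.memℓp f)))⟩, fun _ ↦ rfl⟩

/-- Pointwise quadratic mean of two square summable functions. -/
theorem lp.exists_quadratic_mean {α : Type*} (f g : lp (fun _ : α => ℝ) 2) :
    ∃ h : lp (fun _ : α => ℝ) 2, ∀ q, h q = √((f q ^ 2 + g q ^ 2) / 2) := by
  have hsum := ((memℓp_two_iff_summable_sq.1 (lp.memℓp f)).add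
    (memℓp_two_iff_summable_sq.1 (lp.memℓp g))).div_const 2
  refine ⟨⟨fun q => √((f q ^ 2 + g q ^ 2) / 2), memℓp_two_iff_summable_sq.2 ?_⟩, fun _ ↦ rfl⟩
  exact hsum.congr fun q ↦ (Real.sq_sqrt (by positivity)).symm

/-- The supremum of the spectrum of the restriction `H²_S` of the
second Anderson Hamiltonian `H² = A² + γV²` to the closed subspace `S` of
component-wise symmetric functions of `ℓ²(ℤ^d × ℤ^d)` coincides with
`λ₂ = sup σ(H²)`. -/
theorem sup_spectrum_symmetric_restriction
    (d : ℕ) (hd : 1 ≤ d)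
    (κ ρ γ : ℝ) (hκ : 0 < κ) (hρ : 0 < ρ) (hγ : 0 < γ)
    (H2 : lp (fun _ : (Fin d → ℤ) × (Fin d → ℤ) => ℝ) 2 →L[ℝ]
      lp (fun _ : (Fin d → ℤ) × (Fin d → ℤ) => ℝ) 2)
    (hH2 : ∀ (f : lp (fun _ : (Fin d → ℤ) × (Fin d → ℤ) => ℝ) 2)
        (q : (Fin d → ℤ) × (Fin d → ℤ)),
      H2 f q = κ * (∑ j : Fin d,
          ((f (q.1 + Pi.single j 1, q.2) - f q) + (f (q.1 - Pi.single j 1, q.2) - f q)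
            + (f (q.1, q.2 + Pi.single j 1) - f q) + (f (q.1, q.2 - Pi.single j 1) - f q)))
        + ρ * (∑ j : Fin d,
          ((f (q.1 + Pi.single j 1, q.2 + Pi.single j 1) - f q)
            + (f (q.1 - Pi.single j 1, q.2 - Pi.single j 1) - f q)))
        + γ * (((if q.1 = 0 then (1:ℝ) else 0) + (if q.2 = 0 then (1:ℝ) else 0)) * f q))
    (S : Submodule ℝ (lp (fun _ : (Fin d → ℤ) × (Fin d → ℤ) => ℝ) 2))
    (hS : ∀ f : lp (fun _ : (Fin d → ℤ) × (Fin d → ℤ) => ℝ) 2,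
      f ∈ S ↔ ∀ a b : Fin d → ℤ, f (a, b) = f (b, a))
    (HS : S →L[ℝ] S)
    (hHS : ∀ v : S, (HS v : lp (fun _ : (Fin d → ℤ) × (Fin d → ℤ) => ℝ) 2)
      = H2 (v : lp (fun _ : (Fin d → ℤ) × (Fin d → ℤ) => ℝ) 2)) :
    sSup (spectrum ℝ HS) = sSup (spectrum ℝ H2) := by
  let w : Fin d ⊕ Fin d ⊕ Fin d → ℝ := Sum.elim (fun _ ↦ κ) (Sum.elim (fun _ ↦ κ) fun _ ↦ ρ)
  let v : Fin d ⊕ Fin d ⊕ Fin d → (Fin d → ℤ) × (Fin d → ℤ) :=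
    Sum.elim (fun j ↦ (Pi.single j 1, 0))
      (Sum.elim (fun j ↦ (0, Pi.single j 1)) fun j ↦ (Pi.single j 1, Pi.single j 1))
  let c : (Fin d → ℤ) × (Fin d → ℤ) → ℝ := fun q ↦ -(4 * κ + 2 * ρ) * d
    + γ * ((if q.1 = 0 then (1 : ℝ) else 0) + (if q.2 = 0 then (1 : ℝ) else 0))
  have hw : ∀ i, 0 ≤ w i := by
    rintro (i | i | i)
    exacts [hκ.le, hκ.le, hρ.le]
  have hform : ∀ f q, H2 f q = ∑ i, w i * (f (q + v i) + f (q - v i)) + c q * f q := by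
    rintro f ⟨a, b⟩
    simp only [hH2, w, v, c, Fintype.sum_sum_type, Sum.elim_inl, Sum.elim_inr, Prod.mk_add_mk,
      Prod.mk_sub_mk, add_zero, sub_zero, Finset.sum_add_distrib, Finset.sum_sub_distrib,
      Finset.sum_const, Finset.card_univ, Fintype.card_fin, nsmul_eq_mul, ← Finset.mul_sum]
    ring
  have hsa := isSelfAdjoint_of_symmetric_hopping hform
  have hclosed : IsClosed (S : Set (lp (fun _ : (Fin d → ℤ) × (Fin d → ℤ) => ℝ) 2)) := by
    have hS' : (S : Set (lp (fun _ : (Fin d → ℤ) × (Fin d → ℤ) => ℝ) 2)) =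
        {f | ∀ a b : Fin d → ℤ, f (a, b) = f (b, a)} := Set.ext hS
    rw [hS', Set.ofPred_forall]
    refine isClosed_iInter fun a ↦ ?_
    rw [Set.ofPred_forall]
    have hev : ∀ q, Continuous fun f : lp (fun _ : (Fin d → ℤ) × (Fin d → ℤ) => ℝ) 2 => f q :=
      fun q ↦ (continuous_apply q).comp lp.uniformContinuous_coe.continuous
    exact isClosed_iInter fun b ↦ isClosed_eq (hev _) (hev _)
  have : CompleteSpace S := hclosed.completeSpace_coe
  have hSsa : IsSelfAdjoint HS := by
    rw [ContinuousLinearMap.isSelfAdjoint_iff_isSymmetric] at hsa ⊢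
    intro x y
    change inner ℝ (HS x : lp (fun _ : (Fin d → ℤ) × (Fin d → ℤ) => ℝ) 2) y =
      inner ℝ (x : lp (fun _ : (Fin d → ℤ) × (Fin d → ℤ) => ℝ) 2) (HS y)
    rw [hHS, hHS]
    exact hsa x y
  refine Real.sSup_eq_of_upperBounds_eq (Set.ext fun μ ↦ ?_)
  rw [hSsa.mem_upperBounds_spectrum_iff, hsa.mem_upperBounds_spectrum_iff]
  refine ⟨fun h f ↦ ?_, fun h x ↦ ?_⟩
  · obtain ⟨g, hg⟩ := lp.exists_swap f
    obtain ⟨k, hk⟩ := lp.exists_quadratic_mean f g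
    have hkS : k ∈ S := (hS k).2 fun a b ↦ by simp [hk, hg, add_comm]
    have hk2 : ∀ q, f q ^ 2 + g q ^ 2 = 2 * k q ^ 2 := fun q ↦ by
      rw [hk, Real.sq_sqrt (by positivity)]
      ring
    have hle := inner_add_inner_le_of_sq_add_sq_eq hw hform
      (fun q ↦ by rw [hk]; positivity) hk2
    have hHg : ∀ q, H2 g q = H2 f q.swap := by
      rintro ⟨a, b⟩
      simp only [hH2, hg, Prod.swap_prod_mk]
      congr 1
      · congr 2
        exact Finset.sum_congr rfl fun j _ ↦ by ring
      · ring
    have hinner : inner ℝ (H2 g) g = inner ℝ (H2 f) f := by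
      simp only [lp.inner_eq_tsum, hHg, hg]
      exact (Equiv.prodComm _ _).tsum_eq fun q ↦ inner ℝ (H2 f q) (f q)
    have hgnorm : ‖g‖ ^ 2 = ‖f‖ ^ 2 := by
      simp only [lp.norm_sq_eq_tsum_sq, hg]
      exact (Equiv.prodComm _ _).tsum_eq fun q ↦ f q ^ 2
    have hknorm : ‖f‖ ^ 2 + ‖g‖ ^ 2 = 2 * ‖k‖ ^ 2 := by
      simp only [lp.norm_sq_eq_tsum_sq]
      rw [← (memℓp_two_iff_summable_sq.1 (lp.memℓp f)).tsum_add
        (memℓp_two_iff_summable_sq.1 (lp.memℓp g)), ← tsum_mul_left]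
      exact tsum_congr hk2
    have hkμ : inner ℝ (H2 k) k ≤ μ * ‖k‖ ^ 2 := by
      have := h ⟨k, hkS⟩
      rwa [Submodule.coe_inner, hHS, Submodule.coe_norm] at this
    have : ‖k‖ ^ 2 = ‖f‖ ^ 2 := by linarith
    rw [this] at hkμ
    linarith
  · rw [Submodule.coe_inner, hHS, Submodule.coe_norm]
    exact h x
end

section
/- Suppose λ > 0 and γ > 0, and assume λ = sup σ(A²_S + γ V²_S). Then 1/γ = sup σ(R_λ V²_S), where R_λ := (λ − A²_S)^{−1}. -/
section AbstractHilbert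

variable {H : Type*} [NormedAddCommGroup H] [InnerProductSpace ℝ H]

/-- The norm of a positive operator on a nontrivial Hilbert space belongs to its spectrum. -/
theorem ContinuousLinearMap.IsPositive.norm_mem_spectrum [Nontrivial H] {T : H →L[ℝ] H}
    (hT : T.IsPositive) : ‖T‖ ∈ spectrum ℝ T := by
  by_contra h
  obtain ⟨ε, hε, hle⟩ := T.rayleighQuotient_le_of_norm_mem_resolventSet (𝕜 := ℝ)
    (by simpa [spectrum] using h)
  have hnonneg (x : H) : 0 ≤ T.rayleighQuotient x := div_nonneg (hT.2 x) (by positivity)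
  have := T.norm_eq_iSup_rayleighQuotient hT.isSymmetric
  simp_rw [abs_of_nonneg (hnonneg _)] at this
  linarith [ciSup_le hle]

/-- The quadratic form of a symmetric operator is bounded by the supremum of its spectrum. -/
theorem LinearMap.IsSymmetric.inner_le_sSup_spectrum [CompleteSpace H] {T : H →L[ℝ] H}
    (hT : (T : H →ₗ[ℝ] H).IsSymmetric) (x : H) :
    inner ℝ (T x) x ≤ sSup (spectrum ℝ T) * ‖x‖ ^ 2 := by
  obtain _ | _ := subsingleton_or_nontrivial H
  · simp [Subsingleton.elim x 0]
  have hinner (y : H) : |inner ℝ (T y) y| ≤ ‖T‖ * ‖y‖ ^ 2 := by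
    refine (abs_real_inner_le_norm _ _).trans ?_
    rw [pow_two, ← mul_assoc]
    gcongr
    exact T.le_opNorm y
  have hpos : (algebraMap ℝ (H →L[ℝ] H) ‖T‖ + T).IsPositive := by
    refine (ContinuousLinearMap.isPositive_iff _).2 ⟨fun y z ↦ ?_, fun y ↦ ?_⟩
    · have := hT y z
      simp only [ContinuousLinearMap.coe_coe] at this
      simp [Algebra.algebraMap_eq_smul_one, inner_add_left, inner_add_right, inner_smul_left,
        inner_smul_right, this]
    · have := (abs_le.1 (hinner y)).1
      simp only [Algebra.algebraMap_eq_smul_one, _root_.add_apply,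
        _root_.smul_apply, one_apply_eq_self, inner_add_left,
        real_inner_smul_left, real_inner_self_eq_norm_sq]
      linarith
  have hmem := hpos.norm_mem_spectrum
  set P := algebraMap ℝ (H →L[ℝ] H) ‖T‖ + T with hP
  have hmem' : ‖P‖ - ‖T‖ ∈ spectrum ℝ T := by
    rw [spectrum.mem_iff] at hmem ⊢
    convert hmem using 2
    rw [hP, map_sub]
    abel
  have hle := le_csSup (spectrum.isBounded T).bddAbove hmem'
  have hPx : inner ℝ (P x) x ≤ ‖P‖ * ‖x‖ ^ 2 := by
    refine (real_inner_le_norm _ _).trans ?_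
    rw [pow_two, ← mul_assoc]
    gcongr
    exact P.le_opNorm x
  have hPx' : inner ℝ (P x) x = ‖T‖ * ‖x‖ ^ 2 + inner ℝ (T x) x := by
    simp only [hP, Algebra.algebraMap_eq_smul_one, _root_.add_apply,
      _root_.smul_apply, one_apply_eq_self, inner_add_left,
      real_inner_smul_left, real_inner_self_eq_norm_sq]
  nlinarith [sq_nonneg ‖x‖, mul_le_mul_of_nonneg_right hle (sq_nonneg ‖x‖)]

/-- Birman–Schwinger principle for the top of the spectrum: if `A ≤ 0` and `V` are symmetric and
`lam > 0` is the top of the spectrum of `A + γ V`, then `1 / γ` is the top of the spectrum of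
`(lam - A)⁻¹ V`. -/
theorem one_div_eq_sSup_spectrum_resolvent_comp [CompleteSpace H] {A V R : H →L[ℝ] H}
    (hA : (A : H →ₗ[ℝ] H).IsSymmetric) (hA0 : ∀ x, inner ℝ (A x) x ≤ 0)
    (hV : (V : H →ₗ[ℝ] H).IsSymmetric) {lam γ : ℝ} (hlam : 0 < lam) (hγ : 0 < γ)
    (hR₁ : R ∘L (lam • (1 : H →L[ℝ] H) - A) = 1) (hR₂ : (lam • (1 : H →L[ℝ] H) - A) ∘L R = 1)
    (hsup : lam = sSup (spectrum ℝ (A + γ • V))) :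
    1 / γ = sSup (spectrum ℝ (R ∘L V)) := by
  set B : H →L[ℝ] H := lam • (1 : H →L[ℝ] H) - A with hB
  let u : (H →L[ℝ] H)ˣ := ⟨B, R, hR₂, hR₁⟩
  have hunit {t : ℝ} (ht : 0 < t) :
      IsUnit (algebraMap ℝ (H →L[ℝ] H) (1 / t) - R ∘L V) ↔ IsUnit (B - t • V) := by
    have hfac : B - t • V = t • (B * (algebraMap ℝ (H →L[ℝ] H) (1 / t) - R ∘L V)) := by
      have : B * (R ∘L V) = V := by
        change B * (R * V) = V
        rw [← mul_assoc, show B * R = 1 from hR₂, one_mul]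
      rw [mul_sub, this, smul_sub, Algebra.algebraMap_eq_smul_one, mul_smul_comm, smul_smul,
        mul_one_div_cancel ht.ne', one_smul, mul_one]
    have hsmul (X : H →L[ℝ] H) : IsUnit (t • X) ↔ IsUnit X :=
      isUnit_smul_iff (Units.mk0 t ht.ne') X
    rw [hfac, hsmul]
    exact (Units.isUnit_units_mul u _).symm
  have hsymm : ((A + γ • V : H →L[ℝ] H) : H →ₗ[ℝ] H).IsSymmetric := by
    intro y z
    have h1 := hA y z
    have h2 := hV y z
    simp only [ContinuousLinearMap.coe_coe] at h1 h2
    simp [inner_add_left, inner_add_right, inner_smul_left, inner_smul_right, h1, h2]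
  have hform (x : H) : inner ℝ (A x) x + γ * inner ℝ (V x) x ≤ lam * ‖x‖ ^ 2 := by
    have := hsymm.inner_le_sSup_spectrum x
    rw [← hsup] at this
    simpa [inner_add_left, inner_smul_left] using this
  have hne : (spectrum ℝ (A + γ • V)).Nonempty := by
    by_contra h
    rw [Set.not_nonempty_iff_eq_empty] at h
    rw [h, Real.sSup_empty] at hsup
    exact hlam.ne' hsup
  have hmem : lam ∈ spectrum ℝ (A + γ • V) := by
    have := (spectrum.isCompact (𝕜 := ℝ) (A + γ • V)).sSup_mem hne
    rwa [← hsup] at this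
  refine (IsGreatest.csSup_eq ⟨?_, fun μ hμ ↦ ?_⟩).symm
  · rw [spectrum.mem_iff, hunit hγ]
    rw [spectrum.mem_iff] at hmem
    convert hmem using 2
    rw [hB, Algebra.algebraMap_eq_smul_one]
    abel
  · by_contra! hlt
    have hμ0 : 0 < μ := (one_div_pos.2 hγ).trans hlt
    rw [spectrum.mem_iff, ← one_div_one_div μ, hunit (one_div_pos.2 hμ0)] at hμ
    apply hμ
    set t := 1 / (μ * γ) with ht
    have ht1 : t < 1 := by
      rw [ht, div_lt_one (by positivity)]
      rwa [div_lt_iff₀ hγ] at hlt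
    have ht0 : 0 < t := by positivity
    have htγ : 1 / μ = t * γ := by rw [ht]; field_simp
    have hc : 0 < (1 - t) * lam := mul_pos (by linarith) hlam
    refine ContinuousLinearMap.isUnit_of_forall_le_norm_inner_map _
      (c := ⟨(1 - t) * lam, hc.le⟩) hc fun x ↦ ?_
    refine le_trans ?_ (le_abs_self _)
    have hx : inner ℝ ((B - (1 / μ) • V) x) x
        = lam * ‖x‖ ^ 2 - inner ℝ (A x) x - t * (γ * inner ℝ (V x) x) := by
      rw [htγ, hB]
      simp [inner_sub_left, real_inner_smul_left, mul_assoc]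
    rw [hx]
    change ‖x‖ ^ 2 * ((1 - t) * lam) ≤ _
    nlinarith [mul_le_mul_of_nonneg_left (hform x) ht0.le,
      mul_nonneg (sub_pos.2 ht1).le (neg_nonneg.2 (hA0 x))]

end AbstractHilbert

section LatticeLaplacian

variable {G : Type*} [AddCommGroup G]

theorem lp.summable_mul_of_injective {ι κ : Type*} (f g : lp (fun _ : ι => ℝ) 2) {a b : κ → ι}
    (ha : a.Injective) (hb : b.Injective) : Summable fun q ↦ f (a q) * g (b q) := by
  have hsq (h : lp (fun _ : ι => ℝ) 2) {c : κ → ι} (hc : c.Injective) :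
      Summable fun q ↦ h (c q) ^ 2 := by
    have := (lp.summable_inner (𝕜 := ℝ) h h).comp_injective hc
    simpa [Function.comp_def, pow_two] using this
  refine .of_norm_bounded ((hsq f ha).add (hsq g hb)) fun q ↦ ?_
  rw [Real.norm_eq_abs, abs_mul]
  nlinarith [sq_abs (f (a q)), sq_abs (g (b q)), sq_nonneg (|f (a q)| - |g (b q)|),
    sq_nonneg (f (a q)), sq_nonneg (g (b q))]

/-- The Dirichlet form of the nearest neighbour walk on `G` with steps `±v`. -/
noncomputable def shiftDirichletForm (v : G) (f g : lp (fun _ : G => ℝ) 2) : ℝ :=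
  ∑' q, (f (q + v) - f q) * (g (q + v) - g q)

theorem shiftDirichletForm_comm (v : G) (f g : lp (fun _ : G => ℝ) 2) :
    shiftDirichletForm v f g = shiftDirichletForm v g f :=
  tsum_congr fun _ ↦ mul_comm _ _

theorem shiftDirichletForm_self_nonneg (v : G) (f : lp (fun _ : G => ℝ) 2) :
    0 ≤ shiftDirichletForm v f f :=
  tsum_nonneg fun _ ↦ mul_self_nonneg _

/-- Summation by parts. -/
theorem hasSum_shiftLaplacian_mul (v : G) (f g : lp (fun _ : G => ℝ) 2) :
    HasSum (fun q ↦ ((f (q + v) - f q) + (f (q - v) - f q)) * g q)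
      (-shiftDirichletForm v f g) := by
  have hv : Function.Injective fun q : G ↦ q + v := add_left_injective v
  have hid : Function.Injective fun q : G ↦ q := Function.injective_id
  have h1 : Summable fun q ↦ (f (q + v) - f q) * g q := by
    simp only [sub_mul]
    exact (lp.summable_mul_of_injective f g hv hid).sub
      (lp.summable_mul_of_injective f g hid hid)
  have h2 : Summable fun q ↦ (f q - f (q + v)) * g (q + v) := by
    simp only [sub_mul]
    exact (lp.summable_mul_of_injective f g hid hv).sub
      (lp.summable_mul_of_injective f g hv hv)
  have h3 : HasSum (fun q ↦ (f (q - v) - f q) * g q) (∑' q, (f q - f (q + v)) * g (q + v)) := by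
    rw [← (Equiv.addRight v).hasSum_iff]
    simpa [Function.comp_def] using h2.hasSum
  convert h1.hasSum.add h3 using 1
  · ext q; ring
  · rw [← h1.tsum_add h2, shiftDirichletForm, ← tsum_neg]
    exact tsum_congr fun q ↦ by ring

end LatticeLaplacian

open Filter Topology

/-- Suppose `λ > 0`, `γ > 0` and `λ = sup σ(A²_S + γV²_S)` on the
subspace `S` of symmetric functions of `ℓ²(ℤ^d × ℤ^d)`. Then
`1/γ = sup σ(R_λ V²_S)`, where `R_λ = (λ − A²_S)⁻¹`. -/
theorem sup_spectrum_resolvent_potential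
    (d : ℕ) (hd : 1 ≤ d)
    (κ ρ γ : ℝ) (hκ : 0 < κ) (hρ : 0 < ρ) (hγ : 0 < γ)
    (A2 : lp (fun _ : (Fin d → ℤ) × (Fin d → ℤ) => ℝ) 2 →L[ℝ]
      lp (fun _ : (Fin d → ℤ) × (Fin d → ℤ) => ℝ) 2)
    (hA2 : ∀ (f : lp (fun _ : (Fin d → ℤ) × (Fin d → ℤ) => ℝ) 2)
        (q : (Fin d → ℤ) × (Fin d → ℤ)),
      A2 f q = κ * (∑ j : Fin d,
          ((f (q.1 + Pi.single j 1, q.2) - f q) + (f (q.1 - Pi.single j 1, q.2) - f q)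
            + (f (q.1, q.2 + Pi.single j 1) - f q) + (f (q.1, q.2 - Pi.single j 1) - f q)))
        + ρ * (∑ j : Fin d,
          ((f (q.1 + Pi.single j 1, q.2 + Pi.single j 1) - f q)
            + (f (q.1 - Pi.single j 1, q.2 - Pi.single j 1) - f q))))
    (V2 : lp (fun _ : (Fin d → ℤ) × (Fin d → ℤ) => ℝ) 2 →L[ℝ]
      lp (fun _ : (Fin d → ℤ) × (Fin d → ℤ) => ℝ) 2)
    (hV2 : ∀ (f : lp (fun _ : (Fin d → ℤ) × (Fin d → ℤ) => ℝ) 2)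
        (q : (Fin d → ℤ) × (Fin d → ℤ)),
      V2 f q = ((if q.1 = 0 then (1:ℝ) else 0) + (if q.2 = 0 then (1:ℝ) else 0)) * f q)
    (S : Submodule ℝ (lp (fun _ : (Fin d → ℤ) × (Fin d → ℤ) => ℝ) 2))
    (hS : ∀ f : lp (fun _ : (Fin d → ℤ) × (Fin d → ℤ) => ℝ) 2,
      f ∈ S ↔ ∀ a b : Fin d → ℤ, f (a, b) = f (b, a))
    (A2S V2S : S →L[ℝ] S)
    (hA2S : ∀ v : S, (A2S v : lp (fun _ : (Fin d → ℤ) × (Fin d → ℤ) => ℝ) 2)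
      = A2 (v : lp (fun _ : (Fin d → ℤ) × (Fin d → ℤ) => ℝ) 2))
    (hV2S : ∀ v : S, (V2S v : lp (fun _ : (Fin d → ℤ) × (Fin d → ℤ) => ℝ) 2)
      = V2 (v : lp (fun _ : (Fin d → ℤ) × (Fin d → ℤ) => ℝ) 2))
    (lam : ℝ) (hlam : 0 < lam)
    (R : S →L[ℝ] S)
    (hR₁ : R ∘L (lam • (1 : S →L[ℝ] S) - A2S) = 1)
    (hR₂ : (lam • (1 : S →L[ℝ] S) - A2S) ∘L R = 1)
    (hsup : lam = sSup (spectrum ℝ (A2S + γ • V2S))) :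
    1 / γ = sSup (spectrum ℝ (R ∘L V2S)) := by
  have hclosed : IsClosed (S : Set (lp (fun _ : (Fin d → ℤ) × (Fin d → ℤ) => ℝ) 2)) := by
    have : (S : Set (lp (fun _ : (Fin d → ℤ) × (Fin d → ℤ) => ℝ) 2))
        = ⋂ a : Fin d → ℤ, ⋂ b : Fin d → ℤ, {f | f (a, b) = f (b, a)} := by
      ext f
      simp [hS f]
    rw [this]
    exact isClosed_iInter fun a ↦ isClosed_iInter fun b ↦ isClosed_eq
      (lp.evalCLM ℝ (fun _ : (Fin d → ℤ) × (Fin d → ℤ) => ℝ) 2 (a, b)).continuous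
      (lp.evalCLM ℝ (fun _ : (Fin d → ℤ) × (Fin d → ℤ) => ℝ) 2 (b, a)).continuous
  have : CompleteSpace S := hclosed.completeSpace_coe
  have hAform (f g : lp (fun _ : (Fin d → ℤ) × (Fin d → ℤ) => ℝ) 2) :
      inner ℝ (A2 f) g = -(κ * (∑ j : Fin d,
          (shiftDirichletForm (Pi.single j 1, 0) f g + shiftDirichletForm (0, Pi.single j 1) f g))
        + ρ * (∑ j : Fin d, shiftDirichletForm (Pi.single j 1, Pi.single j 1) f g)) := by
    have h1 := ((hasSum_sum (s := Finset.univ) fun (j : Fin d) _ ↦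
      (hasSum_shiftLaplacian_mul (Pi.single j (1 : ℤ), (0 : Fin d → ℤ)) f g).add
        (hasSum_shiftLaplacian_mul ((0 : Fin d → ℤ), Pi.single j (1 : ℤ)) f g)).mul_left κ).add
      ((hasSum_sum (s := Finset.univ) fun (j : Fin d) _ ↦
        hasSum_shiftLaplacian_mul (Pi.single j (1 : ℤ), Pi.single j (1 : ℤ)) f g).mul_left ρ)
    refine (lp.hasSum_inner (𝕜 := ℝ) (A2 f) g).unique ?_
    convert! h1 using 1
    · ext q
      obtain ⟨a, b⟩ := q
      rw [hA2]
      simp only [RCLike.inner_apply, conj_trivial, Prod.mk_add_mk, Prod.mk_sub_mk, add_zero,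
        sub_zero, Finset.mul_sum, mul_add, Finset.sum_add_distrib]
      simp only [← Finset.sum_add_distrib]
      exact Finset.sum_congr rfl fun j _ ↦ by ring
    · simp only [Finset.sum_add_distrib, Finset.sum_neg_distrib]
      ring
  refine one_div_eq_sSup_spectrum_resolvent_comp (A := A2S) (fun x y ↦ ?_) (fun x ↦ ?_)
    (fun x y ↦ ?_) hlam hγ hR₁ hR₂ hsup
  · simp only [ContinuousLinearMap.coe_coe, Submodule.coe_inner, hA2S]
    rw [real_inner_comm _ (x : lp (fun _ : (Fin d → ℤ) × (Fin d → ℤ) => ℝ) 2), hAform, hAform]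
    simp only [shiftDirichletForm_comm _ (x : lp (fun _ : (Fin d → ℤ) × (Fin d → ℤ) => ℝ) 2)]
  · rw [Submodule.coe_inner, hA2S, hAform, neg_nonpos]
    have h (v : (Fin d → ℤ) × (Fin d → ℤ)) := shiftDirichletForm_self_nonneg v
      (x : lp (fun _ : (Fin d → ℤ) × (Fin d → ℤ) => ℝ) 2)
    exact add_nonneg
      (mul_nonneg hκ.le (Finset.sum_nonneg fun j _ ↦ add_nonneg (h _) (h _)))
      (mul_nonneg hρ.le (Finset.sum_nonneg fun j _ ↦ h _))
  · simp only [ContinuousLinearMap.coe_coe, Submodule.coe_inner, hV2S, lp.inner_eq_tsum]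
    refine tsum_congr fun q ↦ ?_
    simp only [hV2, RCLike.inner_apply, conj_trivial]
    ring
end
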